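/- arXiv:2502.03105 — 6 statements merged into one kernel-verified Lean document; each statement's English description precedes it below -/
import Mathlib

section
/- Let n ≥ 4, k ≥ 2, s ≥ 2 be integers and let F ⊆ [n]^k with |F| = (s−1)·n^{k−1} + 1. Let p_F be the probability that |F ∩ M| ≠ s−1 for a uniformly random perfect matching M in [n]^k, and assume p_F < 1/8. Fix i ∈ [k]. Then at least one of the following holds: (a) for every a ∈ [n], |H_i(a) ∩ F| ≤ 2·p_F·n^{k−1} + (s−1)·n^{k−2}; or (b) for every a ∈ [n], either |H_i(a) ∩ F| ≥ (1 − 2p_F)·n^{k−1} (the hyperplane H_i(a) is F-fat) or |H_i(a) ∩ F| ≤ 2·p_F·n^{k−1} (the hyperplane H_i(a) is F-thin). -/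
/-- The perfect matching of `[n]^k` determined by a tuple of permutations `σ`:
its members are the tuples `(σ 0 t, …, σ (k-1) t)` for `t ∈ [n]`. Every perfect
matching arises this way, each from exactly `n!` tuples `σ`, so uniform probabilities
over perfect matchings agree with uniform probabilities over `σ`. -/
def matchingOf {n k : ℕ} (σ : Fin k → Equiv.Perm (Fin n)) : Finset (Fin k → Fin n) :=
  Finset.univ.image (fun t : Fin n => fun j : Fin k => σ j t)

/-- `pFrac n k s F` is the probability that `|F ∩ M| ≠ s - 1` for a uniformly random
perfect matching `M` of `[n]^k`. -/
noncomputable def pFrac (n k s : ℕ) (F : Finset (Fin k → Fin n)) : ℝ :=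
  ((Finset.univ.filter
      (fun σ : Fin k → Equiv.Perm (Fin n) => (F ∩ matchingOf σ).card ≠ s - 1)).card : ℝ) /
    ((Finset.univ : Finset (Fin k → Equiv.Perm (Fin n))).card : ℝ)

/-- The indicator of coordinatewise disjointness of two tuples. -/
def disjInd {m n : ℕ} (x y : Fin m → Fin n) : ℝ := ∏ j, if x j = y j then 0 else 1

/-- The quadratic form of the graph of disjoint pairs of tuples. -/
def disjForm {m n : ℕ} (f : (Fin m → Fin n) → ℝ) : ℝ := ∑ x, ∑ y, disjInd x y * (f x * f y)

lemma disjInd_nonneg {m n : ℕ} (x y : Fin m → Fin n) : 0 ≤ disjInd x y :=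
  Finset.prod_nonneg fun j _ => by split_ifs <;> norm_num

lemma disjInd_comm {m n : ℕ} (x y : Fin m → Fin n) : disjInd x y = disjInd y x :=
  Finset.prod_congr rfl fun j _ => by simp only [eq_comm]

lemma disjInd_cons {m n : ℕ} (u v : Fin n) (x y : Fin m → Fin n) :
    disjInd (Fin.cons u x : Fin (m + 1) → Fin n) (Fin.cons v y) =
      (if u = v then 0 else 1) * disjInd x y := by
  simp [disjInd, Fin.prod_univ_succ]

lemma sum_disjInd {m n : ℕ} (x : Fin m → Fin n) : ∑ y, disjInd x y = ((n : ℝ) - 1) ^ m := by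
  have h := Finset.prod_univ_sum (fun _ : Fin m => (Finset.univ : Finset (Fin n)))
    (fun j v => if x j = v then (0 : ℝ) else 1)
  rw [Fintype.piFinset_univ] at h
  unfold disjInd
  rw [← h]
  have h1 : ∀ u : Fin n, ∑ v : Fin n, (if u = v then (0 : ℝ) else 1) = n - 1 := by
    intro u
    have h2 : ∀ v : Fin n, (if u = v then (0 : ℝ) else 1) = 1 - if u = v then 1 else 0 := by
      intro v; split_ifs <;> norm_num
    simp [h2]
  simp [h1]

lemma sum_fin_cons {m n : ℕ} (f : (Fin (m + 1) → Fin n) → ℝ) :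
    ∑ x, f x = ∑ u : Fin n, ∑ x : Fin m → Fin n, f (Fin.cons u x) := by
  rw [← (Fin.consEquiv fun _ : Fin (m + 1) => Fin n).sum_comp, Fintype.sum_prod_type]
  rfl

lemma sum_mul_sub_mean {n : ℕ} (hn : (n : ℝ) ≠ 0) (a b : Fin n → ℝ) :
    ∑ u, (a u - (∑ w, a w) / n) * (b u - (∑ w, b w) / n) =
      ∑ u, a u * b u - (∑ w, a w) * (∑ w, b w) / n := by
  simp only [sub_mul, mul_sub, Finset.sum_sub_distrib, ← Finset.mul_sum, ← Finset.sum_mul,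
    Finset.sum_const, Finset.card_univ, Fintype.card_fin, nsmul_eq_mul]
  field_simp
  ring

/-- The quadratic form of the disjointness graph, split along the first coordinate into the mean
part and the mean-zero part. -/
lemma disjForm_succ {m n : ℕ} (hn : (n : ℝ) ≠ 0) (f : (Fin (m + 1) → Fin n) → ℝ) :
    disjForm f = (n - 1) / n * disjForm (fun x => ∑ u, f (Fin.cons u x)) -
      ∑ u, disjForm (fun x => f (Fin.cons u x) - (∑ w, f (Fin.cons w x)) / n) := by
  have h1 : ∑ u, disjForm (fun x => f (Fin.cons u x) - (∑ w, f (Fin.cons w x)) / n) =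
      ∑ x, ∑ y, disjInd x y * (∑ u, f (Fin.cons u x) * f (Fin.cons u y) -
        (∑ w, f (Fin.cons w x)) * (∑ w, f (Fin.cons w y)) / n) := by
    simp only [disjForm]
    rw [Finset.sum_comm]
    refine Finset.sum_congr rfl fun x _ => ?_
    rw [Finset.sum_comm]
    refine Finset.sum_congr rfl fun y _ => ?_
    rw [← Finset.mul_sum, sum_mul_sub_mean hn]
  have h2 : disjForm f = ∑ x, ∑ y, disjInd x y * ((∑ w, f (Fin.cons w x)) *
      (∑ w, f (Fin.cons w y)) - ∑ u, f (Fin.cons u x) * f (Fin.cons u y)) := by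
    rw [disjForm, sum_fin_cons, Finset.sum_comm]
    refine Finset.sum_congr rfl fun x _ => ?_
    simp_rw [sum_fin_cons]
    have h3 : ∀ u, ∑ v, ∑ y, disjInd (Fin.cons u x : Fin (m + 1) → Fin n) (Fin.cons v y) *
        (f (Fin.cons u x) * f (Fin.cons v y)) =
        ∑ y, ∑ v, disjInd (Fin.cons u x : Fin (m + 1) → Fin n) (Fin.cons v y) *
        (f (Fin.cons u x) * f (Fin.cons v y)) := fun u => Finset.sum_comm
    simp_rw [h3]
    rw [Finset.sum_comm]
    refine Finset.sum_congr rfl fun y _ => ?_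
    simp only [disjInd_cons]
    rw [Finset.sum_mul_sum, mul_sub, Finset.mul_sum, Finset.mul_sum, ← Finset.sum_sub_distrib]
    refine Finset.sum_congr rfl fun u _ => ?_
    have h4 : ∀ v, (if u = v then (0 : ℝ) else 1) * disjInd x y *
        (f (Fin.cons u x) * f (Fin.cons v y)) =
        disjInd x y * (f (Fin.cons u x) * f (Fin.cons v y)) -
        if u = v then disjInd x y * (f (Fin.cons u x) * f (Fin.cons v y)) else 0 := by
      intro v; split_ifs <;> ring
    simp_rw [h4]
    simp [Finset.mul_sum]
  rw [h1, h2, disjForm, Finset.mul_sum, ← Finset.sum_sub_distrib]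
  refine Finset.sum_congr rfl fun x _ => ?_
  rw [Finset.mul_sum, ← Finset.sum_sub_distrib]
  refine Finset.sum_congr rfl fun y _ => ?_
  field_simp
  ring

lemma sum_sq_succ {m n : ℕ} (hn : (n : ℝ) ≠ 0) (f : (Fin (m + 1) → Fin n) → ℝ) :
    ∑ x, f x ^ 2 = (∑ x : Fin m → Fin n, (∑ u, f (Fin.cons u x)) ^ 2) / n +
      ∑ u, ∑ x : Fin m → Fin n, (f (Fin.cons u x) - (∑ w, f (Fin.cons w x)) / n) ^ 2 := by
  rw [sum_fin_cons, Finset.sum_comm, Finset.sum_comm (s := (Finset.univ : Finset (Fin n))),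
    Finset.sum_div, ← Finset.sum_add_distrib]
  refine Finset.sum_congr rfl fun x _ => ?_
  have h := sum_mul_sub_mean hn (fun u => f (Fin.cons u x)) (fun u => f (Fin.cons u x))
  simp only [← pow_two] at h
  rw [h]
  ring

lemma disjForm_le {m n : ℕ} (f : (Fin m → Fin n) → ℝ) :
    disjForm f ≤ ((n : ℝ) - 1) ^ m * ∑ x, f x ^ 2 := by
  have h1 : disjForm f ≤ ∑ x, ∑ y, (disjInd x y * (f x ^ 2 / 2) + disjInd x y * (f y ^ 2 / 2)) := by
    refine Finset.sum_le_sum fun x _ => Finset.sum_le_sum fun y _ => ?_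
    rw [← mul_add]
    exact mul_le_mul_of_nonneg_left (by nlinarith [sq_nonneg (f x - f y)]) (disjInd_nonneg x y)
  refine h1.trans (le_of_eq ?_)
  simp only [Finset.sum_add_distrib]
  rw [Finset.sum_comm (f := fun x y => disjInd x y * (f y ^ 2 / 2))]
  simp only [← Finset.sum_mul]
  have h2 : ∀ y : Fin m → Fin n, ∑ x, disjInd x y = ((n : ℝ) - 1) ^ m := fun y => by
    rw [← sum_disjInd y]; exact Finset.sum_congr rfl fun x _ => disjInd_comm x y
  simp only [h2, sum_disjInd, ← Finset.mul_sum, ← Finset.sum_div]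
  ring

lemma neg_le_disjForm {m n : ℕ} (hn : 2 ≤ n) (f : (Fin m → Fin n) → ℝ) :
    -(((n : ℝ) - 1) ^ m * ∑ x, f x ^ 2) ≤ (n - 1) * disjForm f := by
  have hn' : (2 : ℝ) ≤ n := by exact_mod_cast hn
  have hd : (0 : ℝ) ≤ n - 1 := by linarith
  induction m with
  | zero =>
    have : 0 ≤ disjForm f := by
      simpa [disjForm, disjInd] using mul_self_nonneg _
    have h2 : 0 ≤ ∑ x, f x ^ 2 := Finset.sum_nonneg fun x _ => sq_nonneg _
    nlinarith
  | succ m ih =>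
    rw [disjForm_succ (by positivity), sum_sq_succ (by positivity)]
    have h1 := ih (fun x => ∑ u, f (Fin.cons u x))
    have h2 := Finset.sum_le_sum fun u (_ : u ∈ Finset.univ) =>
      disjForm_le (fun x : Fin m → Fin n => f (Fin.cons u x) - (∑ w, f (Fin.cons w x)) / n)
    rw [← Finset.mul_sum] at h2
    have h3 := mul_le_mul_of_nonneg_left h2 hd
    have h4 := mul_le_mul_of_nonneg_left h1 (show (0 : ℝ) ≤ (n - 1) / n by positivity)
    calc _ = (n - 1) / n * -(((n : ℝ) - 1) ^ m * ∑ x, (∑ u, f (Fin.cons u x)) ^ 2) -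
          (n - 1) * (((n : ℝ) - 1) ^ m * ∑ u, ∑ x : Fin m → Fin n,
            (f (Fin.cons u x) - (∑ w, f (Fin.cons w x)) / n) ^ 2) := by ring
      _ ≤ _ := sub_le_sub h4 h3
      _ = _ := by ring

/-- A spectral gap bound for the disjointness graph on `[n]^m`. -/
lemma disjForm_le_of_three_le {m n : ℕ} (hn : 3 ≤ n) (f : (Fin m → Fin n) → ℝ) :
    disjForm f ≤ ((n : ℝ) - 1) ^ m *
      (1 / 4 * ∑ x, f x ^ 2 + 3 / 4 * ((∑ x, f x) ^ 2 / (n : ℝ) ^ m)) := by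
  have hn' : (3 : ℝ) ≤ n := by exact_mod_cast hn
  have hd : (0 : ℝ) < n - 1 := by linarith
  induction m with
  | zero =>
    apply le_of_eq
    simp [disjForm, disjInd]
    ring
  | succ m ih =>
    rw [disjForm_succ (by positivity), sum_sq_succ (by positivity)]
    have h1 := mul_le_mul_of_nonneg_left (ih (fun x => ∑ u, f (Fin.cons u x)))
      (show (0 : ℝ) ≤ (n - 1) / n by positivity)
    have h2 := Finset.sum_le_sum fun u (_ : u ∈ Finset.univ) =>
      neg_le_disjForm (by omega : 2 ≤ n)
        (fun x : Fin m → Fin n => f (Fin.cons u x) - (∑ w, f (Fin.cons w x)) / n)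
    rw [← Finset.mul_sum, Finset.sum_neg_distrib, ← Finset.mul_sum] at h2
    have hL : ∑ x : Fin m → Fin n, ∑ u, f (Fin.cons u x) = ∑ x, f x := by
      rw [sum_fin_cons, Finset.sum_comm]
    rw [hL] at h1
    set S' := ∑ u, ∑ x : Fin m → Fin n, (f (Fin.cons u x) - (∑ w, f (Fin.cons w x)) / n) ^ 2
    have hS' : 0 ≤ S' := Finset.sum_nonneg fun u _ => Finset.sum_nonneg fun x _ => sq_nonneg _
    have h3 : -∑ u, disjForm (fun x : Fin m → Fin n =>
        f (Fin.cons u x) - (∑ w, f (Fin.cons w x)) / n) ≤ (n - 1) ^ (m + 1) * (1 / 4 * S') := by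
      have h5 : (0 : ℝ) ≤ (n - 1) ^ m * S' := by positivity
      refine le_of_mul_le_mul_left ?_ hd
      have h6 : (n - 1) ^ m * S' * 1 ≤ (n - 1) ^ m * S' * (((n : ℝ) - 1) ^ 2 / 4) :=
        mul_le_mul_of_nonneg_left (by nlinarith) h5
      calc _ ≤ (n - 1) ^ m * S' * 1 := by linarith
        _ ≤ _ := h6
        _ = _ := by ring
    calc _ ≤ _ := add_le_add h1 h3
      _ = _ := by
        rw [pow_succ, pow_succ]
        field_simp
        ring

/-- If `g` takes equal values on most disjoint pairs then it is constant on most tuples. -/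
lemma exists_value_of_sum_disjInd_le {m n : ℕ} (hn : 3 ≤ n) (g : (Fin m → Fin n) → ℤ) {p : ℝ}
    (hp : p < 1 / 8)
    (h : ∑ x, ∑ y, disjInd x y * (if g x = g y then 0 else 1) ≤
      2 * p * ((n : ℝ) ^ m * ((n : ℝ) - 1) ^ m)) :
    ∃ v, (1 - 2 * p) * (n : ℝ) ^ m ≤ ((Finset.univ.filter fun x => g x = v).card : ℝ) := by
  have hn' : (3 : ℝ) ≤ n := by exact_mod_cast hn
  have hd : (0 : ℝ) < (n - 1) ^ m := pow_pos (by linarith) m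
  have hN : (0 : ℝ) < (n : ℝ) ^ m := by positivity
  set N : ℝ := (n : ℝ) ^ m with hNdef
  set D : ℝ := ((n : ℝ) - 1) ^ m with hDdef
  set c : ℤ → ℝ := fun v => ((Finset.univ.filter fun x => g x = v).card : ℝ) with hc
  have hcsum : ∀ v, ∑ x, (if g x = v then (1 : ℝ) else 0) = c v := fun v => by simp [hc]
  have hc0 : ∀ v, 0 ≤ c v := fun v => Nat.cast_nonneg _
  have hQ : ∀ v, disjForm (fun x => if g x = v then (1 : ℝ) else 0) ≤
      D * (1 / 4 * c v + 3 / 4 * (c v ^ 2 / N)) := by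
    intro v
    have := disjForm_le_of_three_le hn (fun x => if g x = v then (1 : ℝ) else 0)
    simpa only [ite_pow, one_pow, ne_eq, OfNat.ofNat_ne_zero, not_false_eq_true, zero_pow,
      hcsum] using this
  set V := Finset.univ.image g with hV
  have hVne : V.Nonempty := by
    have : NeZero n := ⟨by omega⟩
    exact Finset.univ_nonempty.image g
  have hctot : ∑ v ∈ V, c v = N := by
    have := Finset.card_eq_sum_card_image g Finset.univ
    simp only [Finset.card_univ, Fintype.card_pi, Fintype.card_fin, Finset.prod_const] at this
    simp only [hNdef, hc]
    exact_mod_cast this.symm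
  obtain ⟨v, hv, hmax⟩ := Finset.exists_max_image V c hVne
  refine ⟨v, ?_⟩
  change _ ≤ c v
  have hcN : c v ≤ N := hctot ▸ Finset.single_le_sum (fun w _ => hc0 w) hv
  have htot : ∑ x : Fin m → Fin n, ∑ y, disjInd x y = N * D := by
    simp [sum_disjInd, hNdef, hDdef]
  have hsame : ∑ x, ∑ y, disjInd x y * (if g x = g y then 1 else 0) =
      ∑ v ∈ V, disjForm (fun x => if g x = v then (1 : ℝ) else 0) := by
    simp only [disjForm]
    rw [Finset.sum_comm (s := V)]
    refine Finset.sum_congr rfl fun x _ => ?_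
    rw [Finset.sum_comm (s := V)]
    refine Finset.sum_congr rfl fun y _ => ?_
    rw [← Finset.mul_sum]
    congr 1
    have : ∀ w, (if g x = w then (1 : ℝ) else 0) * (if g y = w then 1 else 0) =
        if g x = w then (if g x = g y then 1 else 0) else 0 := by
      intro w; split_ifs <;> simp_all
    simp_rw [this]
    rw [Finset.sum_ite_eq, if_pos (Finset.mem_image_of_mem g (Finset.mem_univ x))]
  have hadd : ∑ x, ∑ y, disjInd x y * (if g x = g y then 1 else 0) +
      ∑ x, ∑ y, disjInd x y * (if g x = g y then 0 else 1) = N * D := by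
    rw [← htot, ← Finset.sum_add_distrib]
    refine Finset.sum_congr rfl fun x _ => ?_
    rw [← Finset.sum_add_distrib]
    refine Finset.sum_congr rfl fun y _ => ?_
    split_ifs <;> simp
  have h1 : ∑ v ∈ V, disjForm (fun x => if g x = v then (1 : ℝ) else 0) ≤
      D * (1 / 4 * N + 3 / 4 * c v) := by
    calc _ ≤ ∑ w ∈ V, D * (1 / 4 * c w + 3 / 4 * (c v * c w / N)) := by
          refine Finset.sum_le_sum fun w hw => (hQ w).trans ?_
          have : c w ^ 2 ≤ c v * c w := by
            rw [pow_two]; exact mul_le_mul_of_nonneg_right (hmax w hw) (hc0 w)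
          gcongr
      _ = D * (1 / 4 * ∑ w ∈ V, c w + 3 / 4 * (c v * (∑ w ∈ V, c w) / N)) := by
          simp only [← Finset.mul_sum, Finset.sum_add_distrib, ← Finset.sum_div]
      _ = _ := by rw [hctot]; field_simp
  have h2 : (1 - 2 * p) * N ≤ 1 / 4 * N + 3 / 4 * c v := by
    refine le_of_mul_le_mul_left ?_ hd
    linarith
  have h3 : 2 * (D * c v - disjForm (fun x => if g x = v then (1 : ℝ) else 0)) ≤
      ∑ x, ∑ y, disjInd x y * (if g x = g y then 0 else 1) := by
    have hl : ∑ x, ∑ y, disjInd x y * (if g x = v then (1 : ℝ) else 0) = D * c v := by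
      simp only [← Finset.sum_mul, sum_disjInd, ← Finset.mul_sum, hcsum, hDdef]
    have hr : ∑ x, ∑ y, disjInd x y * (if g y = v then (1 : ℝ) else 0) = D * c v := by
      rw [Finset.sum_comm, ← hl]
      exact Finset.sum_congr rfl fun x _ => Finset.sum_congr rfl fun y _ => by
        rw [disjInd_comm]
    have : 2 * (D * c v - disjForm (fun x => if g x = v then (1 : ℝ) else 0)) =
        ∑ x, ∑ y, disjInd x y * ((if g x = v then (1 : ℝ) else 0) +
          (if g y = v then (1 : ℝ) else 0) -
          2 * ((if g x = v then (1 : ℝ) else 0) * (if g y = v then (1 : ℝ) else 0))) := by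
      simp only [mul_sub, mul_add, Finset.sum_sub_distrib, Finset.sum_add_distrib, hl, hr]
      simp only [mul_left_comm _ (2 : ℝ), ← Finset.mul_sum]
      rw [disjForm]
      ring
    rw [this]
    refine Finset.sum_le_sum fun x _ => Finset.sum_le_sum fun y _ =>
      mul_le_mul_of_nonneg_left ?_ (disjInd_nonneg x y)
    by_cases hxy : g x = g y
    · rw [if_pos hxy, hxy]
      split_ifs <;> norm_num
    · rw [if_neg hxy]
      split_ifs <;> norm_num
  have h4 : 3 / 4 * (c v * (N - c v)) ≤ p * N * N := by
    have h5 := hQ v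
    have h6 : D * (2 * (3 / 4 * (c v - c v ^ 2 / N))) ≤ D * (2 * (p * N)) := by linarith
    have h7 := le_of_mul_le_mul_left h6 hd
    have h8 : 3 / 4 * (c v - c v ^ 2 / N) ≤ p * N := by linarith
    calc _ = 3 / 4 * (c v - c v ^ 2 / N) * N := by field_simp
      _ ≤ _ := mul_le_mul_of_nonneg_right h8 hN.le
  have hpN : p * N < 1 / 8 * N := mul_lt_mul_of_pos_right hp hN
  have h9 : 2 / 3 * N ≤ c v := by linarith
  have h10 : 2 / 3 * N * (N - c v) ≤ c v * (N - c v) :=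
    mul_le_mul_of_nonneg_right h9 (by linarith)
  have h11 : N * (N - c v) ≤ N * (2 * p * N) := by linarith
  linarith [le_of_mul_le_mul_left h11 hN]

/-- The point other than its `i`-th coordinate of the matching of `σ` with `i`-th coordinate `c`. -/
def matchingLink {m n : ℕ} (i : Fin (m + 1)) (σ : Fin (m + 1) → Equiv.Perm (Fin n)) (c : Fin n) :
    Fin m → Fin n :=
  fun j => σ (i.succAbove j) ((σ i)⁻¹ c)

lemma card_inter_matchingOf {m n : ℕ} (i : Fin (m + 1)) (F : Finset (Fin (m + 1) → Fin n))
    (σ : Fin (m + 1) → Equiv.Perm (Fin n)) :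
    (F ∩ matchingOf σ).card =
      ∑ c : Fin n, if i.insertNth c (matchingLink i σ c) ∈ F then 1 else 0 := by
  have hinj : Function.Injective (fun c : Fin n => (i.insertNth c (matchingLink i σ c) :
      Fin (m + 1) → Fin n)) := by
    intro c d h
    simpa using congrFun h i
  have himg : matchingOf σ = Finset.univ.image
      (fun c : Fin n => (i.insertNth c (matchingLink i σ c) : Fin (m + 1) → Fin n)) := by
    have hpt : ∀ t, (i.insertNth (σ i t) (matchingLink i σ (σ i t)) : Fin (m + 1) → Fin n) =
        fun j => σ j t := by
      intro t
      rw [Fin.insertNth_eq_iff]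
      refine ⟨rfl, ?_⟩
      funext j
      simp [matchingLink, Fin.removeNth]
    ext x
    simp only [matchingOf, Finset.mem_image, Finset.mem_univ, true_and]
    constructor
    · rintro ⟨t, rfl⟩
      exact ⟨σ i t, hpt t⟩
    · rintro ⟨c, rfl⟩
      refine ⟨(σ i)⁻¹ c, ?_⟩
      rw [← hpt]
      simp
  rw [← Finset.card_filter, himg, Finset.inter_comm, ← Finset.filter_mem_eq_inter,
    Finset.filter_image, Finset.card_image_of_injective _ hinj]

/-- Exchanging the `i`-th coordinates `a` and `b`. -/
def swapAt {m n : ℕ} (i : Fin (m + 1)) (a b : Fin n) (σ : Fin (m + 1) → Equiv.Perm (Fin n)) :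
    Fin (m + 1) → Equiv.Perm (Fin n) :=
  Function.update σ i (Equiv.swap a b * σ i)

lemma swapAt_involutive {m n : ℕ} (i : Fin (m + 1)) (a b : Fin n) :
    Function.Involutive (swapAt i a b) := by
  intro σ
  simp [swapAt, ← mul_assoc]

lemma matchingLink_swapAt {m n : ℕ} (i : Fin (m + 1)) (a b c : Fin n)
    (σ : Fin (m + 1) → Equiv.Perm (Fin n)) :
    matchingLink i (swapAt i a b σ) c = matchingLink i σ (Equiv.swap a b c) := by
  funext j
  simp [matchingLink, swapAt]

/-- The difference at `x` of the indicators of the links of `a` and `b` in `F`. -/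
def linkDiff {m n : ℕ} (i : Fin (m + 1)) (F : Finset (Fin (m + 1) → Fin n)) (a b : Fin n)
    (x : Fin m → Fin n) : ℤ :=
  (if i.insertNth a x ∈ F then 1 else 0) - (if i.insertNth b x ∈ F then 1 else 0)

lemma linkDiff_eq_of_card_eq {m n : ℕ} (i : Fin (m + 1)) (F : Finset (Fin (m + 1) → Fin n))
    {a b : Fin n} (hab : a ≠ b) (σ : Fin (m + 1) → Equiv.Perm (Fin n))
    (h : (F ∩ matchingOf σ).card = (F ∩ matchingOf (swapAt i a b σ)).card) :
    linkDiff i F a b (matchingLink i σ a) = linkDiff i F a b (matchingLink i σ b) := by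
  rw [card_inter_matchingOf i, card_inter_matchingOf i] at h
  simp only [matchingLink_swapAt] at h
  have hb : b ∈ (Finset.univ : Finset (Fin n)).erase a := by simp [hab.symm]
  rw [← Finset.add_sum_erase _ _ (Finset.mem_univ a), ← Finset.add_sum_erase _ _ hb,
    ← Finset.add_sum_erase _ _ (Finset.mem_univ a), ← Finset.add_sum_erase _ _ hb] at h
  have hrest : ∑ c ∈ ((Finset.univ : Finset (Fin n)).erase a).erase b,
      (if i.insertNth c (matchingLink i σ (Equiv.swap a b c)) ∈ F then 1 else 0) =
      ∑ c ∈ ((Finset.univ : Finset (Fin n)).erase a).erase b,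
      (if i.insertNth c (matchingLink i σ c) ∈ F then 1 else 0) := by
    refine Finset.sum_congr rfl fun c hc => ?_
    simp only [Finset.mem_erase, Finset.mem_univ, and_true] at hc
    rw [Equiv.swap_apply_of_ne_of_ne hc.2 hc.1]
  rw [hrest, Equiv.swap_apply_left, Equiv.swap_apply_right] at h
  simp only [linkDiff]
  zify at h
  linarith

lemma exists_perm_apply_eq_and {n : ℕ} {u v u' v' : Fin n} (h : u ≠ v) (h' : u' ≠ v') :
    ∃ π : Equiv.Perm (Fin n), π u = u' ∧ π v = v' := by
  refine ⟨Equiv.swap (Equiv.swap u u' v) v' * Equiv.swap u u', ?_, by simp⟩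
  have h1 : u' ≠ Equiv.swap u u' v := fun h2 => by
    have := congrArg (Equiv.swap u u') h2
    simp at this
    exact h this
  simp [Equiv.swap_apply_of_ne_of_ne h1 h']

/-- Two fixed points of a random perfect matching form a uniformly random disjoint pair. -/
lemma exists_sum_matchingLink_eq {m n : ℕ} (hn : 2 ≤ n) (i : Fin (m + 1)) {a b : Fin n}
    (hab : a ≠ b) :
    ∃ K : ℝ, ∀ φ : (Fin m → Fin n) → (Fin m → Fin n) → ℝ,
      ∑ σ, φ (matchingLink i σ a) (matchingLink i σ b) = K * ∑ x, ∑ y, disjInd x y * φ x y := by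
  classical
  let C : (Fin m → Fin n) → (Fin m → Fin n) → ℕ := fun x y =>
    (Finset.univ.filter fun σ : Fin (m + 1) → Equiv.Perm (Fin n) =>
      matchingLink i σ a = x ∧ matchingLink i σ b = y).card
  have hle : ∀ x y x' y', (∀ j, x j ≠ y j) → (∀ j, x' j ≠ y' j) → C x y ≤ C x' y' := by
    intro x y x' y' h h'
    choose π hπ using fun j => exists_perm_apply_eq_and (h j) (h' j)
    refine Finset.card_le_card_of_injOn (fun σ => (i.insertNth 1 π : Fin (m + 1) → _) * σ) ?_
      (mul_right_injective _).injOn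
    intro σ hσ
    simp only [Finset.coe_filter, Finset.mem_univ, true_and, Set.mem_ofPred_eq] at hσ ⊢
    obtain ⟨rfl, rfl⟩ := hσ
    constructor
    · funext j
      rw [← (hπ j).1]
      simp [matchingLink]
    · funext j
      rw [← (hπ j).2]
      simp [matchingLink]
  have hzero : ∀ x y, ¬ (∀ j, x j ≠ y j) → C x y = 0 := by
    intro x y h
    rw [Finset.card_eq_zero, Finset.filter_eq_empty_iff]
    rintro σ - ⟨rfl, rfl⟩
    apply h
    intro j hj
    simp only [matchingLink, EmbeddingLike.apply_eq_iff_eq] at hj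
    exact hab hj
  refine ⟨C (fun _ => ⟨0, by omega⟩) (fun _ => ⟨1, by omega⟩), fun φ => ?_⟩
  have hC : ∀ x y, (C x y : ℝ) =
      C (fun _ => ⟨0, by omega⟩) (fun _ => ⟨1, by omega⟩) * disjInd x y := by
    intro x y
    by_cases h : ∀ j, x j ≠ y j
    · have : disjInd x y = 1 := Finset.prod_eq_one fun j _ => if_neg (h j)
      rw [this, mul_one, Nat.cast_inj]
      exact le_antisymm (hle _ _ _ _ h (by simp)) (hle _ _ _ _ (by simp) h)
    · have h0 : disjInd x y = 0 := by
        push Not at h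
        obtain ⟨j, hj⟩ := h
        exact Finset.prod_eq_zero (Finset.mem_univ j) (if_pos hj)
      rw [hzero x y h, h0]
      simp
  have hexp : ∀ σ, φ (matchingLink i σ a) (matchingLink i σ b) =
      ∑ x, ∑ y, if matchingLink i σ a = x ∧ matchingLink i σ b = y then φ x y else 0 := by
    intro σ
    simp [ite_and]
  simp_rw [hexp]
  rw [Finset.sum_comm, Finset.mul_sum]
  refine Finset.sum_congr rfl fun x _ => ?_
  rw [Finset.sum_comm, Finset.mul_sum]
  refine Finset.sum_congr rfl fun y _ => ?_
  rw [← Finset.sum_filter, Finset.sum_const, nsmul_eq_mul, ← mul_assoc, ← hC]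

lemma pFrac_nonneg (n k s : ℕ) (F : Finset (Fin k → Fin n)) : 0 ≤ pFrac n k s F := by
  unfold pFrac
  positivity

/-- The difference of two links takes a single value outside a set of density `2 * pFrac`. -/
lemma exists_value_linkDiff {m n s : ℕ} (hn : 3 ≤ n) (F : Finset (Fin (m + 1) → Fin n))
    (hp : pFrac n (m + 1) s F < 1 / 8) (i : Fin (m + 1)) {a b : Fin n} (hab : a ≠ b) :
    ∃ v, (1 - 2 * pFrac n (m + 1) s F) * (n : ℝ) ^ m ≤
      ((Finset.univ.filter fun x => linkDiff i F a b x = v).card : ℝ) := by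
  refine exists_value_of_sum_disjInd_le hn _ hp ?_
  obtain ⟨K, hK⟩ := exists_sum_matchingLink_eq (by omega : 2 ≤ n) i hab
  have htot := hK fun _ _ => 1
  have hbad := hK fun x y => if linkDiff i F a b x = linkDiff i F a b y then 0 else 1
  simp only [mul_one, sum_disjInd, Finset.sum_const, nsmul_eq_mul,
    Finset.card_univ (α := Fin m → Fin n), Fintype.card_pi, Fintype.card_fin, Finset.prod_const, Nat.cast_pow] at htot
  set T : ℝ := ((Finset.univ : Finset (Fin (m + 1) → Equiv.Perm (Fin n))).card : ℝ) with hT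
  have hTpos : 0 < T := by
    rw [hT, Nat.cast_pos]
    exact Finset.univ_nonempty.card_pos
  have hn' : (3 : ℝ) ≤ n := by exact_mod_cast hn
  have hD : (0 : ℝ) < (n : ℝ) ^ m * (n - 1) ^ m :=
    mul_pos (by positivity) (pow_pos (by linarith) m)
  simp only [Finset.card_univ, Fintype.card_fin] at htot
  have hKpos : 0 < K := by
    by_contra hK0
    nlinarith
  set Bad := Finset.univ.filter
    (fun σ : Fin (m + 1) → Equiv.Perm (Fin n) => (F ∩ matchingOf σ).card ≠ s - 1) with hBad
  have hpT : (Bad.card : ℝ) = pFrac n (m + 1) s F * T := by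
    rw [pFrac, div_mul_cancel₀ _ hTpos.ne']
  have hsum : ∑ σ, (if linkDiff i F a b (matchingLink i σ a) =
      linkDiff i F a b (matchingLink i σ b) then (0 : ℝ) else 1) ≤ 2 * Bad.card := by
    have h1 : ∑ σ, (if σ ∈ Bad then (1 : ℝ) else 0) = Bad.card := by simp
    have h2 : ∑ σ, (if swapAt i a b σ ∈ Bad then (1 : ℝ) else 0) = Bad.card := by
      rw [← h1]
      exact Equiv.sum_comp (swapAt_involutive i a b).toPerm
        (fun σ => if σ ∈ Bad then (1 : ℝ) else 0)
    rw [two_mul]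
    nth_rewrite 1 [← h1]
    rw [← h2, ← Finset.sum_add_distrib]
    refine Finset.sum_le_sum fun σ _ => ?_
    by_cases hσ : σ ∈ Bad
    · rw [if_pos hσ]
      split_ifs <;> norm_num
    by_cases hσ' : swapAt i a b σ ∈ Bad
    · rw [if_pos hσ']
      split_ifs <;> norm_num
    simp only [hBad, Finset.mem_filter, Finset.mem_univ, true_and, not_not] at hσ hσ'
    rw [if_pos (linkDiff_eq_of_card_eq i F hab σ (hσ.trans hσ'.symm))]
    split_ifs <;> norm_num
  rw [hbad, hpT, htot] at hsum
  refine le_of_mul_le_mul_left (hsum.trans (le_of_eq ?_)) hKpos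
  ring

lemma card_filter_insertNth {m n : ℕ} (i : Fin (m + 1)) (F : Finset (Fin (m + 1) → Fin n))
    (a : Fin n) : (F.filter fun x => x i = a).card =
      (Finset.univ.filter fun x : Fin m → Fin n => i.insertNth a x ∈ F).card := by
  symm
  refine Finset.card_bij (fun x _ => i.insertNth a x) ?_ ?_ ?_
  · intro x hx
    simpa using hx
  · intro x _ y _ h
    exact Fin.insertNth_right_injective (α := fun _ => Fin n) (p := i) a h
  · intro x hx
    simp only [Finset.mem_filter] at hx
    refine ⟨i.removeNth x, ?_, ?_⟩
    · simp [← hx.2, hx.1]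
    · simp [← hx.2]

/-- Two links either nearly agree, or one is nearly full and the other nearly empty. -/
lemma link_trichotomy {m n : ℕ} (i : Fin (m + 1)) (F : Finset (Fin (m + 1) → Fin n)) {p : ℝ}
    (hn : 0 < n) (hp : p < 1 / 8) {a b : Fin n} {v : ℤ} (hv : (1 - 2 * p) * (n : ℝ) ^ m ≤
      ((Finset.univ.filter fun x => linkDiff i F a b x = v).card : ℝ)) :
    v = 0 ∧ ((F.filter fun x => x i = a).card : ℝ) ≤
      (F.filter fun x => x i = b).card + 2 * p * (n : ℝ) ^ m ∨
    v = 1 ∧ (1 - 2 * p) * (n : ℝ) ^ m ≤ ((F.filter fun x => x i = a).card : ℝ) ∧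
      ((F.filter fun x => x i = b).card : ℝ) ≤ 2 * p * (n : ℝ) ^ m ∨
    v = -1 ∧ (1 - 2 * p) * (n : ℝ) ^ m ≤ ((F.filter fun x => x i = b).card : ℝ) ∧
      ((F.filter fun x => x i = a).card : ℝ) ≤ 2 * p * (n : ℝ) ^ m := by
  have hN : (0 : ℝ) < (n : ℝ) ^ m := by positivity
  have hne : (Finset.univ.filter fun x => linkDiff i F a b x = v).Nonempty := by
    rw [← Finset.card_pos, ← Nat.cast_pos (α := ℝ)]
    refine lt_of_lt_of_le ?_ hv
    exact mul_pos (by linarith) hN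
  have htot : ∑ _x : Fin m → Fin n, (1 : ℝ) = (n : ℝ) ^ m := by simp
  have hcard : ∀ c, ((F.filter fun x => x i = c).card : ℝ) =
      ∑ x : Fin m → Fin n, if i.insertNth c x ∈ F then 1 else 0 := by
    intro c
    rw [card_filter_insertNth]
    simp
  rw [Finset.card_filter] at hv
  push_cast at hv
  rw [hcard a, hcard b]
  obtain ⟨x, hx⟩ := hne
  replace hx := (Finset.mem_filter.1 hx).2
  rw [linkDiff] at hx
  have hcases : v = 0 ∨ v = 1 ∨ v = -1 := by
    split_ifs at hx <;> simp [← hx]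
  rcases hcases with rfl | rfl | rfl
  · refine Or.inl ⟨rfl, ?_⟩
    have : ∑ x : Fin m → Fin n, ((if linkDiff i F a b x = 0 then (1 : ℝ) else 0) +
        if i.insertNth a x ∈ F then (1 : ℝ) else 0) ≤
        ∑ x : Fin m → Fin n, (1 + if i.insertNth b x ∈ F then (1 : ℝ) else 0) := by
      refine Finset.sum_le_sum fun x _ => ?_
      simp only [linkDiff]
      split_ifs <;> norm_num at *
    rw [Finset.sum_add_distrib, Finset.sum_add_distrib, htot] at this
    linarith
  · refine Or.inr (Or.inl ⟨rfl, hv.trans (Finset.sum_le_sum fun x _ => ?_), ?_⟩)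
    · simp only [linkDiff]
      split_ifs <;> norm_num at *
    have : ∑ x : Fin m → Fin n, ((if linkDiff i F a b x = 1 then (1 : ℝ) else 0) +
        if i.insertNth b x ∈ F then (1 : ℝ) else 0) ≤ ∑ x : Fin m → Fin n, 1 := by
      refine Finset.sum_le_sum fun x _ => ?_
      simp only [linkDiff]
      split_ifs <;> norm_num at *
    rw [Finset.sum_add_distrib, htot] at this
    linarith
  · refine Or.inr (Or.inr ⟨rfl, hv.trans (Finset.sum_le_sum fun x _ => ?_), ?_⟩)
    · simp only [linkDiff]
      split_ifs <;> norm_num at *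
    have : ∑ x : Fin m → Fin n, ((if linkDiff i F a b x = -1 then (1 : ℝ) else 0) +
        if i.insertNth a x ∈ F then (1 : ℝ) else 0) ≤ ∑ x : Fin m → Fin n, 1 := by
      refine Finset.sum_le_sum fun x _ => ?_
      simp only [linkDiff]
      split_ifs <;> norm_num at *
    rw [Finset.sum_add_distrib, htot] at this
    linarith

/-- Differences of links that are typical for their pairs add up. -/
lemma linkDiff_value_add {m n : ℕ} (i : Fin (m + 1)) (F : Finset (Fin (m + 1) → Fin n)) {p : ℝ}
    (hn : 0 < n) (hp : p < 1 / 8) {a b c : Fin n} {v w z : ℤ}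
    (hv : (1 - 2 * p) * (n : ℝ) ^ m ≤
      ((Finset.univ.filter fun x => linkDiff i F a b x = v).card : ℝ))
    (hw : (1 - 2 * p) * (n : ℝ) ^ m ≤
      ((Finset.univ.filter fun x => linkDiff i F b c x = w).card : ℝ))
    (hz : (1 - 2 * p) * (n : ℝ) ^ m ≤
      ((Finset.univ.filter fun x => linkDiff i F a c x = z).card : ℝ)) : v + w = z := by
  by_contra hne
  have hN : (0 : ℝ) < (n : ℝ) ^ m := by positivity
  have htot : ∑ _x : Fin m → Fin n, (2 : ℝ) = (n : ℝ) ^ m * 2 := by simp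
  rw [Finset.card_filter] at hv hw hz
  push_cast at hv hw hz
  have : ∑ x : Fin m → Fin n, ((if linkDiff i F a b x = v then (1 : ℝ) else 0) +
      (if linkDiff i F b c x = w then (1 : ℝ) else 0) +
      (if linkDiff i F a c x = z then (1 : ℝ) else 0)) ≤ ∑ _x : Fin m → Fin n, (2 : ℝ) := by
    refine Finset.sum_le_sum fun x _ => ?_
    have hx : linkDiff i F a b x + linkDiff i F b c x = linkDiff i F a c x := by
      simp [linkDiff]
    split_ifs <;> first | (norm_num; done) | (exfalso; omega)
  rw [Finset.sum_add_distrib, Finset.sum_add_distrib, htot] at this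
  nlinarith

lemma exists_card_filter_le {m n s : ℕ} (hn : 2 ≤ n) (hm : 1 ≤ m)
    (F : Finset (Fin (m + 1) → Fin n)) (hF : F.card = (s - 1) * n ^ m + 1) (i : Fin (m + 1)) :
    ∃ b, (F.filter fun x => x i = b).card ≤ (s - 1) * n ^ (m - 1) := by
  by_contra! h
  have h1 : F.card = ∑ b, (F.filter fun x => x i = b).card :=
    Finset.card_eq_sum_card_fiberwise fun x _ => Finset.mem_coe.2 (Finset.mem_univ (x i))
  have h2 := Finset.sum_le_sum fun b (_ : b ∈ Finset.univ) => Nat.succ_le_of_lt (h b)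
  rw [← h1, hF, Finset.sum_const, Finset.card_univ, Fintype.card_fin, smul_eq_mul] at h2
  obtain ⟨m, rfl⟩ := Nat.exists_eq_add_of_le' hm
  have h3 : n * ((s - 1) * n ^ m).succ = (s - 1) * n ^ (m + 1) + n := by
    rw [Nat.mul_succ, pow_succ]; ring
  rw [Nat.add_sub_cancel, h3] at h2
  omega

/-- Theorem 4.1, part 1 (anticoncentration: dichotomy for hyperplane intersections). -/
theorem stmt10 (n k s : ℕ) (hn : 4 ≤ n) (hk : 2 ≤ k) (hs : 2 ≤ s)
    (F : Finset (Fin k → Fin n)) (hF : F.card = (s - 1) * n ^ (k - 1) + 1)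
    (hp : pFrac n k s F < 1 / 8) (i : Fin k) :
    (∀ a : Fin n, ((F.filter (fun x => x i = a)).card : ℝ) ≤
        2 * pFrac n k s F * (n : ℝ) ^ (k - 1) + ((s : ℝ) - 1) * (n : ℝ) ^ (k - 2)) ∨
    (∀ a : Fin n,
      ((F.filter (fun x => x i = a)).card : ℝ) ≥ (1 - 2 * pFrac n k s F) * (n : ℝ) ^ (k - 1) ∨
      ((F.filter (fun x => x i = a)).card : ℝ) ≤ 2 * pFrac n k s F * (n : ℝ) ^ (k - 1)) := by
  obtain ⟨m, rfl⟩ := Nat.exists_eq_add_of_le' (by omega : 1 ≤ k)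
  simp only [Nat.add_sub_cancel] at hF ⊢
  have hp0 := pFrac_nonneg n (m + 1) s F
  set p := pFrac n (m + 1) s F with hpdef
  have hN : (0 : ℝ) < (n : ℝ) ^ m := by positivity
  have hdiff : ∀ a b : Fin n, a ≠ b → ∃ v, (1 - 2 * p) * (n : ℝ) ^ m ≤
      ((Finset.univ.filter fun x => linkDiff i F a b x = v).card : ℝ) :=
    fun a b hab => exists_value_linkDiff (by omega) F hp i hab
  by_cases hfat : ∃ a b : Fin n, a ≠ b ∧ (1 - 2 * p) * (n : ℝ) ^ m ≤
      ((Finset.univ.filter fun x => linkDiff i F a b x = 1).card : ℝ)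
  · right
    obtain ⟨a, b, hab, h1⟩ := hfat
    have htri := link_trichotomy i F (by omega) hp h1
    simp only [one_ne_zero, false_and, true_and, false_or, show (1 : ℤ) ≠ -1 by decide,
      or_false] at htri
    intro c
    by_cases hca : c = a
    · exact hca ▸ Or.inl htri.1
    by_cases hcb : c = b
    · exact hcb ▸ Or.inr htri.2
    obtain ⟨v, hv⟩ := hdiff a c (Ne.symm hca)
    obtain ⟨w, hw⟩ := hdiff c b hcb
    have hvw := linkDiff_value_add i F (by omega) hp hv hw h1
    rcases link_trichotomy i F (by omega) hp hv with hv' | hv' | hv'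
    · rcases link_trichotomy i F (by omega) hp hw with hw' | hw' | hw'
      · omega
      · exact Or.inl hw'.2.1
      · exact Or.inr hw'.2.2
    · exact Or.inr hv'.2.2
    · exact Or.inl hv'.2.1
  · left
    intro a
    obtain ⟨b, hb⟩ := exists_card_filter_le (by omega) (by omega) F hF i
    have hb' : ((F.filter fun x => x i = b).card : ℝ) ≤ ((s : ℝ) - 1) * (n : ℝ) ^ (m - 1) := by
      have : ((s - 1 : ℕ) : ℝ) = (s : ℝ) - 1 := by
        rw [Nat.cast_sub (by omega), Nat.cast_one]
      rw [← this]
      exact_mod_cast hb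
    have hk2 : m + 1 - 2 = m - 1 := by omega
    rw [hk2]
    have hpN : 0 ≤ 2 * p * (n : ℝ) ^ m := by positivity
    by_cases hab : a = b
    · rw [hab]; linarith
    obtain ⟨v, hv⟩ := hdiff a b hab
    rcases link_trichotomy i F (by omega) hp hv with hv' | hv' | hv'
    · linarith [hv'.2]
    · exact absurd ⟨a, b, hab, hv'.1 ▸ hv⟩ hfat
    · linarith [hv'.2.2, (Nat.cast_nonneg _ : (0 : ℝ) ≤ ((F.filter fun x => x i = b).card : ℝ))]
end

section
/- Let n ≥ 8, k ≥ 2, s ≥ 3 be integers and let F ⊆ [n]^k with |F| = (s−1)·n^{k−1} + 1. Let p_F be the probability that |F ∩ M| ≠ s−1 for a uniformly random perfect matching M in [n]^k, and assume p_F ≤ 1/(4n(s−1)). Then there are exactly s−1 F-fat hyperplanes, i.e., the number of pairs (i, a) ∈ [k]×[n] with |H_i(a) ∩ F| ≥ (1 − 2p_F)·n^{k−1} equals s−1. -/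
section Probability

open scoped BigOperators

/-- The real-valued indicator of a proposition. -/
noncomputable def ind (P : Prop) : ℝ := open Classical in if P then 1 else 0

lemma ind_true {P : Prop} (h : P) : ind P = 1 := by simp [ind, h]

lemma ind_false {P : Prop} (h : ¬P) : ind P = 0 := by simp [ind, h]

lemma ind_nonneg (P : Prop) : 0 ≤ ind P := by unfold ind; split_ifs <;> norm_num

lemma ind_mono {P Q : Prop} (h : P → Q) : ind P ≤ ind Q := by
  by_cases hP : P
  · rw [ind_true hP, ind_true (h hP)]
  · rw [ind_false hP]; exact ind_nonneg Q

lemma ind_congr {P Q : Prop} (h : P ↔ Q) : ind P = ind Q := by rw [propext h]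

lemma ind_not (P : Prop) : ind (¬P) = 1 - ind P := by
  by_cases hP : P <;> simp [ind, hP]

lemma ind_mul_self (P : Prop) : ind P * ind P = ind P := by
  by_cases hP : P <;> simp [ind, hP]

lemma ind_mul (P Q : Prop) : ind P * ind Q = ind (P ∧ Q) := by
  by_cases hP : P <;> by_cases hQ : Q <;> simp [ind, hP, hQ]

lemma ind_or_le (P Q : Prop) : ind (P ∨ Q) ≤ ind P + ind Q := by
  by_cases hP : P <;> by_cases hQ : Q <;> simp [ind, hP, hQ]

lemma sum_ind {α : Type*} [Fintype α] (P : α → Prop) [DecidablePred P] :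
    ∑ a, ind (P a) = ((Finset.univ.filter P).card : ℝ) := by
  rw [Finset.card_filter]
  push_cast
  exact Finset.sum_congr rfl fun a _ => by by_cases h : P a <;> simp [ind, h]

variable {α β : Type*} [Fintype α] [Fintype β]

/-- The probability that a uniformly random element of a finite type satisfies `P`. -/
noncomputable def prob (P : α → Prop) : ℝ := 𝔼 a, ind (P a)

lemma expect_mono {f g : α → ℝ} (h : ∀ a, f a ≤ g a) : 𝔼 a, f a ≤ 𝔼 a, g a :=
  Finset.expect_le_expect fun a _ => h a

lemma expect_swap (f : α → β → ℝ) : 𝔼 a, 𝔼 b, f a b = 𝔼 b, 𝔼 a, f a b :=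
  Finset.expect_comm _ _ _

lemma card_mul_expect [Nonempty α] (f : α → ℝ) :
    (Fintype.card α : ℝ) * 𝔼 a, f a = ∑ a, f a := by
  rw [Fintype.expect_eq_sum_div_card]
  have : (Fintype.card α : ℝ) ≠ 0 := by exact_mod_cast Fintype.card_ne_zero
  field_simp

lemma sq_expect_le [Nonempty α] (f : α → ℝ) : (𝔼 a, f a) ^ 2 ≤ 𝔼 a, f a ^ 2 := by
  have h := Finset.expect_mul_sq_le_sq_mul_sq Finset.univ f (fun _ : α => (1 : ℝ))
  simpa using h

lemma prob_nonneg (P : α → Prop) : 0 ≤ prob P :=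
  Finset.expect_nonneg fun _ _ => ind_nonneg _

lemma prob_mono {P Q : α → Prop} (h : ∀ a, P a → Q a) : prob P ≤ prob Q :=
  expect_mono fun a => ind_mono (h a)

lemma prob_or_le (P Q : α → Prop) : prob (fun a => P a ∨ Q a) ≤ prob P + prob Q := by
  unfold prob
  rw [← Finset.expect_add_distrib]
  exact expect_mono fun a => ind_or_le _ _

lemma prob_not [Nonempty α] (P : α → Prop) : prob (fun a => ¬P a) = 1 - prob P := by
  unfold prob
  simp only [ind_not, Finset.expect_sub_distrib, Fintype.expect_const]

lemma prob_le_one [Nonempty α] (P : α → Prop) : prob P ≤ 1 := by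
  have := prob_nonneg (fun a => ¬P a)
  rw [prob_not] at this
  linarith

lemma expect_comp_equiv (e : α ≃ α) (f : α → ℝ) : 𝔼 a, f (e a) = 𝔼 a, f a :=
  Fintype.expect_equiv e _ _ fun _ => rfl

lemma mul_prob_le_expect {f : α → ℝ} (hf : ∀ a, 0 ≤ f a) {c : ℝ} {P : α → Prop}
    (h : ∀ a, P a → c ≤ f a) : c * prob P ≤ 𝔼 a, f a := by
  unfold prob
  rw [Finset.mul_expect]
  refine expect_mono fun a => ?_
  by_cases hP : P a
  · rw [ind_true hP, mul_one]; exact h a hP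
  · rw [ind_false hP, mul_zero]; exact hf a

/-- Variance is at most the sum of the two conditional variances of a function of two
independent variables. -/
lemma sq_expect_add_expect_sq_ge [Nonempty α] [Nonempty β] (Z : α → β → ℝ) :
    𝔼 a, (𝔼 b, Z a b) ^ 2 + 𝔼 b, (𝔼 a, Z a b) ^ 2 ≤
      (𝔼 a, 𝔼 b, Z a b) ^ 2 + 𝔼 a, 𝔼 b, Z a b ^ 2 := by
  set z := 𝔼 a, 𝔼 b, Z a b with hz
  set R : α → ℝ := fun a => 𝔼 b, Z a b with hR
  set C : β → ℝ := fun b => 𝔼 a, Z a b with hC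
  have hRz : 𝔼 a, R a = z := rfl
  have hCz : 𝔼 b, C b = z := expect_swap _
  have key : 0 ≤ 𝔼 a, 𝔼 b, (Z a b - R a - C b + z) ^ 2 :=
    Finset.expect_nonneg fun _ _ => Finset.expect_nonneg fun _ _ => sq_nonneg _
  have h1 : 𝔼 a, 𝔼 b, R a * Z a b = 𝔼 a, R a ^ 2 := by
    simp only [← Finset.mul_expect, sq]; rfl
  have h2 : 𝔼 a, 𝔼 b, C b * Z a b = 𝔼 b, C b ^ 2 := by
    rw [expect_swap]; simp only [← Finset.mul_expect, sq]; rfl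
  have h3 : 𝔼 a, 𝔼 b, R a * C b = z ^ 2 := by
    simp only [← Finset.mul_expect, ← Finset.expect_mul, hRz, hCz, sq]
  have expand : 𝔼 a, 𝔼 b, (Z a b - R a - C b + z) ^ 2 =
      𝔼 a, 𝔼 b, Z a b ^ 2 + 𝔼 a, R a ^ 2 + 𝔼 b, C b ^ 2 + z ^ 2
      - 2 * 𝔼 a, 𝔼 b, R a * Z a b - 2 * 𝔼 a, 𝔼 b, C b * Z a b + 2 * z * 𝔼 a, 𝔼 b, Z a b
      + 2 * 𝔼 a, 𝔼 b, R a * C b - 2 * z * 𝔼 a, R a - 2 * z * 𝔼 b, C b := by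
    have e : ∀ a b, (Z a b - R a - C b + z) ^ 2 = Z a b ^ 2 + R a ^ 2 + C b ^ 2 + z ^ 2
      - 2 * (R a * Z a b) - 2 * (C b * Z a b) + 2 * z * Z a b
      + 2 * (R a * C b) - 2 * z * R a - 2 * z * C b := fun a b => by ring
    simp only [e, Finset.expect_add_distrib, Finset.expect_sub_distrib, ← Finset.mul_expect,
      Fintype.expect_const]
  rw [expand, h1, h2, h3, hRz, hCz] at key
  have : 𝔼 a, R a ^ 2 + 𝔼 b, C b ^ 2 ≤ z ^ 2 + 𝔼 a, 𝔼 b, Z a b ^ 2 := by nlinarith [key]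
  exact this

end Probability

section RandomPermutations

open scoped BigOperators

variable {n k : ℕ}

/-- The tuple `(σ₁ t, …, σ_k t)`. -/
def diag (σ : Fin k → Equiv.Perm (Fin n)) (t : Fin n) : Fin k → Fin n := fun i => σ i t

lemma expect_tuple_apply [NeZero n] (G : (Fin k → Fin n) → ℝ) (y : Fin k → Fin n) :
    𝔼 σ : Fin k → Equiv.Perm (Fin n), G (fun i => σ i (y i)) = 𝔼 x, G x := by
  have indep : ∀ y' : Fin k → Fin n, 𝔼 σ : Fin k → Equiv.Perm (Fin n), G (fun i => σ i (y' i)) =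
      𝔼 σ : Fin k → Equiv.Perm (Fin n), G (fun i => σ i (y i)) := by
    intro y'
    rw [← expect_comp_equiv
      (Equiv.piCongrRight fun i => Equiv.mulRight (Equiv.swap (y' i) (y i)))]
    simp
  have h : 𝔼 y' : Fin k → Fin n, 𝔼 σ : Fin k → Equiv.Perm (Fin n), G (fun i => σ i (y' i)) =
      𝔼 σ : Fin k → Equiv.Perm (Fin n), G (fun i => σ i (y i)) := by
    simp only [indep, Fintype.expect_const]
  rw [← h, expect_swap]
  have : ∀ σ : Fin k → Equiv.Perm (Fin n),
      𝔼 y' : Fin k → Fin n, G (fun i => σ i (y' i)) = 𝔼 x, G x := fun σ =>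
    expect_comp_equiv (Equiv.piCongrRight fun i => σ i) G
  simp only [this, Fintype.expect_const]

lemma exists_perm_apply_pair {a b t₀ t₁ : Fin n} (hab : a ≠ b) (ht : t₀ ≠ t₁) :
    ∃ θ : Equiv.Perm (Fin n), θ t₀ = a ∧ θ t₁ = b := by
  refine ⟨Equiv.swap (Equiv.swap t₀ a t₁) b * Equiv.swap t₀ a, ?_, ?_⟩
  · rw [Equiv.Perm.mul_apply, Equiv.swap_apply_left, Equiv.swap_apply_of_ne_of_ne _ hab]
    intro hc
    have := congrArg (Equiv.swap t₀ a) hc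
    rw [Equiv.swap_apply_right, Equiv.swap_apply_self] at this
    exact ht this
  · rw [Equiv.Perm.mul_apply, Equiv.swap_apply_left]

lemma sum_expect_perm_pair (h : Fin n → Fin n → ℝ) {t₀ t₁ : Fin n} (ht : t₀ ≠ t₁) :
    (n : ℝ) * (n - 1) * 𝔼 π : Equiv.Perm (Fin n), h (π t₀) (π t₁) =
      ∑ a, ∑ b, h a b - ∑ a, h a a := by
  classical
  have indep : ∀ t t' : Fin n, t ≠ t' → 𝔼 π : Equiv.Perm (Fin n), h (π t) (π t') =
      𝔼 π : Equiv.Perm (Fin n), h (π t₀) (π t₁) := by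
    intro t t' hne
    obtain ⟨ρ, hρ0, hρ1⟩ := exists_perm_apply_pair ht hne
    rw [← expect_comp_equiv (Equiv.mulRight ρ) fun π => h (π t) (π t')]
    simp [hρ0, hρ1]
  have hsum : ∀ π : Equiv.Perm (Fin n),
      ∑ t, ∑ t', h (π t) (π t') - ∑ t, h (π t) (π t) = ∑ a, ∑ b, h a b - ∑ a, h a a := by
    intro π
    rw [Equiv.sum_comp π fun a => h a a, Equiv.sum_comp π fun a => ∑ t', h a (π t')]
    simp only [fun a => Equiv.sum_comp π fun b => h a b]
  have hE : 𝔼 π : Equiv.Perm (Fin n), (∑ t, ∑ t', h (π t) (π t') - ∑ t, h (π t) (π t)) =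
      ∑ a, ∑ b, h a b - ∑ a, h a a := by
    simp only [hsum, Fintype.expect_const]
  rw [← hE, Finset.expect_sub_distrib, Finset.expect_sum_comm]
  simp only [Finset.expect_sum_comm]
  rw [← Finset.sum_sub_distrib]
  have hrow : ∀ t : Fin n, ∑ t', 𝔼 π : Equiv.Perm (Fin n), h (π t) (π t') -
      𝔼 π : Equiv.Perm (Fin n), h (π t) (π t) =
      ((n : ℝ) - 1) * 𝔼 π : Equiv.Perm (Fin n), h (π t₀) (π t₁) := by
    intro t
    rw [← Finset.add_sum_erase _ _ (Finset.mem_univ t), add_sub_cancel_left,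
      Finset.sum_congr rfl fun t' ht' => indep t t' (Finset.ne_of_mem_erase ht').symm,
      Finset.sum_const, Finset.card_erase_of_mem (Finset.mem_univ t), Finset.card_univ,
      Fintype.card_fin, nsmul_eq_mul, Nat.cast_sub (by have := t.pos; omega), Nat.cast_one]
  simp only [hrow, Finset.sum_const, Finset.card_univ, Fintype.card_fin, nsmul_eq_mul]
  ring

lemma expect_tuple_succ {M : Type*} [Fintype M] (G : (Fin (k + 1) → M) → ℝ) :
    𝔼 x, G x = 𝔼 a : M, 𝔼 x : Fin k → M, G (Fin.cons a x) := by
  rw [← Finset.expect_product' Finset.univ Finset.univ fun a (x : Fin k → M) => G (Fin.cons a x)]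
  exact (Fintype.expect_equiv (Fin.consEquiv fun _ => M) _ _ fun _ => rfl).symm

/-- Poincaré inequality for uniformly random pairs of disjoint tuples. -/
theorem expect_disjoint_pair_le {t₀ t₁ : Fin n} (ht : t₀ ≠ t₁) :
    ∀ {k : ℕ} (G : (Fin k → Fin n) → ℝ),
      ((n : ℝ) - 1) * 𝔼 σ : Fin k → Equiv.Perm (Fin n), G (diag σ t₀) * G (diag σ t₁) ≤
        𝔼 x, G x ^ 2 + ((n : ℝ) - 2) * (𝔼 x, G x) ^ 2 := by
  have hn0 : NeZero n := ⟨by have := t₀.pos; omega⟩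
  have hn : 2 ≤ n := by
    by_contra! h
    exact ht (Fin.ext (by have := t₀.isLt; have := t₁.isLt; omega))
  have hnR : (2 : ℝ) ≤ n := by exact_mod_cast hn
  intro k
  induction k with
  | zero =>
    intro G
    have h1 : ∀ x : Fin 0 → Fin n, G x = G default := fun x => by rw [Subsingleton.elim x default]
    simp only [h1, Fintype.expect_const]
    exact le_of_eq (by ring)
  | succ k ih =>
    intro G
    set Q : ((Fin k → Fin n) → ℝ) → ((Fin k → Fin n) → ℝ) → ℝ := fun H H' =>
      𝔼 σ : Fin k → Equiv.Perm (Fin n), H (diag σ t₀) * H' (diag σ t₁) with hQ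
    set g : Fin n → (Fin k → Fin n) → ℝ := fun a x => G (Fin.cons a x) with hg
    set m : (Fin k → Fin n) → ℝ := fun x => 𝔼 a, g a x with hm
    have hlow : ∀ H : (Fin k → Fin n) → ℝ, -𝔼 x, H x ^ 2 ≤ Q H H := by
      intro H
      have h0 : 0 ≤ 𝔼 σ : Fin k → Equiv.Perm (Fin n), (H (diag σ t₀) + H (diag σ t₁)) ^ 2 :=
        Finset.expect_nonneg fun _ _ => sq_nonneg _
      have e : ∀ σ : Fin k → Equiv.Perm (Fin n), (H (diag σ t₀) + H (diag σ t₁)) ^ 2 =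
          H (diag σ t₀) ^ 2 + H (diag σ t₁) ^ 2 + 2 * (H (diag σ t₀) * H (diag σ t₁)) :=
        fun σ => by ring
      simp only [e, Finset.expect_add_distrib, ← Finset.mul_expect] at h0
      rw [show 𝔼 σ : Fin k → Equiv.Perm (Fin n), H (diag σ t₀) ^ 2 = 𝔼 x, H x ^ 2 from
          expect_tuple_apply (fun x => H x ^ 2) fun _ => t₀,
        show 𝔼 σ : Fin k → Equiv.Perm (Fin n), H (diag σ t₁) ^ 2 = 𝔼 x, H x ^ 2 from
          expect_tuple_apply (fun x => H x ^ 2) fun _ => t₁] at h0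
      simp only [hQ]
      linarith
    have hstep : (n : ℝ) * (n - 1) * 𝔼 σ : Fin (k + 1) → Equiv.Perm (Fin n),
        G (diag σ t₀) * G (diag σ t₁) = ∑ a, ∑ b, Q (g a) (g b) - ∑ a, Q (g a) (g a) := by
      rw [expect_tuple_succ, ← sum_expect_perm_pair (fun a b => Q (g a) (g b)) ht]
      congr 2
      funext π
      simp only [hQ, hg]
      congr 1
      funext σ
      have hd : ∀ t : Fin n, diag (Fin.cons π σ : Fin (k + 1) → Equiv.Perm (Fin n)) t =
          Fin.cons (π t) (diag σ t) := by
        intro t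
        funext i
        refine Fin.cases ?_ (fun i => ?_) i <;> simp [diag]
      rw [hd, hd]
    have hsumg : ∀ x, ∑ a, g a x = n * m x := by
      intro x
      have := card_mul_expect fun a : Fin n => g a x
      rw [Fintype.card_fin] at this
      exact this.symm
    have hfull : ∑ a, ∑ b, Q (g a) (g b) = n ^ 2 * Q m m := by
      simp only [hQ, ← Finset.expect_sum_comm, ← Finset.mul_sum, ← Finset.sum_mul, hsumg]
      rw [Finset.mul_expect]
      exact Finset.expect_congr rfl fun σ _ => by ring
    have hcross1 : ∑ a, Q (g a) m = n * Q m m := by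
      simp only [hQ, ← Finset.expect_sum_comm, ← Finset.sum_mul, hsumg]
      rw [Finset.mul_expect]
      exact Finset.expect_congr rfl fun σ _ => by ring
    have hcross2 : ∑ a, Q m (g a) = n * Q m m := by
      simp only [hQ, ← Finset.expect_sum_comm, ← Finset.mul_sum, hsumg]
      rw [Finset.mul_expect]
      exact Finset.expect_congr rfl fun σ _ => by ring
    have hdiff : ∑ a, Q (fun x => g a x - m x) (fun x => g a x - m x) =
        ∑ a, Q (g a) (g a) - n * Q m m := by
      have e : ∀ a, Q (fun x => g a x - m x) (fun x => g a x - m x) =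
          Q (g a) (g a) - Q (g a) m - Q m (g a) + Q m m := by
        intro a
        simp only [hQ, ← Finset.expect_add_distrib, ← Finset.expect_sub_distrib]
        exact Finset.expect_congr rfl fun σ _ => by ring
      simp only [e, Finset.sum_add_distrib, Finset.sum_sub_distrib, hcross1, hcross2,
        Finset.sum_const, Finset.card_univ, Fintype.card_fin, nsmul_eq_mul]
      ring
    have hvar : ∑ a, 𝔼 x, (g a x - m x) ^ 2 = ∑ a, 𝔼 x, g a x ^ 2 - n * 𝔼 x, m x ^ 2 := by
      rw [← Finset.expect_sum_comm, ← Finset.expect_sum_comm, Finset.mul_expect,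
        ← Finset.expect_sub_distrib]
      refine Finset.expect_congr rfl fun x _ => ?_
      have e : ∀ a, (g a x - m x) ^ 2 = g a x ^ 2 - 2 * m x * g a x + m x ^ 2 := fun a => by ring
      simp only [e, Finset.sum_add_distrib, Finset.sum_sub_distrib, ← Finset.mul_sum, hsumg,
        Finset.sum_const, Finset.card_univ, Fintype.card_fin, nsmul_eq_mul]
      ring
    have hGsq : ∑ a, 𝔼 x, g a x ^ 2 = n * 𝔼 x, G x ^ 2 := by
      rw [expect_tuple_succ fun x => G x ^ 2]
      have := card_mul_expect fun a : Fin n => 𝔼 x, g a x ^ 2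
      rw [Fintype.card_fin] at this
      exact this.symm
    have hGm : 𝔼 x, G x = 𝔼 x, m x := by
      rw [expect_tuple_succ, expect_swap]
    have hneg : -∑ a, 𝔼 x, (g a x - m x) ^ 2 ≤
        ∑ a, Q (fun x => g a x - m x) (fun x => g a x - m x) := by
      rw [← Finset.sum_neg_distrib]
      exact Finset.sum_le_sum fun a _ => hlow _
    have hm' := ih m
    rw [hdiff, hvar, hGsq] at hneg
    rw [hfull] at hstep
    rw [hGm]
    have hpos : (0 : ℝ) < n := by linarith
    refine le_of_mul_le_mul_left ?_ hpos
    rw [← mul_assoc, hstep]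
    have hm'' : (n : ℝ) * ((n - 1) * Q m m) ≤
        n * (𝔼 x, m x ^ 2 + (n - 2) * (𝔼 x, m x) ^ 2) :=
      mul_le_mul_of_nonneg_left hm' hpos.le
    nlinarith [hm'', hneg]

/-- Isoperimetric form of `expect_disjoint_pair_le`. -/
lemma mul_prob_not_le_prob_pair {t₀ t₁ : Fin n} (ht : t₀ ≠ t₁) (K : (Fin k → Fin n) → Prop) :
    ((n : ℝ) - 2) * (prob K * (1 - prob K)) ≤
      (n - 1) * prob fun σ : Fin k → Equiv.Perm (Fin n) => K (diag σ t₀) ∧ ¬K (diag σ t₁) := by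
  have hn0 : NeZero n := ⟨by have := t₀.pos; omega⟩
  have h := expect_disjoint_pair_le ht fun x => ind (K x)
  have e1 : 𝔼 x, ind (K x) ^ 2 = prob K := by simp only [sq, ind_mul_self]; rfl
  have e2 : prob (fun σ : Fin k → Equiv.Perm (Fin n) => K (diag σ t₀) ∧ ¬K (diag σ t₁)) =
      prob K - 𝔼 σ : Fin k → Equiv.Perm (Fin n), ind (K (diag σ t₀)) * ind (K (diag σ t₁)) := by
    rw [show prob K = 𝔼 σ : Fin k → Equiv.Perm (Fin n), ind (K (diag σ t₀)) from
      (expect_tuple_apply (fun x => ind (K x)) fun _ => t₀).symm, ← Finset.expect_sub_distrib]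
    refine Finset.expect_congr rfl fun σ _ => ?_
    rw [← ind_mul, ind_not]
    ring
  rw [e1] at h
  rw [e2]
  unfold prob at *
  nlinarith [h]

end RandomPermutations

section MatrixSums

open scoped BigOperators

variable {n : ℕ}

lemma card_mul_card_le_sum_ind (D : Fin n → ℝ) (v₀ : Fin n) :
    2 * (((Finset.univ.filter fun v => D v = D v₀).card : ℝ) *
        (n - (Finset.univ.filter fun v => D v = D v₀).card)) ≤
      ∑ v, ∑ v', ind (D v ≠ D v') := by
  set x : ℝ := ((Finset.univ.filter fun v => D v = D v₀).card : ℝ) with hx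
  have hin : ∑ v, ind (D v = D v₀) = x := sum_ind _
  have hout : ∑ v, ind (D v ≠ D v₀) = n - x := by
    simp only [ne_eq, ind_not, Finset.sum_sub_distrib, hin]
    simp
  have hle : ∀ v v', ind (D v = D v₀) * ind (D v' ≠ D v₀) + ind (D v ≠ D v₀) * ind (D v' = D v₀) ≤
      ind (D v ≠ D v') := by
    intro v v'
    by_cases h : D v = D v₀ <;> by_cases h' : D v' = D v₀
    · simp [ind, h, h']
    · have : D v ≠ D v' := fun hc => h' (hc ▸ h)
      simp [ind, h, h', Ne.symm h']
    · simp [ind, h, h']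
    · simp only [ind_false h, ind_false h', zero_mul, mul_zero, add_zero]
      exact ind_nonneg _
  calc 2 * (x * (n - x)) = ∑ v, ∑ v', (ind (D v = D v₀) * ind (D v' ≠ D v₀) +
        ind (D v ≠ D v₀) * ind (D v' = D v₀)) := by
        simp only [Finset.sum_add_distrib, ← Finset.mul_sum, ← Finset.sum_mul, hin, hout]
        ring
    _ ≤ _ := Finset.sum_le_sum fun v _ => Finset.sum_le_sum fun v' _ => hle v v'

lemma two_mul_pred_le_sum_ind {D : Fin n → ℝ} {v₀ v₁ : Fin n} (h : D v₀ ≠ D v₁) :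
    2 * ((n : ℝ) - 1) ≤ ∑ v, ∑ v', ind (D v ≠ D v') := by
  refine le_trans ?_ (card_mul_card_le_sum_ind D v₀)
  set X := Finset.univ.filter fun v => D v = D v₀ with hX
  have h1 : 1 ≤ X.card := Finset.card_pos.2 ⟨v₀, by simp [hX]⟩
  have h2 : X.card + 1 ≤ n := by
    have : X.card < (Finset.univ : Finset (Fin n)).card :=
      Finset.card_lt_univ_of_notMem (x := v₁) (by simp [hX, h.symm]) |>.trans_eq (by simp)
    simpa using this
  have h1' : (1 : ℝ) ≤ X.card := by exact_mod_cast h1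
  have h2' : (X.card : ℝ) + 1 ≤ n := by exact_mod_cast h2
  nlinarith [mul_nonneg (sub_nonneg.2 h1') (sub_nonneg.2 h2')]

lemma four_mul_sub_two_le_sum_ind {D : Fin n → ℝ} {v₀ v₁ : Fin n} (h : D v₀ ≠ D v₁)
    (htwin : ∀ v, ∃ w, w ≠ v ∧ D w = D v) :
    4 * ((n : ℝ) - 2) ≤ ∑ v, ∑ v', ind (D v ≠ D v') := by
  refine le_trans ?_ (card_mul_card_le_sum_ind D v₀)
  set X := Finset.univ.filter fun v => D v = D v₀ with hX
  have h1 : 2 ≤ X.card := by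
    obtain ⟨w, hw, hDw⟩ := htwin v₀
    exact Finset.one_lt_card.2 ⟨w, by simp [hX, hDw], v₀, by simp [hX], hw⟩
  have h2 : X.card + 2 ≤ n := by
    obtain ⟨w, hw, hDw⟩ := htwin v₁
    have hc : 2 ≤ Xᶜ.card :=
      Finset.one_lt_card.2 ⟨w, by simp [hX, hDw, h.symm], v₁, by simp [hX, h.symm], hw⟩
    have := Finset.card_add_card_compl X
    rw [Fintype.card_fin] at this
    omega
  have h1' : (2 : ℝ) ≤ X.card := by exact_mod_cast h1
  have h2' : (X.card : ℝ) + 2 ≤ n := by exact_mod_cast h2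
  nlinarith [mul_nonneg (sub_nonneg.2 h1') (sub_nonneg.2 h2')]

/-- A random transversal sum of a matrix differs from `m` at least in proportion to the number of
non-additive rectangles containing a given row. -/
lemma sum_row_rectangles_le (A : Fin n → Fin n → ℝ) (m : ℝ) (u : Fin n) :
    ∑ u', ∑ v, ∑ v', ind (A u v - A u' v ≠ A u v' - A u' v') ≤
      2 * n * ((n : ℝ) - 1) ^ 2 *
        prob fun τ : Equiv.Perm (Fin n) => ∑ t, A t (τ t) ≠ m := by
  classical
  set S : Equiv.Perm (Fin n) → Prop := fun τ => ∑ t, A t (τ t) ≠ m with hS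
  set B : Fin n → Fin n → Fin n → Prop := fun u' v v' => A u v - A u' v ≠ A u v' - A u' v' with hB
  have hn1 : (1 : ℝ) ≤ n := by exact_mod_cast u.pos
  have hrow : ∀ u', ∑ v, ∑ v', ind (B u' v v') ≤
      n * (n - 1) * (2 * prob fun τ : Equiv.Perm (Fin n) => B u' (τ u) (τ u') ∧ S τ) := by
    intro u'
    by_cases hu : u = u'
    · have : ∀ v v', ind (B u' v v') = 0 := fun v v' => ind_false (by simp [hB, hu])
      simp only [this, Finset.sum_const_zero]
      exact mul_nonneg (mul_nonneg (by linarith) (by linarith))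
        (mul_nonneg zero_le_two (prob_nonneg _))
    have hpair := sum_expect_perm_pair (fun v v' => ind (B u' v v')) hu
    have hd : ∀ v, ind (B u' v v) = 0 := fun v => ind_false (by simp [hB])
    simp only [hd, Finset.sum_const_zero, sub_zero] at hpair
    rw [← hpair]
    refine mul_le_mul_of_nonneg_left ?_ (mul_nonneg (by linarith) (by linarith))
    set e : Equiv.Perm (Fin n) ≃ Equiv.Perm (Fin n) := Equiv.mulRight (Equiv.swap u u') with he
    have heu : ∀ τ, e τ u = τ u' := fun τ => by simp [he]
    have heu' : ∀ τ, e τ u' = τ u := fun τ => by simp [he]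
    have heo : ∀ τ t, t ≠ u → t ≠ u' → e τ t = τ t := fun τ t h h' => by
      simp [he, Equiv.swap_apply_of_ne_of_ne h h']
    have hsplit : ∀ τ : Equiv.Perm (Fin n), ∑ t, A t (τ t) =
        A u (τ u) + (A u' (τ u') + ∑ t ∈ (Finset.univ.erase u).erase u', A t (τ t)) := by
      intro τ
      rw [← Finset.add_sum_erase _ _ (Finset.mem_univ u),
        ← Finset.add_sum_erase (Finset.univ.erase u) _ (a := u') (by simp [Ne.symm hu])]
    have hor : ∀ τ, B u' (τ u) (τ u') →
        (B u' (τ u) (τ u') ∧ S τ) ∨ (B u' (e τ u) (e τ u') ∧ S (e τ)) := by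
      intro τ hτ
      by_cases h1 : S τ
      · exact Or.inl ⟨hτ, h1⟩
      refine Or.inr ⟨by rw [heu, heu']; exact Ne.symm hτ, fun h2 => hτ ?_⟩
      have h1' : ∑ t, A t (τ t) = m := not_not.1 h1
      rw [hsplit] at h1' h2
      rw [heu, heu', Finset.sum_congr rfl fun t ht => by
        rw [heo τ t (Finset.ne_of_mem_erase (Finset.mem_of_mem_erase ht))
          (Finset.ne_of_mem_erase ht)]] at h2
      linarith
    calc 𝔼 τ : Equiv.Perm (Fin n), ind (B u' (τ u) (τ u'))
        ≤ prob (fun τ : Equiv.Perm (Fin n) => B u' (τ u) (τ u') ∧ S τ) +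
          prob (fun τ : Equiv.Perm (Fin n) => B u' (e τ u) (e τ u') ∧ S (e τ)) :=
          (prob_mono hor).trans (prob_or_le _ _)
      _ = _ := by
          rw [show prob (fun τ : Equiv.Perm (Fin n) => B u' (e τ u) (e τ u') ∧ S (e τ)) =
            prob (fun τ : Equiv.Perm (Fin n) => B u' (τ u) (τ u') ∧ S τ) from
            expect_comp_equiv e fun τ => ind (B u' (τ u) (τ u') ∧ S τ)]
          ring
  have htot : ∑ u', prob (fun τ : Equiv.Perm (Fin n) => B u' (τ u) (τ u') ∧ S τ) ≤
      (n - 1) * prob S := by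
    unfold prob
    rw [← Finset.expect_sum_comm, Finset.mul_expect]
    refine expect_mono fun τ => ?_
    rw [← Finset.add_sum_erase _ _ (Finset.mem_univ u), ind_false (by simp [hB]), zero_add]
    refine (Finset.sum_le_sum (g := fun _ => ind (S τ)) fun u' _ => ind_mono And.right).trans ?_
    rw [Finset.sum_const, Finset.card_erase_of_mem (Finset.mem_univ u), Finset.card_univ,
      Fintype.card_fin, nsmul_eq_mul, Nat.cast_sub u.pos, Nat.cast_one]
  refine (Finset.sum_le_sum fun u' _ => hrow u').trans ?_
  rw [← Finset.mul_sum, ← Finset.mul_sum]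
  have := mul_le_mul_of_nonneg_left htot
    (mul_nonneg (by linarith : (0 : ℝ) ≤ n) (by linarith : (0 : ℝ) ≤ (n : ℝ) - 1))
  linarith

/-- If a random transversal sum of a matrix is nearly always `m`, then the matrix is additive. -/
lemma additive_of_prob_lt (hn : 2 ≤ n) (A : Fin n → Fin n → ℝ) (m : ℝ)
    (h : ((n : ℝ) - 1) ^ 2 * prob (fun τ : Equiv.Perm (Fin n) => ∑ t, A t (τ t) ≠ m) < n - 2)
    (u u' v v' : Fin n) : A u v - A u' v = A u v' - A u' v' := by
  have hnR : (2 : ℝ) ≤ n := by exact_mod_cast hn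
  set q := prob fun τ : Equiv.Perm (Fin n) => ∑ t, A t (τ t) ≠ m with hq
  have hqT : prob (fun τ : Equiv.Perm (Fin n) => ∑ t, A (τ t) t ≠ m) = q := by
    rw [hq]
    unfold prob
    rw [← expect_comp_equiv (Equiv.inv (Equiv.Perm (Fin n)))
      fun τ => ind (∑ t, A t (τ t) ≠ m)]
    refine Finset.expect_congr rfl fun τ _ => ?_
    rw [← Equiv.sum_comp τ fun t => A t ((Equiv.inv (Equiv.Perm (Fin n))) τ t)]
    simp
  by_cases htwin : ∀ w, ∃ w', w' ≠ w ∧ ∀ t t', A t w' - A t' w' = A t w - A t' w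
  · by_contra hne
    set R : Fin n → Fin n → Prop := fun t t' => ∃ w w', A t w - A t' w ≠ A t w' - A t' w' with hR
    have hdeg : ∀ t, (∑ t', ind (R t t')) * (4 * ((n : ℝ) - 2)) ≤
        2 * n * ((n : ℝ) - 1) ^ 2 * q := by
      intro t
      refine le_trans ?_ (sum_row_rectangles_le A m t)
      rw [Finset.sum_mul]
      refine Finset.sum_le_sum fun t' _ => ?_
      by_cases ht : R t t'
      · rw [ind_true ht, one_mul]
        obtain ⟨w, w', hw⟩ := ht
        refine four_mul_sub_two_le_sum_ind (D := fun x => A t x - A t' x) hw fun x => ?_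
        obtain ⟨y, hy, hxy⟩ := htwin x
        exact ⟨y, hy, hxy t t'⟩
      · rw [ind_false ht, zero_mul]
        exact Finset.sum_nonneg fun _ _ => Finset.sum_nonneg fun _ _ => ind_nonneg _
    have hsum : (n : ℝ) ≤ ∑ t', ind (R u t') + ∑ t', ind (R u' t') := by
      rw [← Finset.sum_add_distrib]
      calc (n : ℝ) = ∑ _t : Fin n, (1 : ℝ) := by simp
        _ ≤ _ := Finset.sum_le_sum fun t _ => ?_
      by_cases h1 : R u t
      · rw [ind_true h1]; linarith [ind_nonneg (R u' t)]
      · have h2 : R u' t := ⟨v, v', fun hc => hne (by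
          have : A u v - A t v = A u v' - A t v' := by
            by_contra hh; exact h1 ⟨v, v', hh⟩
          linarith)⟩
        rw [ind_true h2]; linarith [ind_nonneg (R u t)]
    have h1 := hdeg u
    have h2 := hdeg u'
    have h3 := mul_le_mul_of_nonneg_right hsum (by linarith : (0 : ℝ) ≤ 4 * ((n : ℝ) - 2))
    nlinarith
  · push Not at htwin
    obtain ⟨w, hw⟩ := htwin
    exfalso
    have hcol := sum_row_rectangles_le (fun t t' => A t' t) m w
    rw [hqT] at hcol
    have hlow : ((n : ℝ) - 1) * (2 * (n - 1)) ≤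
        ∑ w', ∑ t, ∑ t', ind (A t w - A t w' ≠ A t' w - A t' w') := by
      rw [← Finset.add_sum_erase _ _ (Finset.mem_univ w)]
      refine le_add_of_nonneg_of_le
        (Finset.sum_nonneg fun _ _ => Finset.sum_nonneg fun _ _ => ind_nonneg _) ?_
      have := Finset.card_nsmul_le_sum (Finset.univ.erase w)
        (fun w' => ∑ t, ∑ t', ind (A t w - A t w' ≠ A t' w - A t' w')) (2 * ((n : ℝ) - 1))
        fun w' hw' => by
          obtain ⟨t, t', ht⟩ := hw w' (Finset.ne_of_mem_erase hw')
          refine two_mul_pred_le_sum_ind (D := fun x => A x w - A x w') (v₀ := t) (v₁ := t') ?_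
          intro hc
          apply ht
          linarith
      rw [Finset.card_erase_of_mem (Finset.mem_univ w), Finset.card_univ,
        Fintype.card_fin, nsmul_eq_mul, Nat.cast_sub w.pos, Nat.cast_one] at this
      exact this
    have h1 := hlow.trans hcol
    nlinarith [mul_lt_mul_of_pos_left h (by linarith : (0 : ℝ) < n)]

/-- An additive `0`-`1` matrix has constant rows or constant columns. -/
lemma rows_or_columns_constant {A : Fin n → Fin n → ℝ} (h01 : ∀ t t', A t t' = 0 ∨ A t t' = 1)
    (hA : ∀ u u' v v', A u v - A u' v = A u v' - A u' v') :
    (∀ t v v', A t v = A t v') ∨ ∀ t t' v, A t v = A t' v := by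
  by_cases h : ∀ t v v', A t v = A t v'
  · exact Or.inl h
  · push Not at h
    obtain ⟨t₀, v, v', hv⟩ := h
    have hcol : ∀ t, A t v = A t₀ v := by
      intro t
      have := hA t t₀ v v'
      rcases h01 t v with h1 | h1 <;> rcases h01 t v' with h2 | h2 <;>
        rcases h01 t₀ v with h3 | h3 <;> rcases h01 t₀ v' with h4 | h4 <;>
        first
          | exact h1.trans h3.symm
          | exact absurd (h3.trans h4.symm) hv
          | (rw [h1, h2, h3, h4] at this; exfalso; linarith)
    refine Or.inr fun t t' w => ?_
    have := hA t t' w v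
    rw [hcol t, hcol t'] at this
    linarith

end MatrixSums

section Resampling

open scoped BigOperators

variable {n k : ℕ}

lemma ind_ne_ge {α : Type*} (x y c : α) :
    ind (x = c ∧ ¬y = c) + ind (y = c ∧ ¬x = c) ≤ ind (x ≠ y) := by
  by_cases hx : x = c
  · by_cases hy : y = c
    · simp [ind, hx, hy]
    · subst hx; simp [ind, hy, Ne.symm hy]
  · simp only [hx, false_and, ind_false not_false, zero_add]
    exact ind_mono fun h hc => hx (hc.trans h.1)

lemma expect_expect_equiv {α β : Type*} [Fintype α] [Fintype β] (e : α × β ≃ α × β)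
    (f : α → β → ℝ) : 𝔼 a, 𝔼 b, f (e (a, b)).1 (e (a, b)).2 = 𝔼 a, 𝔼 b, f a b := by
  rw [← Finset.expect_product' Finset.univ Finset.univ f,
    ← Finset.expect_product' Finset.univ Finset.univ fun a b => f (e (a, b)).1 (e (a, b)).2]
  exact expect_comp_equiv e fun q => f q.1 q.2

lemma expect_expect_update {M : Type*} [Fintype M] [Nonempty M] (i : Fin k)
    (h : (Fin k → M) → ℝ) : 𝔼 x, 𝔼 a, h (Function.update x i a) = 𝔼 x, h x := by
  let e : (Fin k → M) × M ≃ (Fin k → M) × M :=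
    { toFun := fun q => (Function.update q.1 i q.2, q.1 i)
      invFun := fun q => (Function.update q.1 i q.2, q.1 i)
      left_inv := fun q => by simp
      right_inv := fun q => by simp }
  have := expect_expect_equiv e fun x _ => h x
  simpa only [e, Equiv.coe_fn_mk, Fintype.expect_const] using this

lemma expect_expect_piecewise {M : Type*} [Fintype M] [Nonempty M] (S : Finset (Fin k))
    (h : (Fin k → M) → ℝ) : 𝔼 x, 𝔼 y, h (S.piecewise x y) = 𝔼 x, h x := by
  have hinv : ∀ q : (Fin k → M) × (Fin k → M),
      (S.piecewise (S.piecewise q.1 q.2) (S.piecewise q.2 q.1),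
        S.piecewise (S.piecewise q.2 q.1) (S.piecewise q.1 q.2)) = q := fun q =>
    Prod.ext (by funext i; by_cases hi : i ∈ S <;> simp [hi])
      (by funext i; by_cases hi : i ∈ S <;> simp [hi])
  let e : (Fin k → M) × (Fin k → M) ≃ (Fin k → M) × (Fin k → M) :=
    { toFun := fun q => (S.piecewise q.1 q.2, S.piecewise q.2 q.1)
      invFun := fun q => (S.piecewise q.1 q.2, S.piecewise q.2 q.1)
      left_inv := hinv
      right_inv := hinv }
  have := expect_expect_equiv e fun x _ => h x
  simpa only [e, Equiv.coe_fn_mk, Fintype.expect_const] using this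

/-- The sum of `f` over the perfect matching determined by `σ`. -/
noncomputable def matchSum (f : (Fin k → Fin n) → ℝ) (σ : Fin k → Equiv.Perm (Fin n)) : ℝ :=
  ∑ t, f (diag σ t)

lemma matchSum_mul_right (f : (Fin k → Fin n) → ℝ) (σ : Fin k → Equiv.Perm (Fin n))
    (π : Equiv.Perm (Fin n)) : matchSum f (fun i => σ i * π) = matchSum f σ :=
  Equiv.sum_comp π fun t => f (diag σ t)

lemma diag_update (σ : Fin k → Equiv.Perm (Fin n)) (i : Fin k) (θ : Equiv.Perm (Fin n))
    (t : Fin n) : diag (Function.update σ i θ) t = Function.update (diag σ t) i (θ t) := by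
  funext l
  by_cases h : l = i
  · subst h; simp [diag]
  · simp [diag, h]

lemma prob_matchSum_update (f : (Fin k → Fin n) → ℝ) (m : ℝ) (i : Fin k)
    (θ : Equiv.Perm (Fin n)) :
    prob (fun σ => matchSum f (Function.update σ i θ) ≠ m) = prob fun σ => matchSum f σ ≠ m := by
  have indep : ∀ θ', 𝔼 σ, ind (matchSum f (Function.update σ i θ') ≠ m) =
      𝔼 σ, ind (matchSum f (Function.update σ i θ) ≠ m) := by
    intro θ'
    rw [← expect_comp_equiv (Equiv.piCongrRight fun _ => Equiv.mulRight (θ⁻¹ * θ'))]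
    refine Finset.expect_congr rfl fun σ _ => ?_
    rw [← matchSum_mul_right f (Function.update σ i θ) (θ⁻¹ * θ')]
    congr 3
    funext l
    by_cases h : l = i
    · subst h; simp
    · simp [h]
  unfold prob
  rw [← expect_expect_update i fun σ => ind (matchSum f σ ≠ m), expect_swap]
  simp only [indep, Fintype.expect_const]

/-- The difference of `f` between two parallel hyperplanes. -/
def lineDiff (f : (Fin k → Fin n) → ℝ) (i : Fin k) (a b : Fin n) (x : Fin k → Fin n) : ℝ :=
  f (Function.update x i a) - f (Function.update x i b)

lemma prob_lineDiff_ne_le (f : (Fin k → Fin n) → ℝ) (m : ℝ) (i : Fin k) {a b t₀ t₁ : Fin n}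
    (hab : a ≠ b) (ht : t₀ ≠ t₁) :
    prob (fun σ : Fin k → Equiv.Perm (Fin n) =>
      lineDiff f i a b (diag σ t₀) ≠ lineDiff f i a b (diag σ t₁)) ≤
      2 * prob fun σ => matchSum f σ ≠ m := by
  obtain ⟨θ, h0, h1⟩ := exists_perm_apply_pair hab ht
  set θ' := Equiv.swap a b * θ with hθ'
  have h0' : θ' t₀ = b := by simp [hθ', h0]
  have h1' : θ' t₁ = a := by simp [hθ', h1]
  have ho : ∀ t, t ≠ t₀ → t ≠ t₁ → θ' t = θ t := by
    intro t ht0 ht1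
    rw [hθ', Equiv.Perm.mul_apply, Equiv.swap_apply_of_ne_of_ne]
    · rw [← h0]; exact fun h => ht0 (θ.injective h)
    · rw [← h1]; exact fun h => ht1 (θ.injective h)
  have hsplit : ∀ (σ : Fin k → Equiv.Perm (Fin n)) (π : Equiv.Perm (Fin n)),
      matchSum f (Function.update σ i π) =
        f (Function.update (diag σ t₀) i (π t₀)) + (f (Function.update (diag σ t₁) i (π t₁)) +
          ∑ t ∈ (Finset.univ.erase t₀).erase t₁, f (Function.update (diag σ t) i (π t))) := by
    intro σ π
    unfold matchSum
    simp only [diag_update]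
    rw [← Finset.add_sum_erase _ _ (Finset.mem_univ t₀),
      ← Finset.add_sum_erase (Finset.univ.erase t₀) _ (a := t₁) (by simp [Ne.symm ht])]
  calc _ ≤ prob (fun σ => matchSum f (Function.update σ i θ) ≠ m ∨
        matchSum f (Function.update σ i θ') ≠ m) := prob_mono fun σ hσ => ?_
    _ ≤ _ := prob_or_le _ _
    _ = _ := by rw [prob_matchSum_update, prob_matchSum_update]; ring
  by_contra! hc
  obtain ⟨hc1, hc2⟩ := hc
  rw [hsplit, h0, h1] at hc1
  rw [hsplit, h0', h1', Finset.sum_congr rfl fun t ht => by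
    rw [ho t (Finset.ne_of_mem_erase (Finset.mem_of_mem_erase ht))
      (Finset.ne_of_mem_erase ht)]] at hc2
  apply hσ
  unfold lineDiff
  linarith

/-- If the matching sums are nearly constant, each directional difference is nearly constant. -/
lemma exists_lineDiff_const (hn : 8 ≤ n) {f : (Fin k → Fin n) → ℝ} (h01 : ∀ x, f x = 0 ∨ f x = 1)
    {m : ℝ} (hp : prob (fun σ => matchSum f σ ≠ m) ≤ 1 / 64) (i : Fin k) {a b : Fin n}
    (hab : a ≠ b) : ∃ c : ℝ, (c = -1 ∨ c = 0 ∨ c = 1) ∧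
      prob (fun x => lineDiff f i a b x ≠ c) ≤ 2 * prob fun σ => matchSum f σ ≠ m := by
  have hn0 : NeZero n := ⟨by omega⟩
  have hnR : (8 : ℝ) ≤ n := by exact_mod_cast hn
  set p := prob fun σ => matchSum f σ ≠ m with hpdef
  have hp0 : 0 ≤ p := prob_nonneg _
  set μ : ℝ → ℝ := fun c => prob fun x => lineDiff f i a b x = c with hμ
  have hμ0 : ∀ c, 0 ≤ μ c := fun c => prob_nonneg _
  have hμ1 : ∀ c, μ c ≤ 1 := fun c => prob_le_one _
  have hiso : ∀ c, μ c * (1 - μ c) ≤ 7 / 6 * p := by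
    intro c
    have ht : (⟨0, by omega⟩ : Fin n) ≠ ⟨1, by omega⟩ := by simp
    have h1 := mul_prob_not_le_prob_pair ht fun x => lineDiff f i a b x = c
    have h2 := mul_prob_not_le_prob_pair ht.symm fun x => lineDiff f i a b x = c
    have h3 := prob_lineDiff_ne_le f m i hab ht
    have h4 : prob (fun σ : Fin k → Equiv.Perm (Fin n) =>
          lineDiff f i a b (diag σ ⟨0, by omega⟩) = c ∧
          ¬lineDiff f i a b (diag σ ⟨1, by omega⟩) = c) +
        prob (fun σ : Fin k → Equiv.Perm (Fin n) =>
          lineDiff f i a b (diag σ ⟨1, by omega⟩) = c ∧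
          ¬lineDiff f i a b (diag σ ⟨0, by omega⟩) = c) ≤
        prob (fun σ : Fin k → Equiv.Perm (Fin n) =>
          lineDiff f i a b (diag σ ⟨0, by omega⟩) ≠ lineDiff f i a b (diag σ ⟨1, by omega⟩)) := by
      unfold prob
      rw [← Finset.expect_add_distrib]
      refine expect_mono fun σ => ?_
      exact ind_ne_ge _ _ _
    have h5 : ((n : ℝ) - 2) * (2 * (μ c * (1 - μ c))) ≤ (n - 1) * (2 * p) := by
      have h6 := mul_le_mul_of_nonneg_left (h4.trans h3) (by linarith : (0 : ℝ) ≤ (n : ℝ) - 1)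
      simp only [hμ]
      linarith
    have h6 : ((n : ℝ) - 1) * (2 * p) ≤ (n - 2) * (7 / 6 * (2 * p)) := by nlinarith
    have h7 := le_of_mul_le_mul_left (h5.trans h6) (by linarith : (0 : ℝ) < (n : ℝ) - 2)
    linarith
  have hsum : μ (-1) + μ 0 + μ 1 = 1 := by
    simp only [hμ, prob]
    rw [← Finset.expect_add_distrib, ← Finset.expect_add_distrib]
    rw [show (1 : ℝ) = 𝔼 _x : Fin k → Fin n, (1 : ℝ) by rw [Fintype.expect_const]]
    refine Finset.expect_congr rfl fun x _ => ?_
    unfold lineDiff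
    rcases h01 (Function.update x i a) with h | h <;> rcases h01 (Function.update x i b) with h' | h'
      <;> rw [h, h'] <;> norm_num [ind]
  have hbig : ∀ c, 1 / 2 < μ c → 1 - μ c ≤ 2 * p := by
    intro c hc
    have h1 := hiso c
    have h2 : 1 - μ c ≤ 7 / 192 := by nlinarith [hμ1 c]
    nlinarith [hμ1 c]
  have hsmall : ∀ c, μ c ≤ 1 / 2 → μ c ≤ 7 / 192 := by
    intro c hc
    nlinarith [hiso c, hμ0 c]
  have hne : ∀ c, prob (fun x => lineDiff f i a b x ≠ c) = 1 - μ c := fun c => prob_not _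
  by_cases h1 : 1 / 2 < μ (-1)
  · exact ⟨-1, Or.inl rfl, (hne _).trans_le (hbig _ h1)⟩
  by_cases h2 : 1 / 2 < μ 0
  · exact ⟨0, Or.inr (Or.inl rfl), (hne _).trans_le (hbig _ h2)⟩
  by_cases h3 : 1 / 2 < μ 1
  · exact ⟨1, Or.inr (Or.inr rfl), (hne _).trans_le (hbig _ h3)⟩
  have := hsmall _ (not_lt.1 h1)
  have := hsmall _ (not_lt.1 h2)
  have := hsmall _ (not_lt.1 h3)
  linarith

end Resampling

section RowsAndColumns

open scoped BigOperators

variable {n k : ℕ} {f : (Fin k → Fin n) → ℝ} {m : ℝ}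

/-- For every `t`, the value of `f` at the mixture of the `t`-th member on `S` and the `t'`-th
member off `S` does not depend on `t'`; moreover the matching sum is `m`. -/
def IsRow (f : (Fin k → Fin n) → ℝ) (m : ℝ) (S : Finset (Fin k))
    (σ : Fin k → Equiv.Perm (Fin n)) : Prop :=
  (∀ t t' t'', f (S.piecewise (diag σ t) (diag σ t')) = f (S.piecewise (diag σ t) (diag σ t''))) ∧
    matchSum f σ = m

lemma IsRow.apply_eq {S : Finset (Fin k)} {σ : Fin k → Equiv.Perm (Fin n)} (h : IsRow f m S σ)
    (t t' : Fin n) : f (S.piecewise (diag σ t) (diag σ t')) = f (diag σ t) := by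
  rw [h.1 t t' t, Finset.piecewise_same]

lemma IsRow.apply_eq_compl {S : Finset (Fin k)} {σ : Fin k → Equiv.Perm (Fin n)}
    (h : IsRow f m Sᶜ σ) (t t' : Fin n) :
    f (S.piecewise (diag σ t) (diag σ t')) = f (diag σ t') := by
  rw [← h.apply_eq t' t, Finset.piecewise_compl]

lemma exists_ne_of_matchSum_eq (h01 : ∀ x, f x = 0 ∨ f x = 1) (hm0 : 0 < m) (hmn : m < n)
    {σ : Fin k → Equiv.Perm (Fin n)} (hσ : matchSum f σ = m) :
    ∃ t t', f (diag σ t) ≠ f (diag σ t') := by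
  by_contra! hc
  have hn : 0 < n := by exact_mod_cast hm0.trans hmn
  have h : (n : ℝ) * f (diag σ ⟨0, hn⟩) = m := by
    rw [← hσ]
    unfold matchSum
    rw [Finset.sum_congr rfl fun t _ => hc t ⟨0, hn⟩]
    simp
  rcases h01 (diag σ ⟨0, hn⟩) with h1 | h1 <;> rw [h1] at h <;> linarith

lemma IsRow.not_compl (h01 : ∀ x, f x = 0 ∨ f x = 1) (hm0 : 0 < m) (hmn : m < n)
    {S : Finset (Fin k)} {σ : Fin k → Equiv.Perm (Fin n)} (h : IsRow f m S σ) :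
    ¬IsRow f m Sᶜ σ := by
  intro h'
  obtain ⟨t, t', ht⟩ := exists_ne_of_matchSum_eq h01 hm0 hmn h.2
  exact ht ((h.apply_eq t t').symm.trans (h'.apply_eq_compl t t'))

lemma isRow_or_isRow_compl (hn : 2 ≤ n) (h01 : ∀ x, f x = 0 ∨ f x = 1) {S : Finset (Fin k)}
    {σ : Fin k → Equiv.Perm (Fin n)}
    (h : ((n : ℝ) - 1) ^ 2 * prob (fun τ : Equiv.Perm (Fin n) =>
      ∑ t, f (S.piecewise (diag σ t) (diag σ (τ t))) ≠ m) < n - 2) :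
    IsRow f m S σ ∨ IsRow f m Sᶜ σ := by
  have hnR : (2 : ℝ) ≤ n := by exact_mod_cast hn
  have hadd := additive_of_prob_lt hn (fun t t' => f (S.piecewise (diag σ t) (diag σ t'))) m h
  obtain ⟨τ, hτ⟩ : ∃ τ : Equiv.Perm (Fin n),
      ∑ t, f (S.piecewise (diag σ t) (diag σ (τ t))) = m := by
    by_contra! hc
    have : prob (fun τ : Equiv.Perm (Fin n) =>
        ∑ t, f (S.piecewise (diag σ t) (diag σ (τ t))) ≠ m) = 1 := by
      unfold prob
      simp only [ind_true (hc _), Fintype.expect_const]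
    rw [this] at h
    nlinarith
  rcases rows_or_columns_constant (fun t t' => h01 _) hadd with hr | hc
  · refine Or.inl ⟨hr, ?_⟩
    rw [← hτ]
    refine Finset.sum_congr rfl fun t _ => ?_
    rw [hr t (τ t) t, Finset.piecewise_same]
  · refine Or.inr ⟨fun t t' t'' => ?_, ?_⟩
    · rw [Finset.piecewise_compl, Finset.piecewise_compl]
      exact hc t' t'' t
    · rw [← hτ]
      unfold matchSum
      rw [← Equiv.sum_comp τ fun t => f (diag σ t)]
      refine Finset.sum_congr rfl fun t _ => ?_
      rw [hc t (τ t) (τ t), Finset.piecewise_same]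

lemma expect_prob_mixed_sum (f : (Fin k → Fin n) → ℝ) (m : ℝ) (S : Finset (Fin k)) :
    𝔼 σ : Fin k → Equiv.Perm (Fin n), prob (fun τ : Equiv.Perm (Fin n) =>
      ∑ t, f (S.piecewise (diag σ t) (diag σ (τ t))) ≠ m) =
      prob fun σ => matchSum f σ ≠ m := by
  unfold prob
  rw [expect_swap]
  have : ∀ τ : Equiv.Perm (Fin n), 𝔼 σ : Fin k → Equiv.Perm (Fin n),
      ind (∑ t, f (S.piecewise (diag σ t) (diag σ (τ t))) ≠ m) =
      𝔼 σ, ind (matchSum f σ ≠ m) := by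
    intro τ
    rw [← expect_comp_equiv (Equiv.piCongrRight fun i =>
      if i ∈ S then Equiv.refl _ else Equiv.mulRight τ) fun σ => ind (matchSum f σ ≠ m)]
    refine Finset.expect_congr rfl fun σ _ => ?_
    refine ind_congr (not_congr (Eq.congr_left (Finset.sum_congr rfl fun t _ => ?_)))
    congr 1
    funext i
    by_cases hi : i ∈ S <;> simp [hi, diag]
  simp only [this, Fintype.expect_const]

/-- Most matchings are of row or of column type. -/
lemma prob_undecided_le (hn : 8 ≤ n) (h01 : ∀ x, f x = 0 ∨ f x = 1)
    (hp : 8 * (n : ℝ) * prob (fun σ => matchSum f σ ≠ m) ≤ 1) (S : Finset (Fin k)) :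
    prob (fun σ => ¬IsRow f m S σ ∧ ¬IsRow f m Sᶜ σ) ≤ 49 / 384 := by
  have hnR : (8 : ℝ) ≤ n := by exact_mod_cast hn
  set p := prob fun σ => matchSum f σ ≠ m with hpdef
  set η := prob fun σ => ¬IsRow f m S σ ∧ ¬IsRow f m Sᶜ σ with hη
  have h1 : ((n : ℝ) - 2) * η ≤ (n - 1) ^ 2 * p := by
    rw [hpdef, ← expect_prob_mixed_sum f m S, Finset.mul_expect]
    refine mul_prob_le_expect (fun σ => mul_nonneg (sq_nonneg _) (prob_nonneg _)) fun σ hσ => ?_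
    by_contra! hc
    rcases isRow_or_isRow_compl (by omega) h01 hc with h | h
    · exact hσ.1 h
    · exact hσ.2 h
  have h2 : (8 * (n : ℝ) * (n - 2)) * η ≤ (n - 1) ^ 2 := by
    have := mul_le_mul_of_nonneg_left hp (sq_nonneg ((n : ℝ) - 1))
    have := mul_le_mul_of_nonneg_left h1 (by linarith : (0 : ℝ) ≤ 8 * n)
    linarith
  have h3 : ((n : ℝ) - 1) ^ 2 ≤ 8 * (n : ℝ) * (n - 2) * (49 / 384) := by nlinarith
  exact le_of_mul_le_mul_left (h2.trans h3) (by nlinarith)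

lemma sum_ind_and_not_le (K : Fin n → Prop) :
    ∑ t, ∑ t', ind (K t ∧ ¬K t') ≤ (n : ℝ) ^ 2 / 4 := by
  simp only [← ind_mul, ← Finset.mul_sum, ← Finset.sum_mul, ind_not, Finset.sum_sub_distrib]
  simp only [Finset.sum_const, Finset.card_univ, Fintype.card_fin, nsmul_eq_mul, mul_one]
  nlinarith [sq_nonneg ((n : ℝ) - 2 * ∑ t, ind (K t))]

/-- Conditionally on the `S`-part of a random matching, the row and the column type cannot both
be likely. -/
lemma prob_row_mul_prob_col_le (hn : 8 ≤ n) (h01 : ∀ x, f x = 0 ∨ f x = 1) (hm0 : 0 < m)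
    (hmn : m < n) (S : Finset (Fin k)) (σ : Fin k → Equiv.Perm (Fin n)) :
    prob (fun ρ => IsRow f m S (S.piecewise σ ρ)) *
        prob (fun ρ => IsRow f m Sᶜ (S.piecewise σ ρ)) ≤
      1 / 3 * prob fun ρ => ¬IsRow f m S (S.piecewise σ ρ) ∧ ¬IsRow f m Sᶜ (S.piecewise σ ρ) := by
  have hn0 : NeZero n := ⟨by omega⟩
  have hnR : (8 : ℝ) ≤ n := by exact_mod_cast hn
  set K : (Fin k → Fin n) → Prop := fun x =>
    ∃ t t', f (S.piecewise (diag σ t) x) ≠ f (S.piecewise (diag σ t') x) with hK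
  set κ := prob K with hκ
  set η := prob fun ρ =>
    ¬IsRow f m S (S.piecewise σ ρ) ∧ ¬IsRow f m Sᶜ (S.piecewise σ ρ) with hη
  have hκt : ∀ t, prob (fun ρ : Fin k → Equiv.Perm (Fin n) => K (diag ρ t)) = κ := fun t =>
    expect_tuple_apply (fun x => ind (K x)) fun _ => t
  have hdiag : ∀ ρ t t', S.piecewise (diag (S.piecewise σ ρ) t) (diag (S.piecewise σ ρ) t') =
      S.piecewise (diag σ t) (diag ρ t') := by
    intro ρ t t'
    funext i
    by_cases hi : i ∈ S <;> simp [hi, diag]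
  have hrow : ∀ ρ, IsRow f m S (S.piecewise σ ρ) → ∀ s, K (diag ρ s) := by
    intro ρ h s
    obtain ⟨t, t', ht⟩ := exists_ne_of_matchSum_eq h01 hm0 hmn h.2
    refine ⟨t, t', ?_⟩
    rwa [← hdiag, ← hdiag, h.apply_eq, h.apply_eq]
  have hcol : ∀ ρ, IsRow f m Sᶜ (S.piecewise σ ρ) → ∀ s, ¬K (diag ρ s) := by
    rintro ρ h s ⟨t, t', ht⟩
    apply ht
    rw [← hdiag, ← hdiag, h.apply_eq_compl, h.apply_eq_compl]
  have hr : prob (fun ρ => IsRow f m S (S.piecewise σ ρ)) ≤ κ := by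
    rw [← hκt 0]
    exact prob_mono fun ρ h => hrow ρ h 0
  have hc : prob (fun ρ => IsRow f m Sᶜ (S.piecewise σ ρ)) ≤ 1 - κ := by
    rw [← hκt 0, ← prob_not]
    exact prob_mono fun ρ h => hcol ρ h 0
  have hcount : 𝔼 ρ : Fin k → Equiv.Perm (Fin n),
      ∑ t, ∑ t', ind (K (diag ρ t) ∧ ¬K (diag ρ t')) ≤ (n : ℝ) ^ 2 / 4 * η := by
    rw [hη]
    unfold prob
    rw [Finset.mul_expect]
    refine expect_mono fun ρ => ?_
    by_cases h : ¬IsRow f m S (S.piecewise σ ρ) ∧ ¬IsRow f m Sᶜ (S.piecewise σ ρ)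
    · rw [ind_true h, mul_one]
      exact sum_ind_and_not_le fun t => K (diag ρ t)
    · rw [ind_false h, mul_zero]
      refine (Finset.sum_eq_zero fun t _ => Finset.sum_eq_zero fun t' _ => ind_false ?_).le
      rintro ⟨h1, h2⟩
      exact h ⟨fun hR => h2 (hrow ρ hR t'), fun hC => hcol ρ hC t h1⟩
  have hlow : (n : ℝ) * (n - 2) * (κ * (1 - κ)) ≤ 𝔼 ρ : Fin k → Equiv.Perm (Fin n),
      ∑ t, ∑ t', ind (K (diag ρ t) ∧ ¬K (diag ρ t')) := by
    rw [Finset.expect_sum_comm]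
    have hrowsum : ∀ t : Fin n, ((n : ℝ) - 2) * (κ * (1 - κ)) ≤ 𝔼 ρ : Fin k → Equiv.Perm (Fin n),
        ∑ t', ind (K (diag ρ t) ∧ ¬K (diag ρ t')) := by
      intro t
      rw [Finset.expect_sum_comm, ← Finset.add_sum_erase _ _ (Finset.mem_univ t)]
      refine le_add_of_nonneg_of_le (prob_nonneg _) ?_
      have h1 : ∀ t' ∈ Finset.univ.erase t, ((n : ℝ) - 2) * (κ * (1 - κ)) / (n - 1) ≤
          𝔼 ρ : Fin k → Equiv.Perm (Fin n), ind (K (diag ρ t) ∧ ¬K (diag ρ t')) := by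
        intro t' ht'
        rw [div_le_iff₀ (by linarith), mul_comm (𝔼 ρ, _)]
        exact mul_prob_not_le_prob_pair (Finset.ne_of_mem_erase ht').symm K
      have h2 := Finset.card_nsmul_le_sum _ _ _ h1
      rw [Finset.card_erase_of_mem (Finset.mem_univ t), Finset.card_univ, Fintype.card_fin,
        nsmul_eq_mul, Nat.cast_sub t.pos, Nat.cast_one,
        mul_div_cancel₀ _ (by linarith : (n : ℝ) - 1 ≠ 0)] at h2
      exact h2
    have := Finset.card_nsmul_le_sum Finset.univ _ _ fun t _ => hrowsum t
    rw [Finset.card_univ, Fintype.card_fin, nsmul_eq_mul] at this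
    linarith
  have hκ0 : 0 ≤ κ := prob_nonneg _
  have hκ1 : κ ≤ 1 := prob_le_one _
  have hη0 : 0 ≤ η := prob_nonneg _
  have h1 : (n : ℝ) * ((n - 2) * (κ * (1 - κ))) ≤ n * (n / 4 * η) := by
    have := hlow.trans hcount
    linarith
  have h2 := le_of_mul_le_mul_left h1 (by linarith)
  have h3 : (n : ℝ) / 4 * η ≤ (n - 2) * (1 / 3 * η) := by nlinarith
  have h4 := le_of_mul_le_mul_left (h2.trans h3) (by linarith)
  exact (mul_le_mul hr hc (prob_nonneg _) hκ0).trans h4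

end RowsAndColumns

section Bias

open scoped BigOperators

variable {n k : ℕ} {f : (Fin k → Fin n) → ℝ} {m : ℝ}

lemma sq_expect_cond_diff_ge (hn : 8 ≤ n) (h01 : ∀ x, f x = 0 ∨ f x = 1) (hm0 : 0 < m)
    (hmn : m < n) (S : Finset (Fin k)) :
    (1 - prob fun σ => ¬IsRow f m S σ ∧ ¬IsRow f m Sᶜ σ) ^ 2 -
        4 / 3 * prob (fun σ => ¬IsRow f m S σ ∧ ¬IsRow f m Sᶜ σ) ≤
      𝔼 σ, (𝔼 ρ, (ind (IsRow f m S (S.piecewise σ ρ)) -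
        ind (IsRow f m Sᶜ (S.piecewise σ ρ)))) ^ 2 := by
  set r := fun σ => prob fun ρ => IsRow f m S (S.piecewise σ ρ) with hr
  set c := fun σ => prob fun ρ => IsRow f m Sᶜ (S.piecewise σ ρ) with hc
  set u := fun σ => prob fun ρ => ¬IsRow f m S (S.piecewise σ ρ) ∧ ¬IsRow f m Sᶜ (S.piecewise σ ρ)
    with hu
  set η := prob fun σ => ¬IsRow f m S σ ∧ ¬IsRow f m Sᶜ σ with hη
  have huη : 𝔼 σ, u σ = η :=
    expect_expect_piecewise S fun σ => ind (¬IsRow f m S σ ∧ ¬IsRow f m Sᶜ σ)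
  have hsum : ∀ σ, r σ + c σ = 1 - u σ := by
    intro σ
    simp only [hr, hc, hu, prob]
    rw [show (1 : ℝ) = 𝔼 _ρ : Fin k → Equiv.Perm (Fin n), (1 : ℝ) by rw [Fintype.expect_const],
      ← Finset.expect_add_distrib, ← Finset.expect_sub_distrib]
    refine Finset.expect_congr rfl fun ρ _ => ?_
    by_cases h : IsRow f m S (S.piecewise σ ρ)
    · simp [ind, h, h.not_compl h01 hm0 hmn]
    · by_cases h' : IsRow f m Sᶜ (S.piecewise σ ρ) <;> simp [ind, h, h']
  have hmul : ∀ σ, r σ * c σ ≤ 1 / 3 * u σ := prob_row_mul_prob_col_le hn h01 hm0 hmn S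
  have hsq : (1 - η) ^ 2 ≤ 𝔼 σ, (1 - u σ) ^ 2 := by
    have := sq_expect_le fun σ => 1 - u σ
    rwa [Finset.expect_sub_distrib, huη, Fintype.expect_const] at this
  calc _ ≤ 𝔼 σ, (1 - u σ) ^ 2 - 4 / 3 * 𝔼 σ, u σ := by rw [huη]; linarith
    _ = 𝔼 σ, ((1 - u σ) ^ 2 - 4 / 3 * u σ) := by
      rw [Finset.expect_sub_distrib, Finset.mul_expect]
    _ ≤ _ := expect_mono fun σ => ?_
  rw [Finset.expect_sub_distrib]
  change _ ≤ (r σ - c σ) ^ 2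
  nlinarith [hmul σ, hsum σ]

/-- The probability of the row type minus the probability of the column type. -/
noncomputable def bias (f : (Fin k → Fin n) → ℝ) (m : ℝ) (S : Finset (Fin k)) : ℝ :=
  prob (IsRow f m S) - prob (IsRow f m Sᶜ)

lemma bias_compl (S : Finset (Fin k)) : bias f m Sᶜ = -bias f m S := by
  unfold bias
  rw [compl_compl]
  ring

lemma prob_row_add_prob_col (h01 : ∀ x, f x = 0 ∨ f x = 1) (hm0 : 0 < m) (hmn : m < n)
    (S : Finset (Fin k)) : prob (IsRow f m S) + prob (IsRow f m Sᶜ) =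
      1 - prob fun σ => ¬IsRow f m S σ ∧ ¬IsRow f m Sᶜ σ := by
  unfold prob
  rw [show (1 : ℝ) = 𝔼 _ρ : Fin k → Equiv.Perm (Fin n), (1 : ℝ) by rw [Fintype.expect_const],
    ← Finset.expect_add_distrib, ← Finset.expect_sub_distrib]
  refine Finset.expect_congr rfl fun σ _ => ?_
  by_cases h : IsRow f m S σ
  · simp [ind, h, h.not_compl h01 hm0 hmn]
  · by_cases h' : IsRow f m Sᶜ σ <;> simp [ind, h, h']

/-- Dichotomy: for each set of coordinates one of the two types clearly dominates. -/
lemma bias_dichotomy (hn : 8 ≤ n) (h01 : ∀ x, f x = 0 ∨ f x = 1) (hm0 : 0 < m) (hmn : m < n)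
    (hp : 8 * (n : ℝ) * prob (fun σ => matchSum f σ ≠ m) ≤ 1) (S : Finset (Fin k)) :
    bias f m S ≤ -(1 / 2) ∨ 1 / 2 ≤ bias f m S := by
  set η := prob fun σ => ¬IsRow f m S σ ∧ ¬IsRow f m Sᶜ σ with hη
  have hη1 : η ≤ 49 / 384 := prob_undecided_le hn h01 hp S
  have hη0 : 0 ≤ η := prob_nonneg _
  set Z : (Fin k → Equiv.Perm (Fin n)) → ℝ := fun σ =>
    ind (IsRow f m S σ) - ind (IsRow f m Sᶜ σ) with hZ
  have hz : 𝔼 σ, 𝔼 ρ, Z (S.piecewise σ ρ) = bias f m S := by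
    rw [expect_expect_piecewise, Finset.expect_sub_distrib]
    rfl
  have hz2 : 𝔼 σ, 𝔼 ρ, Z (S.piecewise σ ρ) ^ 2 = 1 - η := by
    rw [expect_expect_piecewise S fun σ => Z σ ^ 2, hη, ← prob_row_add_prob_col h01 hm0 hmn]
    unfold prob
    rw [← Finset.expect_add_distrib]
    refine Finset.expect_congr rfl fun σ _ => ?_
    by_cases h : IsRow f m S σ
    · simp [hZ, ind, h, h.not_compl h01 hm0 hmn]
    · by_cases h' : IsRow f m Sᶜ σ <;> simp [hZ, ind, h, h']
  have h1 := sq_expect_cond_diff_ge hn h01 hm0 hmn S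
  have h2 := sq_expect_cond_diff_ge hn h01 hm0 hmn Sᶜ
  have h3 := sq_expect_add_expect_sq_ge fun σ ρ => Z (S.piecewise σ ρ)
  have hη' : prob (fun σ => ¬IsRow f m Sᶜ σ ∧ ¬IsRow f m Sᶜᶜ σ) = η := by
    rw [compl_compl, hη]
    exact congrArg prob (funext fun σ => propext and_comm)
  have h4 : 𝔼 σ, (𝔼 ρ, (ind (IsRow f m Sᶜ (Sᶜ.piecewise σ ρ)) -
      ind (IsRow f m Sᶜᶜ (Sᶜ.piecewise σ ρ)))) ^ 2 =
      𝔼 ρ, (𝔼 σ, Z (S.piecewise σ ρ)) ^ 2 := by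
    refine Finset.expect_congr rfl fun ρ _ => ?_
    simp only [compl_compl, Finset.piecewise_compl, hZ, Finset.expect_sub_distrib]
    ring
  rw [hη', h4] at h2
  rw [hz, hz2] at h3
  have h5 : (1 / 2) ^ 2 ≤ bias f m S ^ 2 := by
    change (1 - η) ^ 2 - 4 / 3 * η ≤ 𝔼 σ, (𝔼 ρ, Z (S.piecewise σ ρ)) ^ 2 at h1
    nlinarith
  by_contra! hc
  nlinarith

lemma bias_univ (hn : 8 ≤ n) (h01 : ∀ x, f x = 0 ∨ f x = 1) (hm0 : 0 < m) (hmn : m < n)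
    (hp : 8 * (n : ℝ) * prob (fun σ => matchSum f σ ≠ m) ≤ 1) :
    1 / 2 ≤ bias f m (Finset.univ : Finset (Fin k)) := by
  have hnR : (8 : ℝ) ≤ n := by exact_mod_cast hn
  have hrow : prob (IsRow f m (Finset.univ : Finset (Fin k))) =
      1 - prob fun σ => matchSum f σ ≠ m := by
    rw [← prob_not]
    refine congrArg prob (funext fun σ => propext ?_)
    simp [IsRow]
  have hle := prob_row_add_prob_col h01 hm0 hmn (Finset.univ : Finset (Fin k))
  have h0 : 0 ≤ prob fun σ => ¬IsRow f m (Finset.univ : Finset (Fin k)) σ ∧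
    ¬IsRow f m (Finset.univ : Finset (Fin k))ᶜ σ := prob_nonneg _
  have hp' : prob (fun σ => matchSum f σ ≠ m) ≤ 1 / 64 := by
    nlinarith [prob_nonneg fun σ : Fin k → Equiv.Perm (Fin n) => matchSum f σ ≠ m]
  rcases bias_dichotomy hn h01 hm0 hmn hp (Finset.univ : Finset (Fin k)) with h | h
  · unfold bias at h
    linarith
  · exact h

lemma expect_lineDiff_pair_le {q : ℝ} (hflat : ∀ i a b, a ≠ b →
      prob (fun x => lineDiff f i a b x ≠ 0) ≤ q) (S : Finset (Fin k)) (j : Fin k)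
    {t t' : Fin n} (ht : t ≠ t') :
    prob (fun σ : Fin k → Equiv.Perm (Fin n) =>
      lineDiff f j (σ j t) (σ j t') (S.piecewise (diag σ t) (diag σ t')) ≠ 0) ≤ q := by
  have hn0 : NeZero n := ⟨by have := t.pos; omega⟩
  unfold prob
  rw [← expect_expect_update j, expect_swap]
  refine (expect_mono (g := fun _ => q) fun ρ => ?_).trans_eq (Fintype.expect_const _)
  refine le_trans (le_of_eq ?_) (hflat j (ρ t) (ρ t') (ρ.injective.ne ht))
  unfold prob
  rw [← expect_tuple_apply (fun x => ind (lineDiff f j (ρ t) (ρ t') x ≠ 0))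
    (S.piecewise (fun _ => t) fun _ => t')]
  refine Finset.expect_congr rfl fun σ _ => ?_
  have : ∀ a, Function.update (S.piecewise (diag (Function.update σ j ρ) t)
      (diag (Function.update σ j ρ) t')) j a =
      Function.update (fun i => σ i (S.piecewise (fun _ => t) (fun _ => t') i)) j a := by
    intro a
    funext i
    by_cases hij : i = j
    · subst hij; simp
    · by_cases hi : i ∈ S <;> simp [hij, hi, diag]
  simp only [lineDiff, this, Function.update_self]

/-- If no directional difference is typically nonzero, matching sums cannot be nearly constant. -/
theorem not_flat (hn : 8 ≤ n) (h01 : ∀ x, f x = 0 ∨ f x = 1) (hm : 2 ≤ m) (hmn : m < n)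
    (hp : 4 * (n : ℝ) * m * prob (fun σ => matchSum f σ ≠ m) ≤ 1) :
    ¬∀ i a b, a ≠ b → prob (fun x => lineDiff f i a b x ≠ 0) ≤
      2 * prob fun σ => matchSum f σ ≠ m := by
  intro hflat
  have hnR : (8 : ℝ) ≤ n := by exact_mod_cast hn
  have hm0 : 0 < m := by linarith
  set p := prob fun σ => matchSum f σ ≠ m with hpdef
  have hp0 : 0 ≤ p := prob_nonneg _
  have hp8 : 8 * (n : ℝ) * p ≤ 1 := by
    have : 0 ≤ 4 * (n : ℝ) * p * (m - 2) := mul_nonneg (by positivity) (by linarith)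
    linarith
  have hall : ∀ S : Finset (Fin k), bias f m S ≤ -(1 / 2) := by
    intro S
    induction S using Finset.induction_on with
    | empty =>
      have := bias_univ (k := k) hn h01 hm0 hmn hp8
      rw [← Finset.compl_univ, bias_compl]
      linarith
    | insert j S hj ih =>
      refine (bias_dichotomy hn h01 hm0 hmn hp8 (insert j S)).resolve_right fun hbias => ?_
      have hs1 := prob_row_add_prob_col h01 hm0 hmn S
      have hs2 := prob_row_add_prob_col h01 hm0 hmn (insert j S)
      have hu1 := prob_undecided_le hn h01 hp8 S
      have hu2 := prob_undecided_le hn h01 hp8 (insert j S)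
      set J := prob fun σ => IsRow f m (insert j S) σ ∧ IsRow f m Sᶜ σ with hJ
      have hjoint : prob (IsRow f m (insert j S)) + prob (IsRow f m Sᶜ) - 1 ≤ J := by
        have h1 : prob (fun σ => ¬(IsRow f m (insert j S) σ ∧ IsRow f m Sᶜ σ)) ≤
            prob (fun σ => ¬IsRow f m (insert j S) σ) + prob (fun σ => ¬IsRow f m Sᶜ σ) :=
          (prob_mono fun σ h => not_and_or.1 h).trans (prob_or_le _ _)
        rw [prob_not, prob_not, prob_not] at h1
        linarith
      have hdisagree : 2 * ((n : ℝ) - 1) * J ≤ 𝔼 σ : Fin k → Equiv.Perm (Fin n), ∑ t, ∑ t',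
          ind (lineDiff f j (σ j t) (σ j t') (S.piecewise (diag σ t) (diag σ t')) ≠ 0) := by
        refine mul_prob_le_expect (fun σ => Finset.sum_nonneg fun _ _ => Finset.sum_nonneg
          fun _ _ => ind_nonneg _) fun σ hσ => ?_
        obtain ⟨hR, hC⟩ := hσ
        obtain ⟨t₀, t₁, h01'⟩ := exists_ne_of_matchSum_eq h01 hm0 hmn hR.2
        refine (two_mul_pred_le_sum_ind (D := fun t => f (diag σ t)) h01').trans_eq ?_
        refine Finset.sum_congr rfl fun t _ => Finset.sum_congr rfl fun t' _ => ?_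
        refine ind_congr ?_
        rw [← hR.apply_eq t t', ← hC.apply_eq_compl t t', Finset.piecewise_insert]
        have hx : Function.update (S.piecewise (diag σ t) (diag σ t')) j (σ j t') =
            S.piecewise (diag σ t) (diag σ t') :=
          Function.update_eq_self_iff.2 (by simp [hj, diag])
        rw [lineDiff, hx, sub_ne_zero]
        rfl
      have hupper : 𝔼 σ : Fin k → Equiv.Perm (Fin n), ∑ t, ∑ t',
          ind (lineDiff f j (σ j t) (σ j t') (S.piecewise (diag σ t) (diag σ t')) ≠ 0) ≤
          n * ((n - 1) * (2 * p)) := by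
        simp only [Finset.expect_sum_comm]
        have hrow : ∀ t ∈ (Finset.univ : Finset (Fin n)), ∑ t', 𝔼 σ : Fin k → Equiv.Perm (Fin n),
            ind (lineDiff f j (σ j t) (σ j t') (S.piecewise (diag σ t) (diag σ t')) ≠ 0) ≤
            (n - 1) * (2 * p) := by
          intro t _
          rw [← Finset.add_sum_erase _ _ (Finset.mem_univ t),
            Finset.expect_eq_zero fun σ _ => ind_false (by simp [lineDiff]), zero_add]
          have := Finset.sum_le_card_nsmul (Finset.univ.erase t)
            (fun t' => 𝔼 σ : Fin k → Equiv.Perm (Fin n),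
              ind (lineDiff f j (σ j t) (σ j t') (S.piecewise (diag σ t) (diag σ t')) ≠ 0)) (2 * p)
            fun t' ht' => expect_lineDiff_pair_le hflat S j (Finset.ne_of_mem_erase ht').symm
          rwa [Finset.card_erase_of_mem (Finset.mem_univ t), Finset.card_univ, Fintype.card_fin,
            nsmul_eq_mul, Nat.cast_sub t.pos, Nat.cast_one] at this
        have := Finset.sum_le_card_nsmul _ _ _ hrow
        rwa [Finset.card_univ, Fintype.card_fin, nsmul_eq_mul] at this
      have hJle : J ≤ 1 / 8 := by
        have h1 : ((n : ℝ) - 1) * J ≤ (n - 1) * (n * p) := by linarith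
        have := le_of_mul_le_mul_left h1 (by linarith)
        linarith
      unfold bias at ih hbias
      linarith
  have := bias_univ (k := k) hn h01 hm0 hmn hp8
  have := hall Finset.univ
  linarith

end Bias

section FatHyperplanes

open scoped BigOperators

variable {n k : ℕ} {f : (Fin k → Fin n) → ℝ}

/-- The average of `f` over the hyperplane `x_i = a`. -/
noncomputable def density (f : (Fin k → Fin n) → ℝ) (i : Fin k) (a : Fin n) : ℝ :=
  𝔼 x, f (Function.update x i a)

lemma density_of_lineDiff_eq_one (hn : 0 < n) (h01 : ∀ x, f x = 0 ∨ f x = 1) {q : ℝ} {i : Fin k}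
    {a b : Fin n} (h : prob (fun x => lineDiff f i a b x ≠ 1) ≤ q) :
    1 - q ≤ density f i a ∧ density f i b ≤ q := by
  have hn0 : NeZero n := ⟨by omega⟩
  have hpt : ∀ x, 1 - f (Function.update x i a) ≤ ind (lineDiff f i a b x ≠ 1) ∧
      f (Function.update x i b) ≤ ind (lineDiff f i a b x ≠ 1) := by
    intro x
    unfold lineDiff
    rcases h01 (Function.update x i a) with h | h <;> rcases h01 (Function.update x i b) with h' | h'
      <;> rw [h, h'] <;> norm_num [ind]
  constructor
  · have := expect_mono fun x => (hpt x).1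
    rw [Finset.expect_sub_distrib, Fintype.expect_const] at this
    unfold density
    unfold prob at h
    linarith
  · exact (expect_mono fun x => (hpt x).2).trans h

lemma density_trichotomy (hn : 8 ≤ n) (h01 : ∀ x, f x = 0 ∨ f x = 1) {m p : ℝ}
    (hpdef : p = prob fun σ => matchSum f σ ≠ m) (hp : p ≤ 1 / 64) (i : Fin k) {a b : Fin n}
    (hab : a ≠ b) :
    (1 - 2 * p ≤ density f i a ∧ density f i b ≤ 2 * p) ∨
    (1 - 2 * p ≤ density f i b ∧ density f i a ≤ 2 * p) ∨
    (prob (fun x => lineDiff f i a b x ≠ 0) ≤ 2 * p ∧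
      density f i a - density f i b ≤ 2 * p ∧ density f i b - density f i a ≤ 2 * p) := by
  subst hpdef
  obtain ⟨c, rfl | rfl | rfl, hc'⟩ := exists_lineDiff_const hn h01 hp i hab
  · refine Or.inr (Or.inl (density_of_lineDiff_eq_one (by omega) h01 (le_trans ?_ hc')))
    refine prob_mono fun x hx hc => hx ?_
    unfold lineDiff at hc ⊢
    linarith
  · refine Or.inr (Or.inr ⟨hc', ?_⟩)
    have hpt : ∀ x, lineDiff f i a b x ≤ ind (lineDiff f i a b x ≠ 0) ∧
        -lineDiff f i a b x ≤ ind (lineDiff f i a b x ≠ 0) := by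
      intro x
      unfold lineDiff
      rcases h01 (Function.update x i a) with h | h <;>
        rcases h01 (Function.update x i b) with h' | h' <;> rw [h, h'] <;> norm_num [ind]
    have h1 := (expect_mono fun x => (hpt x).1).trans hc'
    have h2 := (expect_mono fun x => (hpt x).2).trans hc'
    simp only [lineDiff, Finset.expect_sub_distrib, Finset.expect_neg_distrib] at h1 h2
    unfold density
    constructor <;> linarith
  · exact Or.inl (density_of_lineDiff_eq_one (by omega) h01 hc')

lemma density_le_mul_expect (hf : ∀ x, 0 ≤ f x) (l : Fin k) (e : Fin n) :
    density f l e ≤ n * 𝔼 x, f x := by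
  have hn0 : NeZero n := ⟨by have := e.pos; omega⟩
  have h := card_mul_expect fun a => density f l a
  rw [Fintype.card_fin] at h
  have h2 : 𝔼 a, density f l a = 𝔼 x, f x := by
    rw [← expect_expect_update l f, expect_swap]
    rfl
  rw [h2] at h
  rw [h]
  exact Finset.single_le_sum (f := fun a => density f l a)
    (fun a _ => Finset.expect_nonneg fun x _ => hf _) (Finset.mem_univ e)

lemma sum_density [NeZero n] (f : (Fin k → Fin n) → ℝ) (l : Fin k) :
    ∑ a, density f l a = n * 𝔼 x, f x := by
  have h := card_mul_expect fun a => density f l a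
  rw [Fintype.card_fin] at h
  rw [← h, ← expect_expect_update l f, expect_swap]
  rfl

/-- In the presence of one fat hyperplane and one thin parallel one, there are exactly `m` fat
hyperplanes. -/
theorem card_fat (hn : 8 ≤ n) (h01 : ∀ x, f x = 0 ∨ f x = 1) {m : ℕ} (hm : 2 ≤ m) (hmn : m < n)
    {p : ℝ} (hpdef : p = prob fun σ => matchSum f σ ≠ m) (hp : 4 * (n : ℝ) * m * p ≤ 1)
    (hlow : (m : ℝ) ≤ n * 𝔼 x, f x) (hupp : n * 𝔼 x, f x ≤ (m : ℝ) + 1 / 8)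
    {i : Fin k} {a₀ b₀ : Fin n} (ha : 1 - 2 * p ≤ density f i a₀) (hb : density f i b₀ ≤ 2 * p) :
    (Finset.univ.filter fun q : Fin k × Fin n => 1 - 2 * p ≤ density f q.1 q.2).card = m := by
  have hn0 : NeZero n := ⟨by omega⟩
  have hnR : (8 : ℝ) ≤ n := by exact_mod_cast hn
  have hmR : (2 : ℝ) ≤ m := by exact_mod_cast hm
  have hmnR : (m : ℝ) + 1 ≤ n := by exact_mod_cast hmn
  have hp0 : 0 ≤ p := hpdef ▸ prob_nonneg _
  have hpn : 8 * (n : ℝ) * p ≤ 1 := by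
    have : 0 ≤ 4 * (n : ℝ) * p * (m - 2) := mul_nonneg (by positivity) (by linarith)
    linarith
  have hpm : 32 * (m : ℝ) * p ≤ 1 := by
    have : 0 ≤ 4 * (m : ℝ) * p * (n - 8) := mul_nonneg (by positivity) (by linarith)
    linarith
  have hp64 : p ≤ 1 / 64 := by nlinarith
  have hf0 : ∀ x, 0 ≤ f x := fun x => by rcases h01 x with h | h <;> rw [h]; norm_num
  have hf1 : ∀ x, f x ≤ 1 := fun x => by rcases h01 x with h | h <;> rw [h]; norm_num
  have hd1 : ∀ l e, density f l e ≤ 1 := fun l e =>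
    (expect_mono fun x => hf1 _).trans_eq (Fintype.expect_const _)
  have hdich : ∀ e, 1 - 2 * p ≤ density f i e ∨ density f i e ≤ 2 * p := by
    intro e
    by_cases he : e = a₀
    · exact Or.inl (he ▸ ha)
    by_cases he' : e = b₀
    · exact Or.inr (he' ▸ hb)
    rcases density_trichotomy hn h01 hpdef hp64 i he' with h | h | h
    · exact Or.inl h.1
    · linarith [h.1]
    rcases density_trichotomy hn h01 hpdef hp64 i (Ne.symm he) with h' | h' | h'
    · exact Or.inr h'.2
    · exact Or.inl h'.1
    · linarith [h.2.1, h'.2.1]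
  set T := Finset.univ.filter fun e => 1 - 2 * p ≤ density f i e with hT
  have hle : ∀ e, density f i e ≤ ind (1 - 2 * p ≤ density f i e) + 2 * p := by
    intro e
    by_cases h : 1 - 2 * p ≤ density f i e
    · rw [ind_true h]; linarith [hd1 i e]
    · rw [ind_false h, zero_add]; exact (hdich e).resolve_left h
  have hge : ∀ e, (1 - 2 * p) * ind (1 - 2 * p ≤ density f i e) ≤ density f i e := by
    intro e
    by_cases h : 1 - 2 * p ≤ density f i e
    · rw [ind_true h]; linarith
    · rw [ind_false h, mul_zero]; exact Finset.expect_nonneg fun x _ => hf0 _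
  have hTsum : ∑ e, ind (1 - 2 * p ≤ density f i e) = (T.card : ℝ) := sum_ind _
  have hTcard : T.card = m := by
    have h1 := Finset.sum_le_sum fun e (_ : e ∈ Finset.univ) => hle e
    have h2 := Finset.sum_le_sum fun e (_ : e ∈ Finset.univ) => hge e
    rw [sum_density] at h1 h2
    rw [Finset.sum_add_distrib, hTsum] at h1
    rw [← Finset.mul_sum, hTsum] at h2
    simp only [Finset.sum_const, Finset.card_univ, Fintype.card_fin, nsmul_eq_mul] at h1
    rcases lt_trichotomy T.card m with h | h | h
    · have : (T.card : ℝ) + 1 ≤ m := by exact_mod_cast h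
      linarith
    · exact h
    · have : (m : ℝ) + 1 ≤ T.card := by exact_mod_cast h
      have := mul_le_mul_of_nonneg_left this (by linarith : (0 : ℝ) ≤ 1 - 2 * p)
      linarith
  have hother : ∀ l, l ≠ i → ∀ e, density f l e < 1 - 2 * p := by
    intro l hl e
    have hswap : density f l e =
        𝔼 a, 𝔼 x, f (Function.update (Function.update x l e) i a) := by
      rw [density, ← expect_expect_update i, expect_swap]
      simp only [Function.update_comm hl.symm]
    have hbound : ∀ a, 𝔼 x, f (Function.update (Function.update x l e) i a) ≤
        (1 - 2 * p * n) * ind (1 - 2 * p ≤ density f i a) + 2 * p * n := by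
      intro a
      by_cases h : 1 - 2 * p ≤ density f i a
      · rw [ind_true h]
        refine (expect_mono fun x => hf1 _).trans_eq ?_
        rw [Fintype.expect_const]
        ring
      · rw [ind_false h, mul_zero, zero_add]
        refine (density_le_mul_expect (f := fun x => f (Function.update x i a))
          (fun x => hf0 _) l e).trans ?_
        have := mul_le_mul_of_nonneg_left ((hdich a).resolve_left h) (by linarith : (0 : ℝ) ≤ n)
        unfold density at this
        linarith
    have hmul := card_mul_expect fun a => 𝔼 x, f (Function.update (Function.update x l e) i a)
    rw [← hswap, Fintype.card_fin] at hmul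
    have h1 := Finset.sum_le_sum fun a (_ : a ∈ Finset.univ) => hbound a
    rw [← hmul, Finset.sum_add_distrib, ← Finset.mul_sum, hTsum, hTcard] at h1
    simp only [Finset.sum_const, Finset.card_univ, Fintype.card_fin, nsmul_eq_mul] at h1
    by_contra! hc
    have h2 := mul_le_mul_of_nonneg_left hc (by linarith : (0 : ℝ) ≤ n)
    have h3 : (n : ℝ) - m ≤ 2 * p * n * (n - m + 1) := by linarith
    have h4 : 8 * (n : ℝ) * p * (n - m + 1) ≤ 1 * (n - m + 1) :=
      mul_le_mul_of_nonneg_right hpn (by linarith)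
    linarith
  rw [← hTcard, ← Finset.card_map (s := T) ⟨Prod.mk i, Prod.mk_right_injective i⟩]
  refine congrArg Finset.card ?_
  ext ⟨l, e⟩
  simp only [Finset.mem_filter, Finset.mem_univ, true_and, Finset.mem_map, hT,
    Function.Embedding.coeFn_mk, Prod.mk.injEq]
  constructor
  · intro h
    have hl : l = i := by
      by_contra hl
      exact absurd h (not_le.2 (hother l hl e))
    subst hl
    exact ⟨e, h, rfl, rfl⟩
  · rintro ⟨e', h, rfl, rfl⟩
    exact h

end FatHyperplanes

section Counting

open scoped BigOperators

variable {n k : ℕ}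

lemma card_inter_matchingOf_s12 (hk : 0 < k) (F : Finset (Fin k → Fin n))
    (σ : Fin k → Equiv.Perm (Fin n)) :
    ((F ∩ matchingOf σ).card : ℝ) = matchSum (fun x => ind (x ∈ F)) σ := by
  classical
  have hinj : Function.Injective (diag σ) := fun t t' h =>
    (σ ⟨0, hk⟩).injective (congrFun h ⟨0, hk⟩)
  have : F ∩ matchingOf σ = (Finset.univ.filter fun t => diag σ t ∈ F).image (diag σ) := by
    ext x
    simp only [matchingOf, Finset.mem_inter, Finset.mem_image, Finset.mem_filter,
      Finset.mem_univ, true_and]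
    constructor
    · rintro ⟨hx, t, rfl⟩
      exact ⟨t, hx, rfl⟩
    · rintro ⟨t, ht, rfl⟩
      exact ⟨ht, t, rfl⟩
  rw [this, Finset.card_image_of_injective _ hinj, ← sum_ind]
  rfl

lemma pFrac_eq_prob (hk : 0 < k) (s : ℕ) (F : Finset (Fin k → Fin n)) :
    pFrac n k s F = prob fun σ => matchSum (fun x => ind (x ∈ F)) σ ≠ ((s - 1 : ℕ) : ℝ) := by
  unfold pFrac prob
  rw [Fintype.expect_eq_sum_div_card, ← sum_ind, Finset.card_univ]
  congr 1
  refine Finset.sum_congr rfl fun σ _ => ind_congr ?_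
  simp only [← card_inter_matchingOf_s12 hk, ne_eq, Nat.cast_inj]

lemma pow_mul_expect_ind [NeZero n] (F : Finset (Fin k → Fin n)) :
    (n : ℝ) ^ k * 𝔼 x, ind (x ∈ F) = F.card := by
  have h := card_mul_expect fun x : Fin k → Fin n => ind (x ∈ F)
  rw [sum_ind] at h
  simpa using h

lemma pow_pred_mul_density [NeZero n] (F : Finset (Fin k → Fin n)) (i : Fin k) (a : Fin n) :
    (n : ℝ) ^ (k - 1) * density (fun x => ind (x ∈ F)) i a =
      ((F.filter fun x => x i = a).card : ℝ) := by
  rw [← pow_mul_expect_ind, ← expect_expect_update i, show (n : ℝ) ^ k = n ^ (k - 1) * n by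
    rw [← pow_succ, Nat.sub_add_cancel i.pos], mul_assoc, Finset.mul_expect]
  congr 1
  refine Finset.expect_congr rfl fun x _ => ?_
  have h := card_mul_expect fun b => ind (Function.update x i b ∈ F.filter fun x => x i = a)
  rw [Fintype.card_fin] at h
  rw [h, Finset.sum_eq_single a]
  · simp
  · intro b _ hb
    exact ind_false (by simp [hb])
  · simp

end Counting

/-- Theorem 4.1, part 3: there are exactly `s - 1` `F`-fat hyperplanes. -/
theorem stmt12 (n k s : ℕ) (hn : 8 ≤ n) (hk : 2 ≤ k) (hs : 3 ≤ s)
    (F : Finset (Fin k → Fin n)) (hF : F.card = (s - 1) * n ^ (k - 1) + 1)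
    (hp : pFrac n k s F ≤ 1 / (4 * (n : ℝ) * ((s : ℝ) - 1))) :
    ((Finset.univ : Finset (Fin k × Fin n)).filter
      (fun q => (1 - 2 * pFrac n k s F) * (n : ℝ) ^ (k - 1) ≤
        ((F.filter (fun x => x q.1 = q.2)).card : ℝ))).card = s - 1 := by
  have hn0 : NeZero n := ⟨by omega⟩
  have hnR : (8 : ℝ) ≤ n := by exact_mod_cast hn
  have hpow : (0 : ℝ) < (n : ℝ) ^ (k - 1) := by positivity
  have hpow8 : (8 : ℝ) ≤ (n : ℝ) ^ (k - 1) :=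
    hnR.trans (le_self_pow₀ (by linarith) (by omega))
  set f : (Fin k → Fin n) → ℝ := fun x => ind (x ∈ F) with hf
  have h01 : ∀ x, f x = 0 ∨ f x = 1 := fun x => by
    by_cases h : x ∈ F
    · exact Or.inr (ind_true h)
    · exact Or.inl (ind_false h)
  set p := pFrac n k s F with hpF
  have hpdef : p = prob fun σ => matchSum f σ ≠ ((s - 1 : ℕ) : ℝ) :=
    pFrac_eq_prob (by omega) s F
  have hm : 2 ≤ s - 1 := by omega
  have hmR : (2 : ℝ) ≤ ((s - 1 : ℕ) : ℝ) := by exact_mod_cast hm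
  have hp1 : 4 * (n : ℝ) * ((s - 1 : ℕ) : ℝ) * p ≤ 1 := by
    rw [← Nat.cast_one, ← Nat.cast_sub (by omega : 1 ≤ s), Nat.cast_one,
      le_div_iff₀ (mul_pos (by linarith) (by linarith))] at hp
    linarith
  have hmn : s - 1 < n := by
    have h1 : F.card ≤ n ^ k := by simpa using Finset.card_le_univ F
    rw [hF, show n ^ k = n * n ^ (k - 1) by rw [← pow_succ', Nat.sub_add_cancel (by omega)]] at h1
    exact lt_of_mul_lt_mul_right h1 (Nat.zero_le _)
  have hE : (n : ℝ) ^ (k - 1) * (n * Finset.univ.expect fun x => f x) =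
      ((s - 1 : ℕ) : ℝ) * n ^ (k - 1) + 1 := by
    rw [← mul_assoc, ← pow_succ, Nat.sub_add_cancel (by omega), pow_mul_expect_ind, hF]
    push_cast
    ring
  have hlow : ((s - 1 : ℕ) : ℝ) ≤ n * Finset.univ.expect fun x => f x :=
    le_of_mul_le_mul_left (by linarith) hpow
  have hupp : n * (Finset.univ.expect fun x => f x) ≤ ((s - 1 : ℕ) : ℝ) + 1 / 8 :=
    le_of_mul_le_mul_left (by linarith) hpow
  have hp64 : p ≤ 1 / 64 := by
    have hp0 : 0 ≤ p := hpdef ▸ prob_nonneg _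
    nlinarith [mul_nonneg (by linarith : (0 : ℝ) ≤ n - 8) hp0,
      mul_nonneg (mul_nonneg (by linarith : (0 : ℝ) ≤ n) hp0) (sub_nonneg.2 hmR)]
  have hflat := not_flat hn h01 hmR (by exact_mod_cast hmn) (hpdef ▸ hp1)
  push Not at hflat
  obtain ⟨i, a, b, hab, hlt⟩ := hflat
  have hcard : (Finset.univ.filter fun q : Fin k × Fin n =>
      1 - 2 * p ≤ density f q.1 q.2).card = s - 1 := by
    rcases density_trichotomy hn h01 hpdef hp64 i hab with h | h | h
    · exact card_fat hn h01 hm hmn hpdef hp1 hlow hupp h.1 h.2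
    · exact card_fat hn h01 hm hmn hpdef hp1 hlow hupp h.1 h.2
    · rw [← hpdef] at hlt
      exact absurd h.1 (not_le.2 hlt)
  rw [← hcard]
  refine congrArg Finset.card (Finset.filter_congr fun q _ => ?_)
  rw [← pow_pred_mul_density, mul_comm (1 - 2 * p), mul_le_mul_iff_of_pos_left hpow]
end

section
/- Let n ≥ 2 and k ≥ 3 be integers and let P ⊆ [n]^{k−1} be any subset of (k−1)-tuples. Then the number of pairs (x, y) with x ∈ P, y ∈ [n]^{k−1} \ P, and x_j ≠ y_j for every j ∈ [k−1], is at least ((n−1)^{k−1} − (n−1)^{k−3}) · |P| · (n^{k−1} − |P|) / n^{k−1}. -/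
/-- The bilinear form `∑ f x * g y` over the pairs of disjoint tuples `x, y` in `[n]^m`. -/
noncomputable def disjointForm (n m : ℕ) :
    ((Fin m → Fin n) → ℝ) →ₗ[ℝ] ((Fin m → Fin n) → ℝ) →ₗ[ℝ] ℝ :=
  LinearMap.mk₂ ℝ (fun f g => ∑ x, ∑ y, if ∀ j, x j ≠ y j then f x * g y else 0)
    (fun f₁ f₂ g => by
      simp only [← Finset.sum_add_distrib]
      refine Finset.sum_congr rfl fun x _ => Finset.sum_congr rfl fun y _ => ?_
      split_ifs <;> simp [add_mul])
    (fun c f g => by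
      simp only [smul_eq_mul, Finset.mul_sum]
      refine Finset.sum_congr rfl fun x _ => Finset.sum_congr rfl fun y _ => ?_
      split_ifs <;> simp [mul_assoc])
    (fun f g₁ g₂ => by
      simp only [← Finset.sum_add_distrib]
      refine Finset.sum_congr rfl fun x _ => Finset.sum_congr rfl fun y _ => ?_
      split_ifs <;> simp [mul_add])
    (fun c f g => by
      simp only [smul_eq_mul, Finset.mul_sum]
      refine Finset.sum_congr rfl fun x _ => Finset.sum_congr rfl fun y _ => ?_
      split_ifs <;> simp [mul_left_comm])

lemma disjointForm_apply (n m : ℕ) (f g : (Fin m → Fin n) → ℝ) :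
    disjointForm n m f g = ∑ x, ∑ y, if ∀ j, x j ≠ y j then f x * g y else 0 := rfl

lemma disjointForm_zero (n : ℕ) (f g : (Fin 0 → Fin n) → ℝ) :
    disjointForm n 0 f g = f default * g default := by
  simp [disjointForm_apply]

/-- The restriction of `f` to the tuples whose first entry is `a`. -/
def consSlice {n m : ℕ} (f : (Fin (m + 1) → Fin n) → ℝ) (a : Fin n) : (Fin m → Fin n) → ℝ :=
  fun x => f (Fin.cons a x)

lemma sum_tuple_succ {n m : ℕ} (h : (Fin (m + 1) → Fin n) → ℝ) :
    ∑ x, h x = ∑ a, ∑ x : Fin m → Fin n, h (Fin.cons a x) := by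
  rw [← (Fin.consEquiv fun _ : Fin (m + 1) => Fin n).sum_comp, Fintype.sum_prod_type]
  rfl

lemma disjointForm_succ {n m : ℕ} (f g : (Fin (m + 1) → Fin n) → ℝ) :
    disjointForm n (m + 1) f g =
      disjointForm n m (∑ a, consSlice f a) (∑ a, consSlice g a) -
        ∑ a, disjointForm n m (consSlice f a) (consSlice g a) := by
  have h : disjointForm n (m + 1) f g =
      ∑ a, ∑ b, if a ≠ b then disjointForm n m (consSlice f a) (consSlice g b) else 0 := by
    rw [disjointForm_apply, sum_tuple_succ]
    refine Finset.sum_congr rfl fun a _ => ?_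
    simp only [sum_tuple_succ (m := m), Fin.forall_fin_succ, Fin.cons_zero, Fin.cons_succ]
    rw [Finset.sum_comm]
    refine Finset.sum_congr rfl fun b _ => ?_
    by_cases hab : a = b <;> simp [hab, disjointForm_apply, consSlice]
  rw [h]
  simp only [map_sum, LinearMap.sum_apply]
  rw [Finset.sum_comm (γ := Fin n), ← Finset.sum_sub_distrib]
  refine Finset.sum_congr rfl fun a _ => ?_
  rw [eq_sub_iff_add_eq, ← Finset.sum_filter]
  rw [← Finset.sum_filter_add_sum_filter_not Finset.univ (fun b => b ≠ a)]
  simp [Finset.filter_eq']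

lemma disjointForm_one_right (n m : ℕ) (f : (Fin m → Fin n) → ℝ) :
    disjointForm n m f 1 = ((n : ℝ) - 1) ^ m * ∑ x, f x := by
  induction m with
  | zero => simp [disjointForm_zero]
  | succ m ih =>
    have h1 (a : Fin n) : consSlice (1 : (Fin (m + 1) → Fin n) → ℝ) a = 1 := rfl
    rw [disjointForm_succ]
    simp only [h1, map_sum, LinearMap.sum_apply, ih, sum_tuple_succ f, ← Finset.mul_sum]
    simp only [consSlice, Finset.sum_const, Finset.card_univ, Fintype.card_fin, nsmul_eq_mul]
    ring

/-- The part of the slice `consSlice f a` orthogonal to the mean of all slices. -/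
noncomputable def centeredSlice {n m : ℕ} (f : (Fin (m + 1) → Fin n) → ℝ) (a : Fin n) :
    (Fin m → Fin n) → ℝ :=
  consSlice f a - (n : ℝ)⁻¹ • ∑ b, consSlice f b

lemma disjointForm_self_succ {n m : ℕ} (hn : 0 < n) (f : (Fin (m + 1) → Fin n) → ℝ) :
    disjointForm n (m + 1) f f =
      (1 - (n : ℝ)⁻¹) * disjointForm n m (∑ a, consSlice f a) (∑ a, consSlice f a) -
        ∑ a, disjointForm n m (centeredSlice f a) (centeredSlice f a) := by
  have hn' : (n : ℝ) ≠ 0 := by positivity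
  rw [disjointForm_succ]
  set F := ∑ a, consSlice f a with hF
  have h1 : ∑ a, disjointForm n m (consSlice f a) F = disjointForm n m F F := by
    rw [← LinearMap.sum_apply, ← map_sum]
  have h2 : ∑ a, disjointForm n m F (consSlice f a) = disjointForm n m F F := by
    rw [← map_sum]
  simp only [centeredSlice, ← hF, map_sub, map_smul, LinearMap.sub_apply, LinearMap.smul_apply,
    smul_eq_mul, Finset.sum_sub_distrib, ← Finset.mul_sum, h1, h2, Finset.sum_const,
    Finset.card_univ, Fintype.card_fin, nsmul_eq_mul]
  field_simp
  ring

lemma sum_sq_succ_s13 {n m : ℕ} (hn : 0 < n) (f : (Fin (m + 1) → Fin n) → ℝ) :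
    ∑ x, f x ^ 2 = (n : ℝ)⁻¹ * ∑ x, (∑ a, consSlice f a) x ^ 2 +
      ∑ a, ∑ x, centeredSlice f a x ^ 2 := by
  have hn' : (n : ℝ) ≠ 0 := by positivity
  rw [sum_tuple_succ, Finset.sum_comm, Finset.sum_comm (γ := Fin n), Finset.mul_sum,
    ← Finset.sum_add_distrib]
  refine Finset.sum_congr rfl fun x _ => ?_
  simp only [centeredSlice, Pi.sub_apply, Pi.smul_apply, Finset.sum_apply, smul_eq_mul, sub_sq,
    Finset.sum_add_distrib, Finset.sum_sub_distrib, ← Finset.sum_mul, ← Finset.mul_sum,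
    Finset.sum_const, Finset.card_univ, Fintype.card_fin, nsmul_eq_mul]
  simp only [consSlice]
  field_simp
  ring

lemma sum_succ {n m : ℕ} (f : (Fin (m + 1) → Fin n) → ℝ) :
    ∑ x, f x = ∑ x, (∑ a, consSlice f a) x := by
  simp only [Finset.sum_apply]
  rw [sum_tuple_succ, Finset.sum_comm]
  rfl

lemma abs_disjointForm_self_le {n : ℕ} (hn : 2 ≤ n) (m : ℕ) (f : (Fin m → Fin n) → ℝ) :
    |disjointForm n m f f| ≤ ((n : ℝ) - 1) ^ m * ∑ x, f x ^ 2 := by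
  induction m with
  | zero => simp [disjointForm_zero, sq]
  | succ m ih =>
    have hn2 : (2 : ℝ) ≤ n := by exact_mod_cast hn
    have hc : 1 - (n : ℝ)⁻¹ = (n - 1) * (n : ℝ)⁻¹ := by field_simp
    rw [disjointForm_self_succ (by omega), sum_sq_succ_s13 (by omega), hc]
    have hF := ih (∑ a, consSlice f a)
    have hG : |∑ a, disjointForm n m (centeredSlice f a) (centeredSlice f a)| ≤
        ((n : ℝ) - 1) ^ m * ∑ a, ∑ x, centeredSlice f a x ^ 2 := by
      rw [Finset.mul_sum]
      exact (Finset.abs_sum_le_sum_abs _ _).trans (Finset.sum_le_sum fun a _ => ih _)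
    have hS : 0 ≤ ∑ a, ∑ x, centeredSlice f a x ^ 2 := by positivity
    have hq : (0 : ℝ) ≤ n - 1 := by linarith
    calc _ ≤ (n - 1) * (n : ℝ)⁻¹ * (((n : ℝ) - 1) ^ m * ∑ x, (∑ a, consSlice f a) x ^ 2) +
          1 * (((n : ℝ) - 1) ^ m * ∑ a, ∑ x, centeredSlice f a x ^ 2) := by
          refine (abs_sub _ _).trans (add_le_add ?_ (by rwa [one_mul]))
          rw [abs_mul, abs_of_nonneg (by positivity)]
          gcongr
      _ ≤ (n - 1) * (n : ℝ)⁻¹ * (((n : ℝ) - 1) ^ m * ∑ x, (∑ a, consSlice f a) x ^ 2) +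
          (n - 1) * (((n : ℝ) - 1) ^ m * ∑ a, ∑ x, centeredSlice f a x ^ 2) := by
          gcongr
          linarith
      _ = _ := by ring

lemma neg_le_disjointForm_self {n : ℕ} (hn : 2 ≤ n) (m : ℕ) (f : (Fin m → Fin n) → ℝ) :
    -(((n : ℝ) - 1) ^ m * ∑ x, f x ^ 2) ≤ ((n : ℝ) - 1) * disjointForm n m f f := by
  have hn2 : (2 : ℝ) ≤ n := by exact_mod_cast hn
  have hq : (0 : ℝ) ≤ n - 1 := by linarith
  induction m with
  | zero =>
    simp only [disjointForm_zero, pow_zero, one_mul, Finset.univ_unique, Finset.sum_singleton]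
    nlinarith [mul_nonneg hq (mul_self_nonneg (f default)), sq_nonneg (f default)]
  | succ m ih =>
    have hc : 1 - (n : ℝ)⁻¹ = (n - 1) * (n : ℝ)⁻¹ := by field_simp
    rw [disjointForm_self_succ (by omega), sum_sq_succ_s13 (by omega), hc]
    have hF := mul_le_mul_of_nonneg_left (ih (∑ a, consSlice f a))
      (show 0 ≤ ((n : ℝ) - 1) * (n : ℝ)⁻¹ by positivity)
    have hG : ∑ a, disjointForm n m (centeredSlice f a) (centeredSlice f a) ≤
        ((n : ℝ) - 1) ^ m * ∑ a, ∑ x, centeredSlice f a x ^ 2 := by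
      rw [Finset.mul_sum]
      exact Finset.sum_le_sum fun a _ => (le_abs_self _).trans (abs_disjointForm_self_le hn m _)
    have hG' := mul_le_mul_of_nonneg_left hG hq
    rw [pow_succ]
    linarith

/-- A form of the expander mixing inequality for the disjointness graph on `[n]^m`, whose second
largest eigenvalue is `(n - 1) ^ (m - 2)`. -/
lemma disjointForm_self_le {n : ℕ} (hn : 2 ≤ n) (m : ℕ) (f : (Fin m → Fin n) → ℝ) :
    ((n : ℝ) - 1) ^ 2 * disjointForm n m f f ≤ ((n : ℝ) - 1) ^ m * ∑ x, f x ^ 2 +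
      (((n : ℝ) - 1) ^ (m + 2) - ((n : ℝ) - 1) ^ m) * (∑ x, f x) ^ 2 / (n : ℝ) ^ m := by
  have hn2 : (2 : ℝ) ≤ n := by exact_mod_cast hn
  have hq : (0 : ℝ) ≤ n - 1 := by linarith
  induction m with
  | zero =>
    simp only [disjointForm_zero, pow_zero, one_mul, Finset.univ_unique, Finset.sum_singleton]
    apply le_of_eq
    ring
  | succ m ih =>
    have hc : 1 - (n : ℝ)⁻¹ = (n - 1) * (n : ℝ)⁻¹ := by field_simp
    rw [disjointForm_self_succ (by omega), sum_sq_succ_s13 (by omega), sum_succ, hc]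
    have hF := mul_le_mul_of_nonneg_left (ih (∑ a, consSlice f a))
      (show 0 ≤ ((n : ℝ) - 1) * (n : ℝ)⁻¹ by positivity)
    have hG : -(((n : ℝ) - 1) ^ m * ∑ a, ∑ x, centeredSlice f a x ^ 2) ≤
        ((n : ℝ) - 1) * ∑ a, disjointForm n m (centeredSlice f a) (centeredSlice f a) := by
      rw [Finset.mul_sum, Finset.mul_sum, ← Finset.sum_neg_distrib]
      exact Finset.sum_le_sum fun a _ => neg_le_disjointForm_self hn m _
    have hG' := mul_le_mul_of_nonneg_left hG hq
    have hN : (((n : ℝ) - 1) ^ (m + 1 + 2) - ((n : ℝ) - 1) ^ (m + 1)) *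
          (∑ x, (∑ a, consSlice f a) x) ^ 2 / (n : ℝ) ^ (m + 1) =
        ((n : ℝ) - 1) * (n : ℝ)⁻¹ * ((((n : ℝ) - 1) ^ (m + 2) - ((n : ℝ) - 1) ^ m) *
          (∑ x, (∑ a, consSlice f a) x) ^ 2 / (n : ℝ) ^ m) := by
      field_simp
      ring
    rw [hN, pow_succ _ m]
    linarith

lemma card_disjoint_pairs {n m : ℕ} (P Q : Finset (Fin m → Fin n)) :
    (((P ×ˢ Q).filter fun xy => ∀ j, xy.1 j ≠ xy.2 j).card : ℝ) =
      disjointForm n m (fun x => if x ∈ P then 1 else 0) (fun x => if x ∈ Q then 1 else 0) := by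
  rw [disjointForm_apply, Finset.card_filter, Nat.cast_sum, Finset.sum_product,
    ← Finset.sum_subset (Finset.subset_univ P) (by simp +contextual)]
  refine Finset.sum_congr rfl fun x hx => ?_
  rw [← Finset.sum_subset (Finset.subset_univ Q) (by simp +contextual)]
  refine Finset.sum_congr rfl fun y hy => ?_
  simp [hx, hy]


/-- Claim 4.2 (expander mixing): the number of disjoint pairs between
`P ⊆ [n]^{k-1}` and its complement is at least
`((n-1)^{k-1} - (n-1)^{k-3})·|P|·(n^{k-1} - |P|)/n^{k-1}`. -/
theorem stmt13 (n k : ℕ) (hn : 2 ≤ n) (hk : 3 ≤ k) (P : Finset (Fin (k - 1) → Fin n)) :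
    ((((P ×ˢ ((Finset.univ : Finset (Fin (k - 1) → Fin n)) \ P)).filter
        (fun xy => ∀ j, xy.1 j ≠ xy.2 j)).card : ℝ)) ≥
      (((n : ℝ) - 1) ^ (k - 1) - ((n : ℝ) - 1) ^ (k - 3)) * (P.card : ℝ) *
        ((n : ℝ) ^ (k - 1) - (P.card : ℝ)) / (n : ℝ) ^ (k - 1) := by
  obtain ⟨m, hm, hm'⟩ : ∃ m, k - 3 = m ∧ k - 1 = m + 2 := ⟨k - 3, rfl, by omega⟩
  rw [hm]
  clear hm
  generalize k - 1 = r at P hm' ⊢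
  subst hm'
  have hn2 : (2 : ℝ) ≤ n := by exact_mod_cast hn
  have hq : (0 : ℝ) < ((n : ℝ) - 1) ^ 2 := by
    have : (0 : ℝ) < n - 1 := by linarith
    positivity
  set f : (Fin (m + 2) → Fin n) → ℝ := fun x => if x ∈ P then 1 else 0 with hf
  have hsum : ∑ x, f x = P.card := by simp [hf]
  have hsq : ∑ x, f x ^ 2 = P.card := by simp [hf]
  have hcompl : (fun x => if x ∈ Finset.univ \ P then 1 else 0) = 1 - f := by
    ext x
    by_cases hx : x ∈ P <;> simp [hf, hx]
  rw [card_disjoint_pairs, hcompl, map_sub, disjointForm_one_right, hsum]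
  have key := disjointForm_self_le hn (m + 2) f
  rw [hsum, hsq] at key
  have key' : disjointForm n (m + 2) f f ≤ ((n : ℝ) - 1) ^ m * P.card +
      (((n : ℝ) - 1) ^ (m + 2) - ((n : ℝ) - 1) ^ m) * (P.card : ℝ) ^ 2 / (n : ℝ) ^ (m + 2) := by
    refine le_of_mul_le_mul_left (key.trans_eq ?_) hq
    ring
  have hN : (((n : ℝ) - 1) ^ (m + 2) - ((n : ℝ) - 1) ^ m) * P.card *
        ((n : ℝ) ^ (m + 2) - P.card) / (n : ℝ) ^ (m + 2) =
      (((n : ℝ) - 1) ^ (m + 2) - ((n : ℝ) - 1) ^ m) * P.card -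
        (((n : ℝ) - 1) ^ (m + 2) - ((n : ℝ) - 1) ^ m) * (P.card : ℝ) ^ 2 / (n : ℝ) ^ (m + 2) := by
    field_simp
  rw [hN]
  linarith
end

section
/- Let n, k, s be integers with k ≥ 2 and 2 ≤ s ≤ n + 1, and let F ⊆ [n]^k with |F| ≥ (s−1)·n^{k−1}. Let M be a uniformly random perfect matching in [n]^k. Then P[|M ∩ F| > s−1] ≥ P[|M ∩ F| ≠ s−1] / n; equivalently, the number of perfect matchings M of [n]^k with |M ∩ F| > s−1 is at least 1/n times the number of perfect matchings with |M ∩ F| ≠ s−1. -/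
theorem mem_matchingOf {n k : ℕ} (σ : Fin k → Equiv.Perm (Fin n)) (x : Fin k → Fin n) :
    x ∈ matchingOf σ ↔ ∃ t, (fun j => σ j t) = x := by
  simp [matchingOf]

theorem card_matchingOf {n k : ℕ} (hk : 0 < k) (σ : Fin k → Equiv.Perm (Fin n)) :
    (matchingOf σ).card = n := by
  rw [matchingOf, Finset.card_image_of_injective, Finset.card_univ, Fintype.card_fin]
  intro t u h
  exact (σ ⟨0, hk⟩).injective (congrFun h ⟨0, hk⟩)

/-- Every tuple lies on equally many matchings. -/
theorem card_filter_mem_matchingOf_le {n k : ℕ} (x y : Fin k → Fin n) :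
    (Finset.univ.filter fun σ : Fin k → Equiv.Perm (Fin n) => x ∈ matchingOf σ).card ≤
      (Finset.univ.filter fun σ : Fin k → Equiv.Perm (Fin n) => y ∈ matchingOf σ).card := by
  refine Finset.card_le_card_of_injOn (fun σ j => Equiv.swap (x j) (y j) * σ j) ?_ ?_
  · intro σ hσ
    simp only [Finset.coe_filter, Finset.mem_univ, true_and, Set.mem_ofPred_eq,
      mem_matchingOf] at hσ ⊢
    obtain ⟨t, rfl⟩ := hσ
    exact ⟨t, by funext j; simp⟩
  · intro σ _ τ _ h
    funext j
    exact mul_left_cancel (congrFun h j)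

theorem sum_card_inter_matchingOf {n k : ℕ} (F : Finset (Fin k → Fin n)) :
    ∑ σ : Fin k → Equiv.Perm (Fin n), (F ∩ matchingOf σ).card =
      ∑ x ∈ F, (Finset.univ.filter
        fun σ : Fin k → Equiv.Perm (Fin n) => x ∈ matchingOf σ).card := by
  simp only [← Finset.filter_mem_eq_inter, Finset.card_filter]
  exact Finset.sum_comm

theorem pow_mul_card_filter_mem_matchingOf {n k : ℕ} (hk : 0 < k) (x : Fin k → Fin n) :
    n ^ (k - 1) * (Finset.univ.filter
        fun σ : Fin k → Equiv.Perm (Fin n) => x ∈ matchingOf σ).card =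
      Fintype.card (Fin k → Equiv.Perm (Fin n)) := by
  have hn : 0 < n := (x ⟨0, hk⟩).pos
  have h := sum_card_inter_matchingOf (Finset.univ : Finset (Fin k → Fin n))
  rw [Finset.sum_congr rfl fun y _ => le_antisymm (card_filter_mem_matchingOf_le y x)
    (card_filter_mem_matchingOf_le x y)] at h
  simp only [Finset.univ_inter, card_matchingOf hk, Finset.sum_const, smul_eq_mul,
    Finset.card_univ, Fintype.card_fun, Fintype.card_fin] at h
  obtain ⟨m, rfl⟩ : ∃ m, k = m + 1 := ⟨k - 1, by omega⟩
  apply Nat.eq_of_mul_eq_mul_left hn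
  rw [Fintype.card_fun, Fintype.card_fin, mul_comm n (_ ^ (m + 1)), h, Nat.add_sub_cancel,
    pow_succ]
  ring

/-- The mean of `|M ∩ F|` is `|F| / n ^ (k - 1)`. -/
theorem pow_mul_sum_card_inter_matchingOf {n k : ℕ} (hk : 0 < k)
    (F : Finset (Fin k → Fin n)) :
    n ^ (k - 1) * ∑ σ : Fin k → Equiv.Perm (Fin n), (F ∩ matchingOf σ).card =
      F.card * Fintype.card (Fin k → Equiv.Perm (Fin n)) := by
  rw [sum_card_inter_matchingOf, Finset.mul_sum,
    Finset.sum_congr rfl fun x _ => pow_mul_card_filter_mem_matchingOf hk x,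
    Finset.sum_const, smul_eq_mul]

/-- If an integer-valued function `X ≤ n` has mean at least `t ≥ 1`, then it exceeds `t`
at no fewer than a `1 / n` fraction of the points where it differs from `t`. -/
theorem card_filter_ne_le_mul_card_filter_lt {ι : Type*} [Fintype ι] (X : ι → ℕ) {n t : ℕ}
    (ht : 1 ≤ t) (hX : ∀ i, X i ≤ n) (hsum : t * Fintype.card ι ≤ ∑ i, X i) :
    (Finset.univ.filter fun i => X i ≠ t).card ≤
      n * (Finset.univ.filter fun i => t < X i).card := by
  have key : ∑ i, (X i + if X i ≠ t then 1 else 0) ≤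
      ∑ i, (t + n * if t < X i then 1 else 0) := by
    refine Finset.sum_le_sum fun i _ => ?_
    have := hX i
    split_ifs <;> omega
  rw [Finset.sum_add_distrib, Finset.sum_add_distrib, ← Finset.mul_sum, ← Finset.card_filter,
    ← Finset.card_filter, Finset.sum_const, smul_eq_mul, Finset.card_univ,
    mul_comm (Fintype.card ι)] at key
  omega


/-- Claim 4.4: for `|F| ≥ (s-1)n^{k-1}`,
`P[|M ∩ F| > s-1] ≥ P[|M ∩ F| ≠ s-1]/n` for a uniformly random perfect matching `M`. -/
theorem stmt14 (n k s : ℕ) (hk : 2 ≤ k) (hs : 2 ≤ s) (hsn : s ≤ n + 1)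
    (F : Finset (Fin k → Fin n)) (hF : (s - 1) * n ^ (k - 1) ≤ F.card) :
    ((Finset.univ.filter
        (fun σ : Fin k → Equiv.Perm (Fin n) => s - 1 < (F ∩ matchingOf σ).card)).card : ℝ) ≥
      ((Finset.univ.filter
        (fun σ : Fin k → Equiv.Perm (Fin n) => (F ∩ matchingOf σ).card ≠ s - 1)).card : ℝ) /
        (n : ℝ) := by
  have hn : 0 < n := by omega
  have hk0 : 0 < k := by omega
  have hsum : (s - 1) * Fintype.card (Fin k → Equiv.Perm (Fin n)) ≤
      ∑ σ : Fin k → Equiv.Perm (Fin n), (F ∩ matchingOf σ).card := by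
    refine Nat.le_of_mul_le_mul_left ?_ (pow_pos hn (k - 1))
    rw [pow_mul_sum_card_inter_matchingOf hk0, ← mul_assoc, mul_comm (n ^ (k - 1))]
    exact Nat.mul_le_mul_right _ hF
  have h := card_filter_ne_le_mul_card_filter_lt
    (fun σ : Fin k → Equiv.Perm (Fin n) => (F ∩ matchingOf σ).card) (by omega)
    (fun σ => (Finset.card_le_card Finset.inter_subset_right).trans_eq
      (card_matchingOf hk0 σ)) hsum
  rw [ge_iff_le, div_le_iff₀' (by exact_mod_cast hn)]
  exact_mod_cast h
end

section
/- For all integers s ≥ 1, k ≥ 1 and n ≥ k²·s², the sequence f_i = min(s−1, i)·n^{k−1} (i = 1, …, s) is satisfying: whenever families F_1, …, F_s ⊆ [n]^k satisfy |F_i| > min(s−1, i)·n^{k−1} for every i ∈ [s], the families contain a rainbow matching. -/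
open Finset in
/-- Fixing one coordinate of the tuples in `S` leaves room for `n` times as many tuples. -/
lemma mul_card_le_card_of_update_mem {k n : ℕ} (S T : Finset (Fin k → Fin n)) (p : Fin k × Fin n)
    (hS : ∀ x ∈ S, x p.1 = p.2) (hT : ∀ x ∈ S, ∀ c, Function.update x p.1 c ∈ T) :
    n * #S ≤ #T := by
  have h : #(S ×ˢ (univ : Finset (Fin n))) ≤ #T := by
    refine card_le_card_of_injOn (fun y => Function.update y.1 p.1 y.2) ?_ ?_
    · rintro ⟨x, c⟩ hx
      simp only [coe_product, Set.mem_prod, mem_coe] at hx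
      exact hT x hx.1 c
    · rintro ⟨x, c⟩ hx ⟨y, d⟩ hy hxy
      simp only [coe_product, Set.mem_prod, mem_coe] at hx hy hxy
      have hcd : c = d := by simpa using congrFun hxy p.1
      have hxy' : x = y := by
        funext j
        by_cases hj : j = p.1
        · rw [hj, hS x hx.1, hS y hy.1]
        · simpa [hj] using congrFun hxy j
      rw [hcd, hxy']
  simpa [card_product, mul_comm] using h

open Finset in
lemma card_filter_apply_eq_le {k n : ℕ} (hk : 1 ≤ k) (hn : 0 < n) (F : Finset (Fin k → Fin n))
    (p : Fin k × Fin n) : #{x ∈ F | x p.1 = p.2} ≤ n ^ (k - 1) := by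
  have h := mul_card_le_card_of_update_mem {x ∈ F | x p.1 = p.2} univ p
    (fun x hx => (mem_filter.1 hx).2) (fun _ _ _ => mem_univ _)
  have h2 : #(univ : Finset (Fin k → Fin n)) = n * n ^ (k - 1) := by
    rw [← pow_succ', Nat.sub_add_cancel hk]
    simp
  rw [h2] at h
  exact Nat.le_of_mul_le_mul_left h hn

open Finset in
lemma mul_card_filter_apply_eq_and_le {k n : ℕ} (hk : 1 ≤ k) (hn : 0 < n)
    (F : Finset (Fin k → Fin n)) (p q : Fin k × Fin n) (hpq : p ≠ q) :
    n * #{x ∈ F | x p.1 = p.2 ∧ x q.1 = q.2} ≤ n ^ (k - 1) := by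
  by_cases h1 : p.1 = q.1
  · have h2 : p.2 ≠ q.2 := fun h => hpq (Prod.ext h1 h)
    have h3 : #{x ∈ F | x p.1 = p.2 ∧ x q.1 = q.2} = 0 := by
      rw [card_eq_zero, filter_eq_empty_iff]
      rintro x - ⟨ha, hb⟩
      rw [← h1] at hb
      exact h2 (ha.symm.trans hb)
    simp [h3]
  · refine (mul_card_le_card_of_update_mem _ {x ∈ univ | x p.1 = p.2} q
      (fun x hx => (mem_filter.1 hx).2.2) (fun x hx c => ?_)).trans
      (card_filter_apply_eq_le hk hn univ p)
    simp only [mem_filter, mem_univ, true_and] at hx ⊢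
    rw [Function.update_of_ne h1]
    exact hx.2.1

open Finset in
lemma exists_mem_forall_ne_of_sum_lt {k n : ℕ} (F : Finset (Fin k → Fin n))
    (W : Finset (Fin k × Fin n)) (h : ∑ w ∈ W, #{x ∈ F | x w.1 = w.2} < #F) :
    ∃ x ∈ F, ∀ w ∈ W, x w.1 ≠ w.2 := by
  by_contra! hc
  refine absurd h (not_lt.2 ((card_le_card (t := W.biUnion fun w => {x ∈ F | x w.1 = w.2})
    fun x hx => ?_).trans card_biUnion_le))
  obtain ⟨w, hw, hxw⟩ := hc x hx
  exact mem_biUnion.2 ⟨w, hw, mem_filter.2 ⟨hx, hxw⟩⟩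

open Finset in
lemma exists_mem_forall_ne_of_card_mul_lt {k n : ℕ} (hk : 1 ≤ k) (hn : 0 < n)
    (F : Finset (Fin k → Fin n)) (W : Finset (Fin k × Fin n)) (h : #W * n ^ (k - 1) < #F) :
    ∃ x ∈ F, ∀ w ∈ W, x w.1 ≠ w.2 := by
  refine exists_mem_forall_ne_of_sum_lt F W (lt_of_le_of_lt ?_ h)
  rw [← smul_eq_mul]
  exact sum_le_card_nsmul _ _ _ fun w _ => card_filter_apply_eq_le hk hn F w

/-- The coordinate-value pairs contained in more than `K * n ^ (k - 2)` tuples of `F`. -/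
def popularPairs {k n : ℕ} (K : ℕ) (F : Finset (Fin k → Fin n)) : Finset (Fin k × Fin n) :=
  {p | K * n ^ (k - 1) < n * (F.filter fun x => x p.1 = p.2).card}

open Finset in
/-- A family with a popular pair `v` has a member avoiding any few pairs other than `v`. -/
lemma exists_mem_forall_ne_of_mem_popularPairs {k n K : ℕ} (hk : 1 ≤ k) (hn : 0 < n)
    (F : Finset (Fin k → Fin n)) {v : Fin k × Fin n} (hv : v ∈ popularPairs K F)
    (W : Finset (Fin k × Fin n)) (hW : #W ≤ K) (hvW : v ∉ W) :
    ∃ x ∈ F, ∀ w ∈ W, x w.1 ≠ w.2 := by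
  have hv' : K * n ^ (k - 1) < n * #{x ∈ F | x v.1 = v.2} := by
    simpa [popularPairs] using hv
  obtain ⟨x, hx, hxW⟩ := exists_mem_forall_ne_of_sum_lt {x ∈ F | x v.1 = v.2} W (by
    refine Nat.lt_of_mul_lt_mul_left (lt_of_le_of_lt ?_ hv')
    rw [mul_sum]
    refine (sum_le_card_nsmul _ _ (n ^ (k - 1)) fun w hw => ?_).trans ?_
    · rw [filter_filter]
      exact mul_card_filter_apply_eq_and_le hk hn F v w (fun h => hvW (h ▸ hw))
    · rw [smul_eq_mul]
      gcongr)
  exact ⟨x, (mem_filter.1 hx).1, hxW⟩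

open Finset in
/-- A family that is large compared to its number of popular pairs has a member avoiding any
few pairs. -/
lemma exists_mem_forall_ne_of_card_popularPairs {k n K : ℕ} (hk : 1 ≤ k) (hn : 0 < n)
    (hK : K * K ≤ n) (F : Finset (Fin k → Fin n))
    (hF : (#(popularPairs K F) + 1) * n ^ (k - 1) < #F)
    (W : Finset (Fin k × Fin n)) (hW : #W ≤ K) :
    ∃ x ∈ F, ∀ w ∈ W, x w.1 ≠ w.2 := by
  set H := popularPairs K F with hH
  obtain ⟨x, hx, hxW⟩ := exists_mem_forall_ne_of_sum_lt F (H ∪ (W \ H)) (by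
    refine lt_of_le_of_lt ?_ hF
    rw [sum_union disjoint_sdiff, add_mul, one_mul]
    refine add_le_add ?_ ?_
    · rw [← smul_eq_mul]
      exact sum_le_card_nsmul _ _ _ fun w _ => card_filter_apply_eq_le hk hn F w
    · refine Nat.le_of_mul_le_mul_left ?_ hn
      rw [mul_sum]
      refine (sum_le_card_nsmul _ _ (K * n ^ (k - 1)) fun w hw => ?_).trans ?_
      · have := (mem_sdiff.1 hw).2
        simpa [hH, popularPairs] using this
      · rw [smul_eq_mul, ← mul_assoc]
        gcongr
        exact (Nat.mul_le_mul_right K ((card_le_card sdiff_subset).trans hW)).trans hK)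
  refine ⟨x, hx, fun w hw => hxW w ?_⟩
  by_cases h : w ∈ H <;> simp [h, hw]

open Finset in
/-- Greedy choice of a rainbow matching, where each family `F i` can avoid any few pairs outside
its reserved set `V i`. -/
lemma exists_matching_of_reserved {ι : Type*} [DecidableEq ι] {s k n : ℕ} (hk : 1 ≤ k) (hn : 0 < n)
    (F : ι → Finset (Fin k → Fin n)) (V : ι → Finset (Fin k × Fin n)) (S : Finset ι)
    (hF : ∀ i ∈ S, ∀ W : Finset (Fin k × Fin n), #W ≤ (s - 1) * k → Disjoint W (V i) →
      ∃ x ∈ F i, ∀ w ∈ W, x w.1 ≠ w.2)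
    (hV : ∀ i ∈ S, #(V i) ≤ 1)
    (hVd : ∀ i ∈ S, ∀ i' ∈ S, i ≠ i' → Disjoint (V i) (V i'))
    (Q : Finset (Fin k → Fin n)) (hQ : ∀ q ∈ Q, ∀ i ∈ S, ∀ w ∈ V i, q w.1 ≠ w.2)
    (hQS : #Q + #S ≤ s) :
    ∃ g : ι → Fin k → Fin n, (∀ i ∈ S, g i ∈ F i) ∧
      (∀ i ∈ S, ∀ q ∈ Q, ∀ j, g i j ≠ q j) ∧
      ∀ i ∈ S, ∀ i' ∈ S, i ≠ i' → ∀ j, g i j ≠ g i' j := by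
  induction S using Finset.induction_on generalizing Q with
  | empty => exact ⟨fun _ _ => ⟨0, hn⟩, by simp⟩
  | insert a S ha ih =>
    rw [card_insert_of_notMem ha] at hQS
    let W := S.biUnion V ∪ Q.biUnion fun q => univ.image fun j => (j, q j)
    have hWc : #W ≤ (s - 1) * k := by
      have h1 : #(S.biUnion V) ≤ #S * 1 :=
        card_biUnion_le_card_mul _ _ _ fun i hi => hV i (mem_insert_of_mem hi)
      have h2 : #(Q.biUnion fun q => univ.image fun j => (j, q j)) ≤ #Q * k :=
        card_biUnion_le_card_mul _ _ _ fun q _ => card_image_le.trans (by simp)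
      calc #W ≤ #S * 1 + #Q * k := (card_union_le _ _).trans (add_le_add h1 h2)
        _ ≤ #S * k + #Q * k := by gcongr
        _ = (#S + #Q) * k := by ring
        _ ≤ (s - 1) * k := by gcongr; omega
    have hWd : Disjoint W (V a) := by
      refine disjoint_union_left.2 ⟨(disjoint_biUnion_left _ _ _).2 fun i hi => ?_,
        (disjoint_biUnion_left _ _ _).2 fun q hq => ?_⟩
      · exact hVd i (mem_insert_of_mem hi) a (mem_insert_self _ _) (fun h => ha (h ▸ hi))
      · rw [disjoint_left]
        intro w hw hwa
        obtain ⟨j, -, rfl⟩ := mem_image.1 hw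
        exact hQ q hq a (mem_insert_self _ _) _ hwa rfl
    obtain ⟨x, hx, hxW⟩ := hF a (mem_insert_self _ _) W hWc hWd
    obtain ⟨g, hg, hgQ, hgd⟩ := ih (fun i hi => hF i (mem_insert_of_mem hi))
      (fun i hi => hV i (mem_insert_of_mem hi))
      (fun i hi i' hi' => hVd i (mem_insert_of_mem hi) i' (mem_insert_of_mem hi'))
      (insert x Q) (by
        intro q hq i hi w hw
        rcases mem_insert.1 hq with rfl | hq
        · exact hxW w (mem_union_left _ (mem_biUnion.2 ⟨i, hi, hw⟩))
        · exact hQ q hq i (mem_insert_of_mem hi) w hw)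
      (by have := card_insert_le x Q; omega)
    have hne : ∀ i ∈ S, i ≠ a := fun i hi h => ha (h ▸ hi)
    refine ⟨Function.update g a x, ?_, ?_, ?_⟩
    · intro i hi
      rcases mem_insert.1 hi with rfl | hi
      · simpa using hx
      · rw [Function.update_of_ne (hne i hi)]
        exact hg i hi
    · intro i hi q hq j
      rcases mem_insert.1 hi with rfl | hi
      · rw [Function.update_self]
        exact hxW (j, q j) (mem_union_right _
          (mem_biUnion.2 ⟨q, hq, mem_image_of_mem _ (mem_univ j)⟩))
      · rw [Function.update_of_ne (hne i hi)]
        exact hgQ i hi q (mem_insert_of_mem hq) j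
    · intro i hi i' hi' hii j
      rcases mem_insert.1 hi with rfl | hiS <;> rcases mem_insert.1 hi' with rfl | hiS'
      · exact absurd rfl hii
      · rw [Function.update_self, Function.update_of_ne (hne i' hiS')]
        exact (hgQ i' hiS' x (mem_insert_self _ _) j).symm
      · rw [Function.update_self, Function.update_of_ne (hne i hiS)]
        exact hgQ i hiS x (mem_insert_self _ _) j
      · rw [Function.update_of_ne (hne i hiS), Function.update_of_ne (hne i' hiS')]
        exact hgd i hiS i' hiS' hii j

open Finset in
/-- Distinct representatives for sets of sizes at least `1, 2, …, s - 1, s - 1`. -/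
lemma exists_injOn_mem_of_min_le_card {α : Type*} [DecidableEq α] [Nonempty α] {s : ℕ}
    (H : Fin s → Finset α) (A : Finset (Fin s)) (hA : ∀ i ∈ A, min (s - 1) (i + 1) ≤ #(H i))
    (hU : A ≠ univ ∨ s ≤ #(univ.biUnion H)) :
    ∃ v : Fin s → α, Set.InjOn v A ∧ ∀ i ∈ A, v i ∈ H i := by
  obtain ⟨f, hf, hfH⟩ := (all_card_le_biUnion_card_iff_exists_injective
    (fun i : A => H i)).1 (by
      intro B
      rcases B.eq_empty_or_nonempty with rfl | hB
      · simp
      obtain ⟨m, hm, hmax⟩ := B.exists_max_image (fun i => (i : Fin s)) hB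
      have h1 : #(H m) ≤ #(B.biUnion fun i => H i) :=
        card_le_card (subset_biUnion_of_mem (fun i : A => H i) hm)
      have h2 := hA m m.2
      have h3 : #B ≤ m + 1 := by
        rw [← card_map (Function.Embedding.subtype _)]
        refine (card_le_card (t := Iic (m : Fin s)) fun i hi => ?_).trans (by simp)
        obtain ⟨j, hj, rfl⟩ := mem_map.1 hi
        exact mem_Iic.2 (hmax j hj)
      by_cases h4 : #B ≤ s - 1
      · omega
      have h5 : B.map (Function.Embedding.subtype _) = univ := by
        rw [← card_eq_iff_eq_univ, card_map, Fintype.card_fin]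
        omega
      have h6 : A = univ := by
        refine eq_univ_of_forall fun i => ?_
        obtain ⟨j, -, rfl⟩ := mem_map.1 (h5 ▸ mem_univ i)
        exact j.2
      have h7 := hU.resolve_left (not_not.2 h6)
      have h8 : B.biUnion (fun i => H i) = univ.biUnion H := by
        rw [← h5, map_eq_image, image_biUnion]
        rfl
      rw [h8]
      omega)
  refine ⟨fun i => if h : i ∈ A then f ⟨i, h⟩ else Classical.arbitrary α, ?_, ?_⟩
  · intro i hi j hj hij
    have hi' : i ∈ A := hi
    have hj' : j ∈ A := hj
    simp only [hi', hj', dif_pos] at hij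
    simpa using hf hij
  · intro i hi
    simpa [hi] using hfH ⟨i, hi⟩

open Finset in
/-- Theorem 5.1: the sequence `f_i = min(s-1, i)·n^{k-1}` is satisfying for `n ≥ k²s²`. -/
theorem stmt15 (s k n : ℕ) (hs : 1 ≤ s) (hk : 1 ≤ k) (hn : k ^ 2 * s ^ 2 ≤ n)
    (F : Fin s → Finset (Fin k → Fin n))
    (hF : ∀ i : Fin s, min (s - 1) ((i : ℕ) + 1) * n ^ (k - 1) < (F i).card) :
    ∃ g : Fin s → (Fin k → Fin n), (∀ i, g i ∈ F i) ∧
      ∀ i i', i ≠ i' → ∀ j, g i j ≠ g i' j := by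
  have hn0 : 0 < n := lt_of_lt_of_le (by positivity) hn
  have hK : ((s - 1) * k) * ((s - 1) * k) ≤ n := by
    calc ((s - 1) * k) * ((s - 1) * k) ≤ (s * k) * (s * k) := by gcongr <;> omega
      _ = k ^ 2 * s ^ 2 := by ring
      _ ≤ n := hn
  have : Nonempty (Fin k × Fin n) := ⟨(⟨0, hk⟩, ⟨0, hn0⟩)⟩
  let H i := popularPairs ((s - 1) * k) (F i)
  let A : Finset (Fin s) := {i | min (s - 1) ((i : ℕ) + 1) ≤ #(H i)}
  have hA : ∀ i ∈ A, min (s - 1) ((i : ℕ) + 1) ≤ #(H i) := fun i hi => (mem_filter.1 hi).2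
  by_cases hU : A ≠ univ ∨ s ≤ #(univ.biUnion H)
  · obtain ⟨v, hv, hvH⟩ := exists_injOn_mem_of_min_le_card H A hA hU
    obtain ⟨g, hg, -, hgd⟩ := exists_matching_of_reserved (s := s) hk hn0 F
      (fun i => if i ∈ A then {v i} else ∅) univ (by
        intro i _ W hW hWd
        by_cases hi : i ∈ A
        · simp only [hi, if_true, disjoint_singleton_right] at hWd
          exact exists_mem_forall_ne_of_mem_popularPairs hk hn0 (F i) (hvH i hi) W hW hWd
        · refine exists_mem_forall_ne_of_card_popularPairs hk hn0 hK (F i)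
            (lt_of_le_of_lt ?_ (hF i)) W hW
          have hi' : #(H i) < min (s - 1) ((i : ℕ) + 1) := not_le.1 fun h => hi (mem_filter.2 ⟨mem_univ i, h⟩)
          exact Nat.mul_le_mul_right _ hi')
      (by intro i _; split_ifs <;> simp)
      (by
        intro i _ j _ hij
        by_cases hi : i ∈ A <;> by_cases hj : j ∈ A <;> simp [hi, hj]
        exact fun h => hij (hv hi hj h))
      ∅ (by simp) (by simp)
    exact ⟨g, fun i => hg i (mem_univ i), fun i i' => hgd i (mem_univ i) i' (mem_univ i')⟩
  · push Not at hU
    obtain ⟨hAu, hUc⟩ := hU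
    let l : Fin s := ⟨s - 1, by omega⟩
    obtain ⟨x, hx, hxU⟩ := exists_mem_forall_ne_of_card_mul_lt hk hn0 (F l) (univ.biUnion H)
      (lt_of_le_of_lt (Nat.mul_le_mul_right _ (by simp only [l]; omega)) (hF l))
    obtain ⟨v, hv, hvH⟩ := exists_injOn_mem_of_min_le_card H (univ.erase l)
      (fun i _ => hA i (hAu ▸ mem_univ i))
      (Or.inl fun h => notMem_erase l univ (by rw [h]; exact mem_univ l))
    obtain ⟨g, hg, hgx, hgd⟩ := exists_matching_of_reserved (s := s) hk hn0 F
      (fun i => {v i}) (univ.erase l) (by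
        intro i hi W hW hWd
        exact exists_mem_forall_ne_of_mem_popularPairs hk hn0 (F i) (hvH i hi) W hW
          (disjoint_singleton_right.1 hWd))
      (by simp)
      (by
        intro i hi j hj hij
        exact disjoint_singleton.2 fun h => hij (hv hi hj h))
      {x} (by
        intro q hq i hi w hw
        rw [mem_singleton.1 hq, mem_singleton.1 hw]
        exact hxU _ (mem_biUnion.2 ⟨i, mem_univ i, hvH i hi⟩))
      (by
        rw [card_singleton, card_erase_of_mem (mem_univ l), card_univ, Fintype.card_fin]
        omega)
    have hmem : ∀ i, i ≠ l → i ∈ univ.erase l := fun i hi => mem_erase.2 ⟨hi, mem_univ i⟩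
    refine ⟨Function.update g l x, fun i => ?_, fun i i' hii j => ?_⟩
    · by_cases hi : i = l
      · rw [hi, Function.update_self]
        exact hx
      · rw [Function.update_of_ne hi]
        exact hg i (hmem i hi)
    · by_cases hi : i = l
      · have hi' : i' ≠ l := fun h => hii (hi.trans h.symm)
        rw [hi, Function.update_self, Function.update_of_ne hi']
        exact (hgx i' (hmem i' hi') x (mem_singleton_self x) j).symm
      · by_cases hi' : i' = l
        · rw [hi', Function.update_self, Function.update_of_ne hi]
          exact hgx i (hmem i hi) x (mem_singleton_self x) j
        · rw [Function.update_of_ne hi, Function.update_of_ne hi']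
          exact hgd i (hmem i hi) i' (hmem i' hi') hii j
end

section
/- Let n, k, s be positive integers and let F_1, …, F_s ⊆ [n]^k be cross-dependent families. Suppose that for some i ∈ [s], j ∈ [k] and a ∈ [n] we have |H_j(a) ∩ F_i| > (s−1)·(k−1)·n^{k−2}. Then the families F_1, …, F_{i−1}, F_i ∪ H_j(a), F_{i+1}, …, F_s are also cross-dependent. -/
theorem card_filter_two_coords_le {n k : ℕ} {j j' : Fin k} (h : j' ≠ j) (a b : Fin n) :
    (Finset.univ.filter (fun x : Fin k → Fin n => x j = a ∧ x j' = b)).card ≤ n ^ (k - 2) := by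
  let t : Fin k → Finset (Fin n) := fun l =>
    if l = j then {a} else if l = j' then {b} else Finset.univ
  have hsub : Finset.univ.filter (fun x : Fin k → Fin n => x j = a ∧ x j' = b) ⊆
      Fintype.piFinset t := by
    intro x hx
    simp only [Finset.mem_filter, Finset.mem_univ, true_and] at hx
    rw [Fintype.mem_piFinset]
    intro l
    by_cases h1 : l = j
    · subst h1; simp [t, hx.1]
    · by_cases h2 : l = j'
      · subst h2; simp [t, h1, hx.2]
      · simp [t, h1, h2]
  refine (Finset.card_le_card hsub).trans_eq ?_
  have hmem : j' ∈ Finset.univ.erase j := by simp [h]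
  rw [Fintype.card_piFinset, ← Finset.mul_prod_erase Finset.univ _ (Finset.mem_univ j),
    ← Finset.mul_prod_erase _ _ hmem]
  have hrest : ∀ l ∈ (Finset.univ.erase j).erase j', (t l).card = n := by
    intro l hl
    simp only [Finset.mem_erase] at hl
    simp [t, hl.1, hl.2.1]
  rw [Finset.prod_congr rfl hrest, Finset.prod_const, Finset.card_erase_of_mem hmem,
    Finset.card_erase_of_mem (Finset.mem_univ j), Finset.card_univ, Fintype.card_fin,
    Nat.sub_sub]
  simp [t, h]

/-- Claim 5.2: if `F_1, …, F_s` are cross-dependent and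
`|H_j(a) ∩ F_i| > (s-1)(k-1)n^{k-2}`, then `F_1, …, F_i ∪ H_j(a), …, F_s`
are also cross-dependent. -/
theorem stmt16 (n k s : ℕ) (hn : 1 ≤ n) (hk : 1 ≤ k) (hs : 1 ≤ s)
    (F : Fin s → Finset (Fin k → Fin n))
    (hdep : ¬ ∃ g : Fin s → (Fin k → Fin n), (∀ i, g i ∈ F i) ∧
      ∀ i i', i ≠ i' → ∀ j, g i j ≠ g i' j)
    (i : Fin s) (j : Fin k) (a : Fin n)
    (hH : (s - 1) * (k - 1) * n ^ (k - 2) <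
      ((Finset.univ.filter (fun x : Fin k → Fin n => x j = a)) ∩ F i).card) :
    ¬ ∃ g : Fin s → (Fin k → Fin n),
      (∀ i', g i' ∈
        Function.update F i (F i ∪ Finset.univ.filter (fun x : Fin k → Fin n => x j = a)) i') ∧
      ∀ i1 i2, i1 ≠ i2 → ∀ j', g i1 j' ≠ g i2 j' := by
  rintro ⟨g, hg, hdisj⟩
  have hgF : ∀ i', i' ≠ i → g i' ∈ F i' := fun i' hi' => by
    simpa [Function.update_of_ne hi'] using hg i'
  have hgi : g i ∈ F i ∨ g i j = a := by simpa using hg i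
  rcases hgi with hgi | hgi
  · refine hdep ⟨g, fun i' => ?_, hdisj⟩
    by_cases h : i' = i
    · exact h ▸ hgi
    · exact hgF i' h
  let B := (Finset.univ.erase i ×ˢ Finset.univ.erase j).biUnion fun p =>
    Finset.univ.filter (fun x : Fin k → Fin n => x j = a ∧ x p.2 = g p.1 p.2)
  have hB : B.card ≤ (s - 1) * (k - 1) * n ^ (k - 2) := by
    refine (Finset.card_biUnion_le_card_mul _ _ (n ^ (k - 2)) fun p hp => ?_).trans_eq ?_
    · simp only [Finset.mem_product, Finset.mem_erase] at hp
      exact card_filter_two_coords_le hp.2.1 _ _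
    · simp [Finset.card_product]
  obtain ⟨x, hx, hxB⟩ := Finset.exists_mem_notMem_of_card_lt_card (hB.trans_lt hH)
  simp only [Finset.mem_inter, Finset.mem_filter, Finset.mem_univ, true_and] at hx
  have hxg : ∀ i', i' ≠ i → ∀ j', x j' ≠ g i' j' := by
    intro i' hi' j' heq
    by_cases hj : j' = j
    · subst hj
      exact hdisj i' i hi' j' (by rw [← heq, hx.1, hgi])
    · exact hxB (Finset.mem_biUnion.2 ⟨(i', j'), by simp [hi', hj], by simp [hx.1, heq]⟩)
  refine hdep ⟨Function.update g i x, fun i' => ?_, fun i₁ i₂ hne j' => ?_⟩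
  · by_cases h : i' = i
    · subst h; simpa using hx.2
    · simpa [h] using hgF i' h
  · by_cases h₁ : i₁ = i
    · subst h₁
      simpa [hne.symm] using hxg i₂ hne.symm j'
    · by_cases h₂ : i₂ = i
      · subst h₂
        simpa [h₁] using (hxg i₁ h₁ j').symm
      · simpa [h₁, h₂] using hdisj i₁ i₂ hne j'
end
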